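/- arXiv:math/0402172 — 5 statements merged into one kernel-verified Lean document; each statement's English description precedes it below -/
import Mathlib

section
/- Let κ : (0,∞) → ℂ be continuous, and suppose there are positive constants c₀, c_∞ and non-negative constants α₀, α_∞ such that c₀^{-1} ξ^{α₀} ≤ Re κ(ξ) ≤ c₀ ξ^{α₀} for 0 < ξ ≤ 1 and c_∞^{-1} ξ^{α_∞} ≤ Re κ(ξ) ≤ c_∞ ξ^{α_∞} for ξ ≥ 1. For h > 0, u ∈ ℝ, ξ > 0 define g̃_{h,u,ξ}(x) = exp{iξ(x−u)/h − (x−u)²/(2hκ(ξ))}, ẽ_{h,u,ξ} = g̃_{h,u,ξ}/‖g̃_{h,u,ξ}‖₂, and (Ẽ_h φ)(x) = h^{−1/2} ∫_{ℝ²₊} φ(u,ξ) ẽ_{h,u,ξ}(x) du dξ for φ continuous with compact support in ℝ²₊. Then there exists a constant C, depending only on κ, c₀, c_∞, α₀, α_∞, such that ‖Ẽ_h φ‖_{L²(ℝ)} ≤ C ‖φ‖_{L²(ℝ²₊)} for all such φ and all h > 0. -/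
open MeasureTheory
open scoped ENNReal

/-- The twisted FBI Gaussian with `ξ`-dependent width
`g̃_{h,u,ξ}(x) = exp{iξ(x-u)/h - (x-u)²/(2hκ(ξ))}`. -/
noncomputable def twistedGaussianVar (κ : ℝ → ℂ) (h u ξ : ℝ) (x : ℝ) : ℂ :=
  Complex.exp (Complex.I * (ξ:ℂ) * ((x:ℂ) - (u:ℂ)) / (h:ℂ)
    - ((x:ℂ) - (u:ℂ))^2 / (2 * (h:ℂ) * κ ξ))

/-- Its `L²`-normalization `ẽ_{h,u,ξ}`. -/
noncomputable def twistedCoherentStateVar (κ : ℝ → ℂ) (h u ξ : ℝ) (x : ℝ) : ℂ :=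
  twistedGaussianVar κ h u ξ x
    / ((eLpNorm (twistedGaussianVar κ h u ξ) 2 volume).toReal : ℂ)

section Fourier

open FourierTransform

/-- The Fourier transform is self-adjoint, tested against a Schwartz function. -/
theorem integral_fourier_schwartz_mul_eq (ψ : SchwartzMap ℝ ℂ) {f : ℝ → ℂ} (hf : Integrable f) :
    ∫ x, (𝓕 ψ) x • f x = ∫ x, ψ x • 𝓕 f x := by
  have e := VectorFourier.integral_fourierIntegral_smul_eq_flip (L := innerₗ ℝ)
    (f := ψ) (g := f) (μ := volume) (ν := volume)
    Real.continuous_fourierChar continuous_inner ψ.integrable hf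
  rw [flip_innerₗ] at e
  exact e

theorem ae_eq_fourier_of_integral_schwartz_eq {f F : ℝ → ℂ} (hf : Integrable f)
    (hF : LocallyIntegrable F)
    (h : ∀ ψ : SchwartzMap ℝ ℂ, ∫ x, (𝓕 ψ) x • f x = ∫ x, ψ x • F x) :
    F =ᵐ[volume] 𝓕 f := by
  have hc : Continuous (𝓕 f) :=
    VectorFourier.fourierIntegral_continuous Real.continuous_fourierChar
      (innerSL ℝ).continuous₂ hf
  refine ae_eq_of_integral_contDiff_smul_eq hF hc.locallyIntegrable fun g hg hgs => ?_
  have hg' : ContDiff ℝ ((⊤ : ℕ∞) : WithTop ℕ∞) (fun x => (g x : ℂ)) :=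
    Complex.ofRealCLM.contDiff.comp hg
  have hgs' : HasCompactSupport (fun x => (g x : ℂ)) :=
    hgs.comp_left (g := Complex.ofReal) Complex.ofReal_zero
  obtain ⟨ψ, hψ⟩ : ∃ ψ : SchwartzMap ℝ ℂ, ∀ x, ψ x = (g x : ℂ) :=
    ⟨hgs'.toSchwartzMap hg', by simp⟩
  have e (G : ℝ → ℂ) : ∫ x, g x • G x = ∫ x, ψ x • G x := by simp [hψ]
  rw [e, e, ← h, integral_fourier_schwartz_mul_eq ψ hf]

theorem fourier_toLp_ae_eq {f : ℝ → ℂ} (hf : Integrable f) (hf2 : MemLp f 2) :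
    ((𝓕 (hf2.toLp f) : Lp (α := ℝ) ℂ 2) : ℝ → ℂ) =ᵐ[volume] 𝓕 f := by
  refine ae_eq_fourier_of_integral_schwartz_eq hf
    (MemLp.locallyIntegrable (Lp.memLp _) one_le_two) fun ψ => ?_
  have key := congrArg (fun T => T ψ) (Lp.fourier_toTemperedDistribution_eq (hf2.toLp f))
  simp only [TemperedDistribution.fourier_apply, Lp.toTemperedDistribution_apply] at key
  rw [← key]
  refine integral_congr_ae ?_
  filter_upwards [hf2.coeFn_toLp] with x hx
  rw [hx]

/-- **Plancherel's theorem** for functions in `L¹ ∩ L²` of the real line. -/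
theorem eLpNorm_fourier_eq {f : ℝ → ℂ} (hf : Integrable f) (hf2 : MemLp f 2) :
    eLpNorm (𝓕 f) 2 volume = eLpNorm f 2 volume := by
  rw [← eLpNorm_congr_ae (fourier_toLp_ae_eq hf hf2), ← eLpNorm_congr_ae hf2.coeFn_toLp]
  have h := Lp.norm_fourier_eq (hf2.toLp f)
  rw [Lp.norm_def, Lp.norm_def] at h
  exact (ENNReal.toReal_eq_toReal_iff' (Lp.eLpNorm_ne_top _) (Lp.eLpNorm_ne_top _)).1 h

theorem norm_twistedGaussianVar (κ : ℝ → ℂ) (h u ξ x : ℝ) :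
    ‖twistedGaussianVar κ h u ξ x‖ =
      Real.exp (-((κ ξ)⁻¹.re / (2 * h)) * (x - u) ^ 2) := by
  rw [twistedGaussianVar, Complex.norm_exp]
  congr 1
  have e : Complex.I * (ξ:ℂ) * ((x:ℂ) - (u:ℂ)) / (h:ℂ) - ((x:ℂ) - (u:ℂ))^2 / (2 * (h:ℂ) * κ ξ)
      = ((ξ * (x - u) / h : ℝ) : ℂ) * Complex.I
        - (((x - u) ^ 2 / (2 * h) : ℝ) : ℂ) * (κ ξ)⁻¹ := by
    push_cast
    rw [← div_div, div_eq_mul_inv _ (κ ξ)]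
    ring
  rw [e, Complex.sub_re, Complex.re_ofReal_mul, Complex.re_ofReal_mul, Complex.I_re]
  ring

theorem inv_re_pos {z : ℂ} (hz : 0 < z.re) : 0 < (z⁻¹).re := by
  rw [Complex.inv_re]
  exact div_pos hz (Complex.normSq_pos.2 fun h => by simp [h] at hz)

theorem eLpNorm_twistedGaussianVar {κ : ℝ → ℂ} {h ξ : ℝ} (hh : 0 < h) (hκ : 0 < (κ ξ).re)
    (u : ℝ) :
    eLpNorm (twistedGaussianVar κ h u ξ) 2 volume =
      ENNReal.ofReal √√(Real.pi * h / (κ ξ)⁻¹.re) := by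
  have hr := inv_re_pos hκ
  rw [eLpNorm_eq_lintegral_rpow_enorm_toReal (by simp) (by simp)]
  have hi : ∫⁻ x, ‖twistedGaussianVar κ h u ξ x‖ₑ ^ (ENNReal.toReal 2) =
      ENNReal.ofReal √(Real.pi * h / (κ ξ)⁻¹.re) := by
    have e : ∀ x, ‖twistedGaussianVar κ h u ξ x‖ₑ ^ (ENNReal.toReal 2) =
        ENNReal.ofReal (Real.exp (-((κ ξ)⁻¹.re / h) * (x - u) ^ 2)) := fun x => by
      rw [← ofReal_norm, norm_twistedGaussianVar, ENNReal.toReal_ofNat,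
        ENNReal.ofReal_rpow_of_nonneg (by positivity) (by norm_num), ← Real.exp_mul]
      congr 2
      field_simp
    simp_rw [e]
    rw [lintegral_sub_right_eq_self
      (fun x => ENNReal.ofReal (Real.exp (-((κ ξ)⁻¹.re / h) * x ^ 2))),
      ← ofReal_integral_eq_lintegral_ofReal (integrable_exp_neg_mul_sq (by positivity))
        (.of_forall fun x => by positivity), integral_gaussian]
    congr 2
    field_simp
  rw [hi, ENNReal.toReal_ofNat, ENNReal.ofReal_rpow_of_nonneg (by positivity) (by norm_num),
    Real.sqrt_eq_rpow √_]

theorem integrable_twistedGaussianVar {κ : ℝ → ℂ} {h ξ : ℝ} (hh : 0 < h) (hκ : 0 < (κ ξ).re)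
    (u : ℝ) : Integrable (twistedGaussianVar κ h u ξ) := by
  have hr := inv_re_pos hκ
  have h1 : Integrable (fun x : ℝ => Real.exp (-((κ ξ)⁻¹.re / (2 * h)) * (x - u) ^ 2)) :=
    (integrable_exp_neg_mul_sq (by positivity)).comp_sub_right u
  refine h1.mono' ?_ (.of_forall fun x => (norm_twistedGaussianVar ..).le)
  unfold twistedGaussianVar
  exact Continuous.aestronglyMeasurable (by fun_prop)

theorem integral_norm_twistedGaussianVar (κ : ℝ → ℂ) (h u ξ : ℝ) :
    ∫ x, ‖twistedGaussianVar κ h u ξ x‖ = √(Real.pi / ((κ ξ)⁻¹.re / (2 * h))) := by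
  simp_rw [norm_twistedGaussianVar]
  rw [integral_sub_right_eq_self
    (fun x : ℝ => Real.exp (-((κ ξ)⁻¹.re / (2 * h)) * x ^ 2)), integral_gaussian]

theorem fourier_twistedGaussianVar {κ : ℝ → ℂ} {h ξ : ℝ} (hh : 0 < h) (hκ : 0 < (κ ξ).re)
    (u η : ℝ) :
    𝓕 (twistedGaussianVar κ h u ξ) η =
      Complex.exp ((-2 * Real.pi * u * η : ℝ) * Complex.I) *
      ((2 * Real.pi * h * κ ξ) ^ (1 / 2 : ℂ) *
        Complex.exp (((-((ξ - 2 * Real.pi * h * η) ^ 2 / (2 * h)) : ℝ) : ℂ) * κ ξ)) := by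
  have hk : κ ξ ≠ 0 := fun h => by simp [h] at hκ
  have hh' : (h : ℂ) ≠ 0 := by exact_mod_cast hh.ne'
  have hb : (-(1 / (2 * h) : ℝ) * (κ ξ)⁻¹ : ℂ).re < 0 := by
    rw [← Complex.ofReal_neg, Complex.re_ofReal_mul]
    have := inv_re_pos hκ
    have : 0 < 1 / (2 * h) * (κ ξ)⁻¹.re := by positivity
    linarith
  rw [Real.fourier_real_eq_integral_exp_smul]
  have e : ∀ x : ℝ, Complex.exp (↑(-2 * Real.pi * x * η) * Complex.I) •
      twistedGaussianVar κ h u ξ x = Complex.exp ((-(1 / (2 * h) : ℝ) * (κ ξ)⁻¹ : ℂ) * x ^ 2 +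
        (Complex.I * ξ / h + u / (h * κ ξ) - 2 * Real.pi * Complex.I * η) * x +
        (-(Complex.I * ξ * u / h) - u ^ 2 / (2 * h * κ ξ))) := fun x => by
    rw [twistedGaussianVar, smul_eq_mul, ← Complex.exp_add]
    congr 1
    push_cast
    field_simp
    ring
  simp_rw [e]
  rw [integral_cexp_quadratic hb, mul_left_comm (Complex.exp (↑(-2 * Real.pi * u * η) * Complex.I)),
    ← Complex.exp_add]
  congr 2
  · push_cast
    field_simp
  · push_cast
    field_simp
    ring_nf
    simp only [Complex.I_sq]
    ring

theorem fourier_twistedCoherentStateVar_eq_div (κ : ℝ → ℂ) (h u ξ η : ℝ) :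
    𝓕 (twistedCoherentStateVar κ h u ξ) η = 𝓕 (twistedGaussianVar κ h u ξ) η /
      ((eLpNorm (twistedGaussianVar κ h u ξ) 2 volume).toReal : ℂ) := by
  simp_rw [Real.fourier_real_eq_integral_exp_smul, twistedCoherentStateVar, smul_eq_mul,
    ← mul_div_assoc, integral_div]

theorem fourier_twistedCoherentStateVar {κ : ℝ → ℂ} {h ξ : ℝ} (hh : 0 < h)
    (hκ : 0 < (κ ξ).re) (u η : ℝ) :
    𝓕 (twistedCoherentStateVar κ h u ξ) η =
      Complex.exp ((-2 * Real.pi * u * η : ℝ) * Complex.I) *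
        𝓕 (twistedCoherentStateVar κ h 0 ξ) η := by
  simp only [fourier_twistedCoherentStateVar_eq_div, fourier_twistedGaussianVar hh hκ,
    eLpNorm_twistedGaussianVar hh hκ, mul_div_assoc]
  simp

theorem norm_fourier_twistedCoherentStateVar_sq {κ : ℝ → ℂ} {h ξ : ℝ} (hh : 0 < h)
    (hκ : 0 < (κ ξ).re) (η : ℝ) :
    ‖𝓕 (twistedCoherentStateVar κ h 0 ξ) η‖ ^ 2 = 2 * √Real.pi * h *
      (√((κ ξ).re / h) * Real.exp (-((κ ξ).re / h) * (ξ - 2 * Real.pi * h * η) ^ 2)) := by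
  have hk : κ ξ ≠ 0 := fun h => by simp [h] at hκ
  have hr := inv_re_pos hκ
  have hn : 0 < ‖κ ξ‖ := norm_pos_iff.2 hk
  have hpi := Real.pi_pos
  rw [fourier_twistedCoherentStateVar_eq_div, fourier_twistedGaussianVar hh hκ,
    eLpNorm_twistedGaussianVar hh hκ, ENNReal.toReal_ofReal (by positivity), norm_div, norm_mul,
    norm_mul, Complex.norm_exp_ofReal_mul_I, one_mul, Complex.norm_real, div_pow,
    Real.norm_of_nonneg (by positivity), Real.sq_sqrt (by positivity), mul_pow,
    Complex.norm_exp, Complex.re_ofReal_mul, ← Real.exp_nat_mul]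
  have e1 : ‖(2 * Real.pi * h * κ ξ : ℂ) ^ (1 / 2 : ℂ)‖ ^ 2 = 2 * Real.pi * h * ‖κ ξ‖ := by
    rw [← norm_pow, ← Complex.cpow_nat_mul]
    simp [abs_of_pos hpi, abs_of_pos hh]
  have e2 : √(Real.pi * h / (κ ξ)⁻¹.re) = √Real.pi * ‖κ ξ‖ / √((κ ξ).re / h) := by
    rw [eq_div_iff (by positivity), ← Real.sqrt_mul (by positivity), Complex.inv_re,
      Complex.normSq_eq_norm_sq, ← Real.sqrt_sq hn.le, ← Real.sqrt_mul hpi.le, Real.sqrt_sq hn.le]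
    congr 1
    field_simp
  have e3 : Real.pi = √Real.pi * √Real.pi := (Real.mul_self_sqrt hpi.le).symm
  have e4 : ((2 : ℕ) : ℝ) * (-((ξ - 2 * Real.pi * h * η) ^ 2 / (2 * h)) * (κ ξ).re) =
      -((κ ξ).re / h) * (ξ - 2 * Real.pi * h * η) ^ 2 := by
    push_cast
    field_simp
  rw [e1, e2, e4]
  generalize Real.exp _ = E
  rw [div_div_eq_mul_div, div_eq_iff (by positivity)]
  nth_rw 1 [e3]
  ring

section PowerLaw

open Set

theorem lintegral_Ioi_sqrt_rpow_mul_exp {a l b : ℝ} (ha : 0 ≤ a) (hl : 0 < l) (hb : 0 < b) :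
    ∫⁻ ξ in Ioi (0 : ℝ), ENNReal.ofReal (√l * (ξ ^ (a / 2) * Real.exp (-(b * l) * ξ ^ (a + 2)))) =
      ENNReal.ofReal (√Real.pi / (√b * (a + 2))) := by
  rw [← ofReal_integral_eq_lintegral_ofReal]
  · rw [integral_const_mul, integral_rpow_mul_exp_neg_mul_rpow (by linarith) (by linarith)
      (by positivity), show (a / 2 + 1) / (a + 2) = 1 / 2 by field_simp,
      show -(a / 2 + 1) / (a + 2) = -(1 / 2) by field_simp, Real.Gamma_one_half_eq,
      Real.rpow_neg (by positivity), ← Real.sqrt_eq_rpow, Real.sqrt_mul hb.le]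
    congr 1
    field_simp
  · exact (integrableOn_rpow_mul_exp_neg_mul_rpow (by linarith) (by linarith)
      (by positivity)).const_mul _
  · filter_upwards [ae_restrict_mem measurableSet_Ioi] with ξ hξ
    have : (0 : ℝ) < ξ := hξ
    positivity

theorem lintegral_sqrt_mul_exp_neg_mul_sq {p q : ℝ} (hp : 0 ≤ p) (hq : 0 < q) (η : ℝ) :
    ∫⁻ ξ : ℝ, ENNReal.ofReal (√p * Real.exp (-q * (ξ - η) ^ 2)) =
      ENNReal.ofReal √(p * Real.pi / q) := by
  rw [← ofReal_integral_eq_lintegral_ofReal, integral_const_mul,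
    integral_sub_right_eq_self (fun x : ℝ => Real.exp (-q * x ^ 2)), integral_gaussian,
    ← Real.sqrt_mul hp, mul_div_assoc]
  · exact ((integrable_exp_neg_mul_sq hq).comp_sub_right η).const_mul _
  · exact .of_forall fun ξ => by positivity

/-- Away from the diagonal, i.e. where `|ξ - η| ≥ ξ / 2`, the weighted Gaussian is dominated by a
function independent of `η`. -/
theorem sqrt_mul_exp_le_of_far {a c l η ξ : ℝ} (hc : 0 < c) (hl : 0 < l) (hξ : 0 < ξ)
    (hfar : ξ / 2 ≤ |ξ - η|) :
    √(l * ξ ^ a) * Real.exp (-(c * (l * ξ ^ a)) * (ξ - η) ^ 2) ≤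
      √l * (ξ ^ (a / 2) * Real.exp (-(c / 4 * l) * ξ ^ (a + 2))) := by
  have h1 : √(ξ ^ a) = ξ ^ (a / 2) := by
    rw [Real.sqrt_eq_rpow, ← Real.rpow_mul hξ.le]
    ring_nf
  rw [Real.sqrt_mul hl.le, h1, mul_assoc]
  gcongr √l * (_ * Real.exp ?_)
  have h2 : (ξ / 2) ^ 2 ≤ (ξ - η) ^ 2 := by
    rw [← sq_abs (ξ - η)]
    gcongr
  have h3 : ξ ^ (a + 2) = ξ ^ a * ξ ^ 2 := by
    rw [Real.rpow_add hξ, Real.rpow_two]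
  have h4 : c * (l * ξ ^ a) * (ξ / 2) ^ 2 ≤ c * (l * ξ ^ a) * (ξ - η) ^ 2 := by gcongr
  rw [h3]
  linarith

/-- Near the diagonal the weighted Gaussian is dominated by one of constant width. -/
theorem sqrt_mul_exp_le_of_near {a c l η ξ : ℝ} (ha : 0 ≤ a) (hc : 0 < c) (hl : 0 < l)
    (hξ : 0 < ξ) (hnear : |ξ - η| < ξ / 2) :
    √(l * ξ ^ a) * Real.exp (-(c * (l * ξ ^ a)) * (ξ - η) ^ 2) ≤
      √(l * (2 * η) ^ a) * Real.exp (-(c * (l * (2 * η / 3) ^ a)) * (ξ - η) ^ 2) := by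
  obtain ⟨h1, h2⟩ := abs_lt.1 hnear
  have hη : 0 < η := by linarith
  have e1 : ξ ^ a ≤ (2 * η) ^ a := Real.rpow_le_rpow hξ.le (by linarith) ha
  have e2 : (2 * η / 3) ^ a ≤ ξ ^ a := Real.rpow_le_rpow (by positivity) (by linarith) ha
  gcongr

/-- Uniform boundedness in `l > 0` and `η` of the integral of the Gaussian of power-law width. -/
theorem lintegral_Ioi_rpow_gaussian_le {a c : ℝ} (ha : 0 ≤ a) (hc : 0 < c) {l : ℝ} (hl : 0 < l)
    (η : ℝ) :
    ∫⁻ ξ in Ioi (0 : ℝ), ENNReal.ofReal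
        (√(l * ξ ^ a) * Real.exp (-(c * (l * ξ ^ a)) * (ξ - η) ^ 2)) ≤
      ENNReal.ofReal (√Real.pi / (√(c / 4) * (a + 2)) + √(3 ^ a * Real.pi / c)) := by
  rw [ENNReal.ofReal_add (by positivity) (by positivity),
    ← lintegral_Ioi_sqrt_rpow_mul_exp ha hl (by positivity : 0 < c / 4)]
  rcases le_or_gt η 0 with hη | hη
  · refine le_add_right (setLIntegral_mono' measurableSet_Ioi fun ξ hξ => ?_)
    have hξ : 0 < ξ := hξ
    refine ENNReal.ofReal_le_ofReal (sqrt_mul_exp_le_of_far hc hl hξ ?_)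
    rw [abs_of_pos (by linarith)]
    linarith
  · have hB : ∫⁻ ξ in Ioi (0 : ℝ), ENNReal.ofReal (√(l * (2 * η) ^ a) *
        Real.exp (-(c * (l * (2 * η / 3) ^ a)) * (ξ - η) ^ 2)) ≤
          ENNReal.ofReal √(3 ^ a * Real.pi / c) := by
      refine (setLIntegral_le_lintegral _ _).trans ?_
      rw [lintegral_sqrt_mul_exp_neg_mul_sq (by positivity) (by positivity),
        Real.div_rpow (by positivity) (by norm_num)]
      refine le_of_eq ?_
      congr 2
      field_simp
    refine le_trans ?_ (add_le_add_right hB _)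
    rw [← lintegral_add_left (by fun_prop)]
    refine setLIntegral_mono' measurableSet_Ioi fun ξ hξ => ?_
    have hξ : 0 < ξ := hξ
    rcases le_or_gt (ξ / 2) |ξ - η| with h | h
    · exact le_add_right (ENNReal.ofReal_le_ofReal (sqrt_mul_exp_le_of_far hc hl hξ h))
    · exact le_add_left (ENNReal.ofReal_le_ofReal (sqrt_mul_exp_le_of_near ha hc hl hξ h))

theorem sqrt_mul_exp_le_of_comparable {r c w h y : ℝ} (hc : 0 < c) (hh : 0 < h)
    (hr : c⁻¹ * w ≤ r ∧ r ≤ c * w) :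
    √(r / h) * Real.exp (-(r / h) * y ^ 2) ≤
      √c * (√(h⁻¹ * w) * Real.exp (-(c⁻¹ * (h⁻¹ * w)) * y ^ 2)) := by
  rw [← mul_assoc, ← Real.sqrt_mul hc.le]
  have e1 : r / h ≤ c * (h⁻¹ * w) := by
    rw [div_eq_inv_mul, mul_left_comm c]
    gcongr
    exact hr.2
  have e2 : c⁻¹ * (h⁻¹ * w) ≤ r / h := by
    rw [div_eq_inv_mul, mul_left_comm c⁻¹]
    gcongr
    exact hr.1
  gcongr

theorem exists_lintegral_gaussian_le {r : ℝ → ℝ} {c₀ c_inf α₀ α_inf : ℝ}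
    (hc₀ : 0 < c₀) (hcinf : 0 < c_inf) (hα₀ : 0 ≤ α₀) (hαinf : 0 ≤ α_inf)
    (hbound₀ : ∀ ξ : ℝ, 0 < ξ → ξ ≤ 1 → c₀⁻¹ * ξ ^ α₀ ≤ r ξ ∧ r ξ ≤ c₀ * ξ ^ α₀)
    (hboundinf : ∀ ξ : ℝ, 1 ≤ ξ → c_inf⁻¹ * ξ ^ α_inf ≤ r ξ ∧ r ξ ≤ c_inf * ξ ^ α_inf) :
    ∃ M : ℝ, 0 < M ∧ ∀ h : ℝ, 0 < h → ∀ η : ℝ,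
      ∫⁻ ξ in Ioi (0 : ℝ), ENNReal.ofReal (√(r ξ / h) * Real.exp (-(r ξ / h) * (ξ - η) ^ 2)) ≤
        ENNReal.ofReal M := by
  refine ⟨√c₀ * (√Real.pi / (√(c₀⁻¹ / 4) * (α₀ + 2)) + √(3 ^ α₀ * Real.pi / c₀⁻¹)) +
    √c_inf * (√Real.pi / (√(c_inf⁻¹ / 4) * (α_inf + 2)) + √(3 ^ α_inf * Real.pi / c_inf⁻¹)),
    by positivity, fun h hh η => ?_⟩
  rw [ENNReal.ofReal_add (by positivity) (by positivity), ENNReal.ofReal_mul (by positivity),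
    ENNReal.ofReal_mul (by positivity)]
  refine le_trans ?_ (add_le_add
    (mul_le_mul_right (lintegral_Ioi_rpow_gaussian_le hα₀ (inv_pos.2 hc₀) (inv_pos.2 hh) η) _)
    (mul_le_mul_right (lintegral_Ioi_rpow_gaussian_le hαinf (inv_pos.2 hcinf) (inv_pos.2 hh) η) _))
  rw [← lintegral_const_mul _ (by fun_prop), ← lintegral_const_mul _ (by fun_prop),
    ← lintegral_add_left (by fun_prop)]
  refine setLIntegral_mono' measurableSet_Ioi fun ξ hξ => ?_
  have hξ : 0 < ξ := hξ
  rw [← ENNReal.ofReal_mul (by positivity), ← ENNReal.ofReal_mul (by positivity)]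
  rcases le_total ξ 1 with h1 | h1
  · exact le_add_right (ENNReal.ofReal_le_ofReal
      (sqrt_mul_exp_le_of_comparable hc₀ hh (hbound₀ ξ hξ h1)))
  · exact le_add_left (ENNReal.ofReal_le_ofReal
      (sqrt_mul_exp_le_of_comparable hcinf hh (hboundinf ξ h1)))

end PowerLaw

theorem measurable_twistedGaussianVar {κ : ℝ → ℂ} (hκ : Measurable κ) (h : ℝ) :
    Measurable fun q : (ℝ × ℝ) × ℝ => twistedGaussianVar κ h q.1.1 q.1.2 q.2 := by
  unfold twistedGaussianVar
  have : Measurable fun q : (ℝ × ℝ) × ℝ => κ q.1.2 := hκ.comp (by fun_prop)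
  fun_prop

theorem twistedCoherentStateVar_eq_div {κ : ℝ → ℂ} {h ξ : ℝ} (hh : 0 < h) (hκ : 0 < (κ ξ).re)
    (u x : ℝ) :
    twistedCoherentStateVar κ h u ξ x =
      twistedGaussianVar κ h u ξ x / (√√(Real.pi * h / (κ ξ)⁻¹.re) : ℝ) := by
  rw [twistedCoherentStateVar, eLpNorm_twistedGaussianVar hh hκ,
    ENNReal.toReal_ofReal (by positivity)]

theorem measurable_twistedCoherentStateVar {κ : ℝ → ℂ} (hκ : Measurable κ)
    (hpos : ∀ ξ, 0 < (κ ξ).re) {h : ℝ} (hh : 0 < h) :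
    Measurable fun q : (ℝ × ℝ) × ℝ => twistedCoherentStateVar κ h q.1.1 q.1.2 q.2 := by
  simp_rw [twistedCoherentStateVar_eq_div hh (hpos _)]
  refine (measurable_twistedGaussianVar hκ h).div ?_
  have : Measurable fun q : (ℝ × ℝ) × ℝ => κ q.1.2 := hκ.comp (by fun_prop)
  fun_prop

theorem integrable_norm_mul_of_continuousOn_Ioi {φ : ℝ × ℝ → ℂ} (hφ : Continuous φ)
    (hφs : HasCompactSupport φ) (hφt : tsupport φ ⊆ {p : ℝ × ℝ | 0 < p.2}) {w : ℝ → ℝ}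
    (hw : ContinuousOn w (Set.Ioi 0)) :
    Integrable fun p : ℝ × ℝ => ‖φ p‖ * w p.2 := by
  rw [← integrableOn_iff_integrable_of_support_subset (s := tsupport φ)]
  · refine ContinuousOn.integrableOn_compact hφs ?_
    exact hφ.norm.continuousOn.mul (hw.comp continuousOn_snd fun p hp => hφt hp)
  · intro p hp
    refine subset_tsupport φ fun h0 => hp ?_
    simp [h0]

theorem continuousOn_inv_re {κ : ℝ → ℂ} {s : Set ℝ} (hκ : ContinuousOn κ s)
    (hpos : ∀ ξ, 0 < (κ ξ).re) : ContinuousOn (fun ξ => (κ ξ)⁻¹.re) s :=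
  Complex.continuous_re.comp_continuousOn
    (hκ.inv₀ fun ξ _ h0 => by simpa [h0] using hpos ξ)

theorem lintegral_mul_sq_le {α : Type*} [MeasurableSpace α] {μ : Measure α} {f g : α → ℝ≥0∞}
    (hf : AEMeasurable f μ) (hg : AEMeasurable g μ) :
    (∫⁻ a, f a * g a ∂μ) ^ 2 ≤ (∫⁻ a, f a ^ 2 ∂μ) * ∫⁻ a, g a ^ 2 ∂μ := by
  have H := ENNReal.lintegral_mul_le_Lp_mul_Lq μ Real.HolderConjugate.two_two hf hg
  calc (∫⁻ a, f a * g a ∂μ) ^ 2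
      ≤ ((∫⁻ a, f a ^ (2 : ℝ) ∂μ) ^ (1 / 2 : ℝ) * (∫⁻ a, g a ^ (2 : ℝ) ∂μ) ^ (1 / 2 : ℝ)) ^ 2 :=
        pow_le_pow_left' H 2
    _ = _ := by
        rw [mul_pow, ← ENNReal.rpow_mul_natCast, ← ENNReal.rpow_mul_natCast]
        norm_num

theorem eLpNorm_two_sq_eq_lintegral {α : Type*} [MeasurableSpace α] {μ : Measure α} (f : α → ℂ) :
    eLpNorm f 2 μ ^ 2 = ∫⁻ a, ‖f a‖ₑ ^ 2 ∂μ := by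
  have := eLpNorm_nnreal_pow_eq_lintegral (f := f) (μ := μ) (p := 2) two_ne_zero
  simpa using this

theorem restrict_upperHalfPlane_eq_prod :
    (volume : Measure (ℝ × ℝ)).restrict {p | 0 < p.2} =
      (volume : Measure ℝ).prod (volume.restrict (Set.Ioi 0)) := by
  have : {p : ℝ × ℝ | 0 < p.2} = Set.univ ×ˢ Set.Ioi 0 := by ext; simp
  rw [this, Measure.volume_eq_prod, ← Measure.prod_restrict, Measure.restrict_univ]

section Bound

variable {κ : ℝ → ℂ} {h : ℝ} {φ : ℝ × ℝ → ℂ}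

theorem integrable_mul_twistedCoherentStateVar (hκm : Measurable κ) (hpos : ∀ ξ, 0 < (κ ξ).re)
    (hκ : ContinuousOn κ (Set.Ioi 0)) (hh : 0 < h) (hφ : Continuous φ)
    (hφs : HasCompactSupport φ) (hφt : tsupport φ ⊆ {p : ℝ × ℝ | 0 < p.2}) :
    Integrable (fun q : (ℝ × ℝ) × ℝ => φ q.1 * twistedCoherentStateVar κ h q.1.1 q.1.2 q.2)
      (((volume : Measure ℝ).prod (volume.restrict (Set.Ioi 0))).prod volume) := by
  have hr := continuousOn_inv_re hκ hpos
  rw [integrable_prod_iff]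
  · refine ⟨.of_forall fun p => ?_, ?_⟩
    · simp_rw [twistedCoherentStateVar_eq_div hh (hpos _)]
      exact ((integrable_twistedGaussianVar hh (hpos _) _).div_const _).const_mul _
    · have e : ∀ p : ℝ × ℝ, ∫ x, ‖φ p * twistedCoherentStateVar κ h p.1 p.2 x‖ =
          ‖φ p‖ * (√(Real.pi / ((κ p.2)⁻¹.re / (2 * h))) /
            √√(Real.pi * h / (κ p.2)⁻¹.re)) := fun p => by
        simp_rw [twistedCoherentStateVar_eq_div hh (hpos _), norm_mul, norm_div, Complex.norm_real,
          Real.norm_of_nonneg (Real.sqrt_nonneg _)]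
        rw [integral_const_mul, integral_div, integral_norm_twistedGaussianVar]
      simp_rw [e]
      rw [← restrict_upperHalfPlane_eq_prod]
      refine (integrable_norm_mul_of_continuousOn_Ioi hφ hφs hφt (w := fun ξ =>
        √(Real.pi / ((κ ξ)⁻¹.re / (2 * h))) / √√(Real.pi * h / (κ ξ)⁻¹.re)) ?_).integrableOn
      have h1 : ∀ ξ ∈ Set.Ioi (0 : ℝ), (κ ξ)⁻¹.re ≠ 0 := fun ξ _ => (inv_re_pos (hpos ξ)).ne'
      refine (continuousOn_const.div (hr.div_const _) fun ξ hξ =>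
        div_ne_zero (h1 ξ hξ) (by positivity)).sqrt.div
        (continuousOn_const.div hr h1).sqrt.sqrt fun ξ _ => ?_
      have := inv_re_pos (hpos ξ)
      have := Real.pi_pos
      positivity
  · exact ((hφ.measurable.comp measurable_fst).mul
      (measurable_twistedCoherentStateVar hκm hpos hh)).aestronglyMeasurable

theorem exists_norm_integral_mul_twistedCoherentStateVar_le (hpos : ∀ ξ, 0 < (κ ξ).re)
    (hκ : ContinuousOn κ (Set.Ioi 0)) (hh : 0 < h) (hφ : Continuous φ)
    (hφs : HasCompactSupport φ) (hφt : tsupport φ ⊆ {p : ℝ × ℝ | 0 < p.2}) :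
    ∃ B : ℝ, ∀ x, ‖∫ p, φ p * twistedCoherentStateVar κ h p.1 p.2 x
      ∂((volume : Measure ℝ).prod (volume.restrict (Set.Ioi 0)))‖ ≤ B := by
  have hr := continuousOn_inv_re hκ hpos
  refine ⟨_, fun x => norm_integral_le_of_norm_le
    (g := fun p => ‖φ p‖ * (√√(Real.pi * h / (κ p.2)⁻¹.re))⁻¹) ?_ (.of_forall fun p => ?_)⟩
  · rw [← restrict_upperHalfPlane_eq_prod]
    refine (integrable_norm_mul_of_continuousOn_Ioi hφ hφs hφt
      (w := fun ξ => (√√(Real.pi * h / (κ ξ)⁻¹.re))⁻¹) ?_).integrableOn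
    have h1 : ∀ ξ ∈ Set.Ioi (0 : ℝ), (κ ξ)⁻¹.re ≠ 0 := fun ξ _ => (inv_re_pos (hpos ξ)).ne'
    refine (continuousOn_const.div hr h1).sqrt.sqrt.inv₀ fun ξ _ => ?_
    have hr := inv_re_pos (hpos ξ)
    exact (Real.sqrt_pos.2 (Real.sqrt_pos.2 (div_pos (by positivity) hr))).ne'
  · rw [norm_mul, twistedCoherentStateVar_eq_div hh (hpos _), norm_div, Complex.norm_real,
      Real.norm_of_nonneg (Real.sqrt_nonneg _), norm_twistedGaussianVar, div_eq_mul_inv]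
    refine mul_le_mul_of_nonneg_left (mul_le_of_le_one_left (by positivity) ?_) (norm_nonneg _)
    rw [Real.exp_le_one_iff]
    have := inv_re_pos (hpos p.2)
    have : 0 ≤ (κ p.2)⁻¹.re / (2 * h) * (x - p.1) ^ 2 := by positivity
    linarith

/-- The Fourier transform of the superposition of coherent states is an integral over the
frequency variable only. -/
theorem fourier_integral_mul_twistedCoherentStateVar (hpos : ∀ ξ, 0 < (κ ξ).re) (hh : 0 < h)
    (hi : Integrable
      (fun q : (ℝ × ℝ) × ℝ => φ q.1 * twistedCoherentStateVar κ h q.1.1 q.1.2 q.2)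
      (((volume : Measure ℝ).prod (volume.restrict (Set.Ioi 0))).prod volume)) (η : ℝ) :
    𝓕 (fun x => ∫ p, φ p * twistedCoherentStateVar κ h p.1 p.2 x
      ∂((volume : Measure ℝ).prod (volume.restrict (Set.Ioi 0)))) η =
      ∫ ξ in Set.Ioi 0, 𝓕 (twistedCoherentStateVar κ h 0 ξ) η * 𝓕 (fun u => φ (u, ξ)) η := by
  have hi2 : Integrable (fun q : (ℝ × ℝ) × ℝ =>
      Complex.exp (↑(-2 * Real.pi * q.2 * η) * Complex.I) •
        (φ q.1 * twistedCoherentStateVar κ h q.1.1 q.1.2 q.2))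
      (((volume : Measure ℝ).prod (volume.restrict (Set.Ioi 0))).prod volume) := by
    refine hi.norm.mono' ?_ (.of_forall fun q => ?_)
    · have hc : Continuous fun q : (ℝ × ℝ) × ℝ =>
          Complex.exp (↑(-2 * Real.pi * q.2 * η) * Complex.I) := by fun_prop
      exact hc.aestronglyMeasurable.smul hi.aestronglyMeasurable
    · rw [norm_smul, Complex.norm_exp_ofReal_mul_I, one_mul]
  have e : ∀ p : ℝ × ℝ, ∫ x : ℝ, Complex.exp (↑(-2 * Real.pi * x * η) * Complex.I) •
      (φ p * twistedCoherentStateVar κ h p.1 p.2 x) =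
      𝓕 (twistedCoherentStateVar κ h 0 p.2) η *
        (Complex.exp (↑(-2 * Real.pi * p.1 * η) * Complex.I) • φ p) := fun p => by
    simp_rw [smul_eq_mul, mul_left_comm _ (φ p)]
    rw [integral_const_mul]
    have := fourier_twistedCoherentStateVar hh (hpos p.2) p.1 η
    rw [Real.fourier_real_eq_integral_exp_smul] at this
    simp_rw [smul_eq_mul] at this
    rw [this]
    ring
  have hi3 := hi2.integral_prod_left
  simp_rw [e] at hi3
  rw [Real.fourier_real_eq_integral_exp_smul]
  simp_rw [← integral_smul]
  rw [← integral_integral_swap hi2]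
  simp_rw [e]
  rw [integral_prod_symm _ hi3]
  simp_rw [integral_const_mul, ← Real.fourier_real_eq_integral_exp_smul (fun u => φ (u, _))]

theorem measurable_fourier_slice (hφ : Continuous φ) :
    Measurable fun q : ℝ × ℝ => 𝓕 (fun u => φ (u, q.1)) q.2 := by
  simp_rw [Real.fourier_real_eq_integral_exp_smul]
  refine (StronglyMeasurable.integral_prod_right' (f := fun q : (ℝ × ℝ) × ℝ =>
    Complex.exp (↑(-2 * Real.pi * q.2 * q.1.2) * Complex.I) • φ (q.2, q.1.1)) ?_).measurable
  exact Continuous.stronglyMeasurable (by fun_prop)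

theorem measurable_fourier_twistedCoherentStateVar (hκm : Measurable κ)
    (hpos : ∀ ξ, 0 < (κ ξ).re) (hh : 0 < h) (η : ℝ) :
    Measurable fun ξ => 𝓕 (twistedCoherentStateVar κ h 0 ξ) η := by
  simp_rw [Real.fourier_real_eq_integral_exp_smul]
  refine (StronglyMeasurable.integral_prod_right' (f := fun q : ℝ × ℝ =>
    Complex.exp (↑(-2 * Real.pi * q.2 * η) * Complex.I) •
      twistedCoherentStateVar κ h 0 q.1 q.2) ?_).measurable
  have hc : Continuous fun q : ℝ × ℝ =>
      Complex.exp (↑(-2 * Real.pi * q.2 * η) * Complex.I) := by fun_prop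
  refine hc.stronglyMeasurable.smul (Measurable.stronglyMeasurable ?_)
  exact (measurable_twistedCoherentStateVar hκm hpos hh).comp
    (g := fun q : (ℝ × ℝ) × ℝ => twistedCoherentStateVar κ h q.1.1 q.1.2 q.2)
    (f := fun q : ℝ × ℝ => ((0, q.1), q.2)) (by fun_prop)

/-- Plancherel's theorem in the first variable, integrated over the second one. -/
theorem lintegral_fourier_slice_le (hφ : Continuous φ) (hφs : HasCompactSupport φ) :
    ∫⁻ η, ∫⁻ ξ in Set.Ioi 0, ‖𝓕 (fun u => φ (u, ξ)) η‖ₑ ^ 2 ≤ eLpNorm φ 2 volume ^ 2 := by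
  rw [lintegral_lintegral_swap (f := fun η ξ => ‖𝓕 (fun u => φ (u, ξ)) η‖ₑ ^ 2)
    (((measurable_fourier_slice hφ).comp measurable_swap).enorm.pow_const 2).aemeasurable,
    eLpNorm_two_sq_eq_lintegral, Measure.volume_eq_prod, lintegral_prod_symm _ (by fun_prop)]
  refine (setLIntegral_le_lintegral _ _).trans (lintegral_mono fun ξ => ?_)
  have hemb : Topology.IsClosedEmbedding (fun u : ℝ => (u, ξ)) :=
    Function.LeftInverse.isClosedEmbedding (f := Prod.fst) (fun u => rfl) continuous_fst
      (by fun_prop)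
  have hc : Continuous fun u => φ (u, ξ) := by fun_prop
  have hs : HasCompactSupport fun u => φ (u, ξ) := hφs.comp_isClosedEmbedding hemb
  rw [← eLpNorm_two_sq_eq_lintegral, ← eLpNorm_two_sq_eq_lintegral (fun u => φ (u, ξ)),
    eLpNorm_fourier_eq (hc.integrable_of_hasCompactSupport hs) (hc.memLp_of_hasCompactSupport hs)]

theorem eLpNorm_integral_mul_twistedCoherentStateVar_sq_le (hκm : Measurable κ)
    (hpos : ∀ ξ, 0 < (κ ξ).re) (hκ : ContinuousOn κ (Set.Ioi 0)) (hh : 0 < h) {M : ℝ}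
    (hM : ∀ η : ℝ, ∫⁻ ξ in Set.Ioi (0 : ℝ), ENNReal.ofReal
      (√((κ ξ).re / h) * Real.exp (-((κ ξ).re / h) * (ξ - η) ^ 2)) ≤ ENNReal.ofReal M)
    (hφ : Continuous φ) (hφs : HasCompactSupport φ)
    (hφt : tsupport φ ⊆ {p : ℝ × ℝ | 0 < p.2}) :
    eLpNorm (fun x => ∫ p in {p : ℝ × ℝ | 0 < p.2},
      φ p * twistedCoherentStateVar κ h p.1 p.2 x) 2 volume ^ 2 ≤
      ENNReal.ofReal (2 * √Real.pi * h * M) * eLpNorm φ 2 volume ^ 2 := by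
  rw [restrict_upperHalfPlane_eq_prod]
  have hi := integrable_mul_twistedCoherentStateVar hκm hpos hκ hh hφ hφs hφt
  obtain ⟨B, hB⟩ :=
    exists_norm_integral_mul_twistedCoherentStateVar_le hpos hκ hh hφ hφs hφt
  have hG := hi.integral_prod_right
  have hG2 : MemLp (fun x => ∫ p, φ p * twistedCoherentStateVar κ h p.1 p.2 x
      ∂((volume : Measure ℝ).prod (volume.restrict (Set.Ioi 0)))) 2 := by
    rw [memLp_two_iff_integrable_sq_norm hG.aestronglyMeasurable]
    refine (hG.norm.const_mul B).mono' (hG.aestronglyMeasurable.norm.pow 2)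
      (.of_forall fun x => ?_)
    rw [Real.norm_of_nonneg (by positivity), sq]
    exact mul_le_mul_of_nonneg_right (hB x) (norm_nonneg _)
  rw [← eLpNorm_fourier_eq hG hG2, eLpNorm_two_sq_eq_lintegral]
  refine le_trans ?_ (mul_le_mul_right (lintegral_fourier_slice_le hφ hφs) _)
  rw [← lintegral_const_mul _ (Measurable.lintegral_prod_right'
    (f := fun q : ℝ × ℝ => ‖𝓕 (fun u => φ (u, q.2)) q.1‖ₑ ^ 2)
    (((measurable_fourier_slice hφ).comp measurable_swap).enorm.pow_const 2))]
  refine lintegral_mono fun η => ?_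
  rw [fourier_integral_mul_twistedCoherentStateVar hpos hh hi]
  have hE : ∫⁻ ξ in Set.Ioi 0, ‖𝓕 (twistedCoherentStateVar κ h 0 ξ) η‖ₑ ^ 2 ≤
      ENNReal.ofReal (2 * √Real.pi * h * M) := by
    have e : ∀ ξ, ‖𝓕 (twistedCoherentStateVar κ h 0 ξ) η‖ₑ ^ 2 =
        ENNReal.ofReal (2 * √Real.pi * h) * ENNReal.ofReal (√((κ ξ).re / h) *
          Real.exp (-((κ ξ).re / h) * (ξ - 2 * Real.pi * h * η) ^ 2)) := fun ξ => by
      rw [← ofReal_norm, ← ENNReal.ofReal_pow (norm_nonneg _),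
        norm_fourier_twistedCoherentStateVar_sq hh (hpos ξ), ENNReal.ofReal_mul (by positivity)]
    simp_rw [e]
    rw [lintegral_const_mul _ (by fun_prop), ENNReal.ofReal_mul (q := M) (by positivity)]
    exact mul_le_mul_right (hM _) _
  refine le_trans ?_ (mul_le_mul_left hE _)
  refine le_trans (pow_le_pow_left' (enorm_integral_le_lintegral_enorm _) 2) ?_
  simp_rw [enorm_mul]
  exact lintegral_mul_sq_le
    (measurable_fourier_twistedCoherentStateVar hκm hpos hh η).enorm.aemeasurable
    ((measurable_fourier_slice hφ).comp (measurable_id.prodMk measurable_const)).enorm.aemeasurable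

end Bound

end Fourier

/-- Theorem 11 (generalized uniform boundedness of the twisted FBI transform): if
`Re κ(ξ)` is comparable to `ξ^{α₀}` near `0` and to `ξ^{α_∞}` near `∞`, then
`Ẽ_h φ = h^{-1/2} ∫_{ℝ²₊} φ(u,ξ) ẽ_{h,u,ξ} du dξ` is bounded from `L²(ℝ²₊)` to `L²(ℝ)`,
uniformly in `h > 0`. -/
theorem twistedFBI_bounded_general (κ : ℝ → ℂ)
    (hκcont : ContinuousOn κ (Set.Ioi 0))
    (c₀ c_inf : ℝ) (hc₀ : 0 < c₀) (hcinf : 0 < c_inf)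
    (α₀ α_inf : ℝ) (hα₀ : 0 ≤ α₀) (hαinf : 0 ≤ α_inf)
    (hbound₀ : ∀ ξ : ℝ, 0 < ξ → ξ ≤ 1 →
      c₀⁻¹ * ξ ^ α₀ ≤ (κ ξ).re ∧ (κ ξ).re ≤ c₀ * ξ ^ α₀)
    (hboundinf : ∀ ξ : ℝ, 1 ≤ ξ →
      c_inf⁻¹ * ξ ^ α_inf ≤ (κ ξ).re ∧ (κ ξ).re ≤ c_inf * ξ ^ α_inf) :
    ∃ C : ℝ, 0 < C ∧ ∀ h : ℝ, 0 < h →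
      ∀ φ : ℝ × ℝ → ℂ, Continuous φ → HasCompactSupport φ →
        tsupport φ ⊆ {p : ℝ × ℝ | 0 < p.2} →
        eLpNorm (fun x : ℝ => ((h ^ (-(1:ℝ)/2) : ℝ) : ℂ) *
            ∫ p in {p : ℝ × ℝ | 0 < p.2},
              φ p * twistedCoherentStateVar κ h p.1 p.2 x) 2 volume
          ≤ ENNReal.ofReal C * eLpNorm φ 2 volume := by
  classical
  obtain ⟨M, hM0, hM⟩ := exists_lintegral_gaussian_le (r := fun ξ => (κ ξ).re) hc₀ hcinf hα₀ hαinf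
    hbound₀ hboundinf
  have hpi := Real.pi_pos
  refine ⟨√(2 * √Real.pi * M), by positivity, fun h hh φ hφ hφs hφt => ?_⟩
  set κ' : ℝ → ℂ := (Set.Ioi (0 : ℝ)).piecewise κ (fun _ => 1) with hκ'
  have hpos' : ∀ ξ, 0 < ξ → 0 < (κ ξ).re := fun ξ hξ => by
    rcases le_total ξ 1 with h1 | h1
    · exact lt_of_lt_of_le (by positivity) (hbound₀ ξ hξ h1).1
    · exact lt_of_lt_of_le (by positivity) (hboundinf ξ h1).1
  have heq : ∀ ξ, 0 < ξ → κ' ξ = κ ξ := fun ξ hξ => Set.piecewise_eq_of_mem _ _ _ hξ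
  have hpos : ∀ ξ, 0 < (κ' ξ).re := fun ξ => by
    by_cases hξ : 0 < ξ
    · rw [heq ξ hξ]
      exact hpos' ξ hξ
    · rw [hκ', Set.piecewise_eq_of_notMem _ _ _ (by simpa using hξ)]
      simp
  have hcont : ContinuousOn κ' (Set.Ioi 0) := hκcont.congr fun ξ hξ => heq ξ hξ
  have hmeas : Measurable κ' :=
    hκcont.measurable_piecewise continuousOn_const measurableSet_Ioi
  have key := eLpNorm_integral_mul_twistedCoherentStateVar_sq_le hmeas hpos hcont hh (M := M)
    (fun η => by
      refine le_trans (le_of_eq ?_) (hM h hh η)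
      refine setLIntegral_congr_fun measurableSet_Ioi fun ξ hξ => ?_
      simp only [heq ξ hξ]) hφ hφs hφt
  have hG : ∀ x, ∫ p in {p : ℝ × ℝ | 0 < p.2}, φ p * twistedCoherentStateVar κ h p.1 p.2 x =
      ∫ p in {p : ℝ × ℝ | 0 < p.2}, φ p * twistedCoherentStateVar κ' h p.1 p.2 x := fun x => by
    refine setIntegral_congr_fun (measurableSet_lt measurable_const measurable_snd) fun p hp => ?_
    have hg : twistedGaussianVar κ h p.1 p.2 = twistedGaussianVar κ' h p.1 p.2 := by
      ext y
      simp only [twistedGaussianVar, heq p.2 hp]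
    simp only [twistedCoherentStateVar, hg]
  simp_rw [hG]
  rw [show (fun x : ℝ => ((h ^ (-(1:ℝ)/2) : ℝ) : ℂ) *
      ∫ p in {p : ℝ × ℝ | 0 < p.2}, φ p * twistedCoherentStateVar κ' h p.1 p.2 x) =
      ((h ^ (-(1:ℝ)/2) : ℝ) : ℂ) • fun x : ℝ =>
        ∫ p in {p : ℝ × ℝ | 0 < p.2}, φ p * twistedCoherentStateVar κ' h p.1 p.2 x from rfl,
    eLpNorm_const_smul]
  rw [← ENNReal.pow_le_pow_left_iff two_ne_zero, mul_pow, mul_pow]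
  refine (mul_le_mul_right key _).trans (le_of_eq ?_)
  rw [← mul_assoc]
  congr 1
  rw [← ofReal_norm, Complex.norm_real, Real.norm_of_nonneg (by positivity),
    ← ENNReal.ofReal_pow (by positivity), ← ENNReal.ofReal_pow (by positivity),
    Real.sq_sqrt (by positivity), ← ENNReal.ofReal_mul (by positivity),
    ← Real.rpow_mul_natCast hh.le]
  congr 1
  norm_num
  rw [Real.rpow_neg_one]
  field_simp
end

section
/- Let δ > 0, let F : [0, δ] → ℝ be a positive continuous function, let G : [0, δ] → ℂ be continuous, and let m be a non-negative even integer. Then lim_{h→0+} h^{−(m+1)} ∫_0^δ s^m G(s) exp(−s F(s)/h) ds = G(0) Γ(m+1) / F(0)^{m+1}. -/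
open MeasureTheory
open scoped Topology

/-- The Gamma integral with a natural exponent and a rate `b > 0`. -/
lemma integral_pow_mul_exp_neg_mul_Ioi (m : ℕ) {b : ℝ} (hb : 0 < b) :
    ∫ t in Set.Ioi (0 : ℝ), t ^ m * Real.exp (-(t * b)) =
      Real.Gamma ((m : ℝ) + 1) / b ^ ((m : ℝ) + 1) := by
  have h := Real.integral_rpow_mul_exp_neg_mul_Ioi (a := (m : ℝ) + 1) (by positivity) hb
  rw [one_div, Real.inv_rpow hb.le, inv_mul_eq_div] at h
  rw [← h]
  refine setIntegral_congr_fun measurableSet_Ioi fun t _ => ?_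
  simp [mul_comm]

lemma integrableOn_pow_mul_exp_neg_mul_Ioi (m : ℕ) {b : ℝ} (hb : 0 < b) :
    IntegrableOn (fun t : ℝ => t ^ m * Real.exp (-(t * b))) (Set.Ioi 0) := by
  have h := integrableOn_rpow_mul_exp_neg_mul_rpow (s := (m : ℝ)) (p := 1)
    (neg_one_lt_zero.trans_le m.cast_nonneg) one_pos hb
  refine h.congr_fun (fun t _ => ?_) measurableSet_Ioi
  simp [mul_comm]

/-- Rescaling `s = h * t` in the Laplace integral. -/
lemma rpow_smul_setIntegral_laplace_eq {E : Type*} [NormedAddCommGroup E] [NormedSpace ℝ E]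
    (δ : ℝ) (F : ℝ → ℝ) (G : ℝ → E) (m : ℕ) {h : ℝ} (hh : 0 < h) :
    h ^ (-((m : ℝ) + 1)) •
        ∫ s in Set.Icc 0 δ, (s ^ m * Real.exp (-(s * F s) / h)) • G s =
      ∫ t in Set.Ioi (0 : ℝ), (Set.Iic δ).indicator
        (fun s => (t ^ m * Real.exp (-(t * F s))) • G s) (h * t) := by
  have key := integral_comp_mul_left_Ioi' ((Set.Iic δ).indicator
    fun s => (s ^ m * Real.exp (-(s * F s) / h)) • G s) 0 hh
  rw [mul_zero, setIntegral_indicator measurableSet_Iic, Set.Ioi_inter_Iic] at key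
  rw [integral_Icc_eq_integral_Ioc, ← key, smul_smul, ← integral_smul]
  refine setIntegral_congr_fun measurableSet_Ioi fun t _ => ?_
  by_cases ht : h * t ∈ Set.Iic δ
  · have hpow : h ^ (-((m : ℝ) + 1)) = (h ^ (m + 1))⁻¹ := by
      rw [Real.rpow_neg hh.le, ← Nat.cast_succ, Real.rpow_natCast]
    have hexp : -(h * t * F (h * t)) / h = -(t * F (h * t)) := by field_simp
    simp only [Set.indicator_of_mem ht, smul_smul, hpow, hexp]
    congr 1
    field_simp
    ring
  · simp [Set.indicator_of_notMem ht]

/-- Laplace asymptotics at a boundary point, for phases bounded below by a positive constant and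
bounded amplitudes on the whole line. -/
lemma tendsto_laplace_of_continuous {E : Type*} [NormedAddCommGroup E] [NormedSpace ℝ E]
    [CompleteSpace E] {δ c C : ℝ} (hδ : 0 < δ) {F : ℝ → ℝ} (hF : Continuous F) (hc : 0 < c)
    (hcF : ∀ s, c ≤ F s) {G : ℝ → E} (hG : Continuous G) (hGC : ∀ s, ‖G s‖ ≤ C) (m : ℕ) :
    Filter.Tendsto
      (fun h : ℝ => h ^ (-((m : ℝ) + 1)) •
        ∫ s in Set.Icc 0 δ, (s ^ m * Real.exp (-(s * F s) / h)) • G s)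
      (𝓝[>] 0) (𝓝 ((Real.Gamma ((m : ℝ) + 1) / F 0 ^ ((m : ℝ) + 1)) • G 0)) := by
  have hlim : Filter.Tendsto
      (fun h : ℝ => ∫ t in Set.Ioi (0 : ℝ), (Set.Iic δ).indicator
        (fun s => (t ^ m * Real.exp (-(t * F s))) • G s) (h * t))
      (𝓝[>] 0) (𝓝 (∫ t in Set.Ioi (0 : ℝ), (t ^ m * Real.exp (-(t * F 0))) • G 0)) := by
    refine tendsto_integral_filter_of_dominated_convergence
      (fun t => t ^ m * Real.exp (-(t * c)) * C) ?_ ?_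
      ((integrableOn_pow_mul_exp_neg_mul_Ioi m hc).mul_const C) ?_
    · refine Filter.Eventually.of_forall fun h => ?_
      have hcont : Continuous fun t : ℝ =>
          (t ^ m * Real.exp (-(t * F (h * t)))) • G (h * t) := by fun_prop
      exact (hcont.aestronglyMeasurable.indicator
        (measurableSet_Iic.preimage (measurable_const_mul h)) :)
    · refine Filter.Eventually.of_forall fun h => ?_
      filter_upwards [ae_restrict_mem measurableSet_Ioi] with t ht
      have ht0 : (0 : ℝ) < t := ht
      refine (norm_indicator_le_norm_self _ _).trans ?_
      rw [norm_smul, Real.norm_of_nonneg (by positivity)]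
      gcongr
      · exact hcF _
      · exact hGC _
    · refine Filter.Eventually.of_forall fun t => ?_
      have hmul : Filter.Tendsto (fun h : ℝ => h * t) (𝓝[>] 0) (𝓝 0) := by
        simpa using ((continuous_mul_const t).tendsto 0).mono_left nhdsWithin_le_nhds
      have hcont : Continuous fun s => (t ^ m * Real.exp (-(t * F s))) • G s := by fun_prop
      refine ((hcont.tendsto 0).comp hmul).congr' ?_
      filter_upwards [hmul.eventually (Iic_mem_nhds hδ)] with h hh
      rw [Set.indicator_of_mem (Set.mem_Iic.2 hh), Function.comp_apply]
  rw [integral_smul_const, integral_pow_mul_exp_neg_mul_Ioi m (hc.trans_le (hcF 0))] at hlim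
  refine hlim.congr' ?_
  filter_upwards [self_mem_nhdsWithin] with h hh
  exact (rpow_smul_setIntegral_laplace_eq δ F G m hh).symm

/-- Lemma (Watson/Laplace asymptotics, boundary version): for positive continuous `F`,
continuous `G` and a non-negative even integer `m`,
`∫_0^δ s^m G(s) exp(-s F(s)/h) ds ∼ G(0) Γ(m+1) F(0)^{-(m+1)} h^{m+1}` as `h → 0+`. -/
theorem laplace_method_boundary (δ : ℝ) (hδ : 0 < δ)
    (F : ℝ → ℝ) (hFcont : ContinuousOn F (Set.Icc 0 δ))
    (hFpos : ∀ s ∈ Set.Icc 0 δ, 0 < F s)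
    (G : ℝ → ℂ) (hGcont : ContinuousOn G (Set.Icc 0 δ))
    (m : ℕ) (hm : Even m) :
    Filter.Tendsto
      (fun h : ℝ => (h ^ (-((m : ℝ) + 1))) •
        ∫ s in Set.Icc 0 δ,
          (s ^ m * Real.exp (-(s * F s) / h)) • G s)
      (𝓝[>] 0)
      (𝓝 ((Real.Gamma ((m : ℝ) + 1) / F 0 ^ ((m : ℝ) + 1)) • G 0)) := by
  have h0 : (0 : ℝ) ∈ Set.Icc 0 δ := ⟨le_rfl, hδ.le⟩
  obtain ⟨x, hx, hmin⟩ := isCompact_Icc.exists_isMinOn ⟨0, h0⟩ hFcont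
  obtain ⟨C, hC⟩ := isCompact_Icc.exists_bound_of_continuousOn hGcont
  have hlim := tendsto_laplace_of_continuous hδ
    (F := Set.IccExtend hδ.le ((Set.Icc 0 δ).domRestrict F))
    (G := Set.IccExtend hδ.le ((Set.Icc 0 δ).domRestrict G))
    hFcont.domRestrict.Icc_extend' (hFpos x hx)
    (fun s => hmin (Set.projIcc 0 δ hδ.le s).2)
    hGcont.domRestrict.Icc_extend' (fun s => hC _ (Set.projIcc 0 δ hδ.le s).2) m
  rw [Set.IccExtend_of_mem _ _ h0, Set.IccExtend_of_mem _ _ h0] at hlim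
  refine hlim.congr fun h => ?_
  congr 1
  refine setIntegral_congr_fun measurableSet_Icc fun s hs => ?_
  simp only [Set.IccExtend_of_mem _ _ hs, Set.domRestrict_apply]
end

section
/- Let γ₀ > 0 and let a, b, c : [0, γ₀] → ℂ be C^∞ with a(x) ≠ 0 for all x ∈ [0, γ₀]. Let (L_h f)(x) = −h² a(x) f″(x) − i h b(x) f′(x) + c(x) f(x) and σ(u,ξ) = a(u)ξ² + b(u)ξ + c(u). Let ξ ∈ ℂ with Im(ξ) > 0. Then for every positive integer n there exist δ ∈ (0, γ₀), constants c > 0 and C > 0, and for each h ∈ (0,1] a function f_h ∈ C^∞([0, γ₀]) vanishing on [δ, γ₀], such that: lim_{h→0+} ‖f_h‖ = c; ‖x f_h‖ ≤ C h; ‖−ih f_h′ − ξ f_h‖ ≤ C h; and ‖L_h f_h − σ(0,ξ) f_h‖ ≤ C h^{n+2} for all h ∈ (0,1]. -/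
open MeasureTheory
open scoped ENNReal Topology

open Polynomial in
lemma Polynomial.exists_derivative_eq (r : ℂ[X]) : ∃ v : ℂ[X], derivative v = r := by
  induction r using Polynomial.induction_on' with
  | add p q hp hq =>
    obtain ⟨v, rfl⟩ := hp
    obtain ⟨w, rfl⟩ := hq
    exact ⟨v + w, derivative_add⟩
  | monomial n c =>
    refine ⟨monomial (n + 1) (c / (n + 1)), ?_⟩
    have : (n : ℂ) + 1 ≠ 0 := Nat.cast_add_one_ne_zero n
    rw [derivative_monomial]
    simp [this]

open Polynomial in
lemma Polynomial.exists_first_order_ode {α β : ℂ} (hβ : β ≠ 0) (r : ℂ[X]) :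
    ∃ w : ℂ[X], C α * derivative w + C β * w = r := by
  suffices H : ∀ n : ℕ, ∀ r : ℂ[X], derivative^[n] r = 0 →
      ∃ w : ℂ[X], C α * derivative w + C β * w = r from
    H _ r (iterate_derivative_eq_zero (Nat.lt_succ_self _))
  intro n
  induction n with
  | zero => exact fun r hr => ⟨0, by simpa using hr.symm⟩
  | succ n ih =>
    intro r hr
    obtain ⟨w, hw⟩ := ih (derivative r) (by simpa using hr)
    refine ⟨C β⁻¹ * (r - C α * w), ?_⟩
    have hC : (C β * C β⁻¹ : ℂ[X]) = 1 := by rw [← C_mul, mul_inv_cancel₀ hβ, C_1]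
    simp only [derivative_C_mul, derivative_sub]
    linear_combination r * hC - (C α * C β⁻¹) * hw

open Polynomial in
/-- A constant coefficient operator `α ∂² + β ∂` with `α ≠ 0` is onto on polynomials. -/
lemma Polynomial.exists_second_order_ode {α : ℂ} (hα : α ≠ 0) (β : ℂ) (r : ℂ[X]) :
    ∃ v : ℂ[X], C α * derivative (derivative v) + C β * derivative v = r := by
  rcases eq_or_ne β 0 with rfl | hβ
  · obtain ⟨w, hw⟩ := exists_derivative_eq (C α⁻¹ * r)
    obtain ⟨v, rfl⟩ := exists_derivative_eq w
    refine ⟨v, ?_⟩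
    rw [hw, ← mul_assoc, ← C_mul, mul_inv_cancel₀ hα]
    simp
  · obtain ⟨w, hw⟩ := exists_first_order_ode (α := α) hβ r
    obtain ⟨v, rfl⟩ := exists_derivative_eq w
    exact ⟨v, hw⟩

open Polynomial in
/-- The substitution `x = h s`, where `h` is the inner and `s` the outer variable. -/
noncomputable def dilation : ℂ[X] →+* ℂ[X][X] :=
  eval₂RingHom ((C : ℂ[X] →+* ℂ[X][X]).comp C) (C X * X)

open Polynomial in
lemma evalEval_dilation (A : ℂ[X]) (h s : ℂ) :
    (dilation A).evalEval h s = A.eval (h * s) := by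
  induction A using Polynomial.induction_on' with
  | add p q hp hq => simp [hp, hq]
  | monomial n c => simp [dilation, eval₂_monomial, evalEval_C]

open Polynomial in
lemma exists_dilation_eq (A : ℂ[X]) :
    ∃ A' : ℂ[X][X], dilation A = C (C (A.coeff 0)) + C X * A' := by
  refine ⟨dilation (divX A) * X, ?_⟩
  conv_lhs => rw [← divX_mul_X_add A]
  simp [dilation]
  ring

open Polynomial in
lemma exists_eq_map_C_add (r : ℂ[X][X]) :
    ∃ (r₀ : ℂ[X]) (r' : ℂ[X][X]), r = r₀.map C + C X * r' := by
  induction r using Polynomial.induction_on' with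
  | add p q hp hq =>
    obtain ⟨p₀, p', hp⟩ := hp
    obtain ⟨q₀, q', hq⟩ := hq
    refine ⟨p₀ + q₀, p' + q', ?_⟩
    rw [Polynomial.map_add]
    linear_combination hp + hq
  | monomial n c =>
    refine ⟨monomial n (c.coeff 0), monomial n (divX c), ?_⟩
    rw [map_monomial, C_mul_monomial, ← map_add]
    congr 1
    conv_lhs => rw [← divX_mul_X_add c]
    ring

open Polynomial in
/-- Formal solution, to any order in `h`, of `A(hs) u'' + B(hs) u' - D(hs) u = 0`. -/
lemma exists_formal_solution (A B D : ℂ[X]) (hA : A.coeff 0 ≠ 0) (hD : D.coeff 0 = 0) (N : ℕ) :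
    ∃ u w r : ℂ[X][X], u = 1 + C X * w ∧
      dilation A * derivative (derivative u) + dilation B * derivative u - dilation D * u
        = C (X ^ (N + 1)) * r := by
  obtain ⟨A', hA'⟩ := exists_dilation_eq A
  obtain ⟨B', hB'⟩ := exists_dilation_eq B
  obtain ⟨D', hD'⟩ := exists_dilation_eq D
  induction N with
  | zero => exact ⟨1, 0, -D', by simp, by simp [hD', hD]; ring⟩
  | succ N ih =>
    obtain ⟨u, w, r, hu, hr⟩ := ih
    obtain ⟨r₀, r', hr₀⟩ := exists_eq_map_C_add r
    obtain ⟨v, hv⟩ := Polynomial.exists_second_order_ode hA (B.coeff 0) (-r₀)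
    have hv' := congrArg (Polynomial.map (C : ℂ →+* ℂ[X])) hv
    simp only [Polynomial.map_add, Polynomial.map_mul, map_C, ← derivative_map,
      Polynomial.map_neg] at hv'
    refine ⟨u + C (X ^ (N + 1)) * v.map C, w + C (X ^ N) * v.map C,
      r' + A' * derivative (derivative (v.map C)) + B' * derivative (v.map C) - D' * v.map C,
      ?_, ?_⟩
    · rw [hu]; simp only [map_pow]; ring
    · simp only [derivative_add, derivative_C_mul]
      rw [hA', hB', hD', hD] at *
      simp only [map_pow, map_zero] at *
      linear_combination hr + (C X ^ (N + 1)) * hr₀ + (C X ^ (N + 1)) * hv'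

lemma pow_le_factorial_div_mul_exp {s ν : ℝ} (hs : 0 ≤ s) (hν : 0 < ν) (m : ℕ) :
    s ^ m ≤ m.factorial / ν ^ m * Real.exp (ν * s) := by
  have key := Real.pow_div_factorial_le_exp (ν * s) (by positivity) m
  rw [mul_pow, div_le_iff₀ (by positivity)] at key
  rw [div_mul_eq_mul_div, le_div_iff₀ (by positivity)]
  linarith

/-- `G h x = O(h ^ m)` on `[0, γ]`, up to factors growing slower than any `exp (ν x / h)`. -/
def IsSymbol (γ : ℝ) (m : ℕ) (G : ℝ → ℝ → ℂ) : Prop :=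
  ∀ ν > (0 : ℝ), ∃ K ≥ (0 : ℝ), ∀ h ∈ Set.Ioc (0 : ℝ) 1, ∀ x ∈ Set.Icc (0 : ℝ) γ,
    ‖G h x‖ ≤ K * h ^ m * Real.exp (ν * (x / h))

namespace IsSymbol

variable {γ : ℝ} {m k : ℕ} {F G : ℝ → ℝ → ℂ}

lemma congr (hF : IsSymbol γ m F)
    (h : ∀ h ∈ Set.Ioc (0 : ℝ) 1, ∀ x ∈ Set.Icc (0 : ℝ) γ, G h x = F h x) : IsSymbol γ m G := by
  intro ν hν
  obtain ⟨K, hK, hb⟩ := hF ν hν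
  exact ⟨K, hK, fun t ht x hx => (h t ht x hx).symm ▸ hb t ht x hx⟩

lemma add (hF : IsSymbol γ m F) (hG : IsSymbol γ m G) :
    IsSymbol γ m (fun h x => F h x + G h x) := by
  intro ν hν
  obtain ⟨K, hK, hF⟩ := hF ν hν
  obtain ⟨L, hL, hG⟩ := hG ν hν
  refine ⟨K + L, by positivity, fun h hh x hx => (norm_add_le _ _).trans ?_⟩
  linarith [hF h hh x hx, hG h hh x hx]

lemma mul (hF : IsSymbol γ m F) (hG : IsSymbol γ k G) :
    IsSymbol γ (m + k) (fun h x => F h x * G h x) := by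
  intro ν hν
  obtain ⟨K, hK, hF⟩ := hF (ν / 2) (by positivity)
  obtain ⟨L, hL, hG⟩ := hG (ν / 2) (by positivity)
  refine ⟨K * L, by positivity, fun h hh x hx => ?_⟩
  have hh0 := hh.1
  rw [norm_mul]
  calc ‖F h x‖ * ‖G h x‖
      ≤ (K * h ^ m * Real.exp (ν / 2 * (x / h))) * (L * h ^ k * Real.exp (ν / 2 * (x / h))) := by
        gcongr
        exacts [hF h hh x hx, hG h hh x hx]
    _ = K * L * h ^ (m + k) * (Real.exp (ν / 2 * (x / h)) * Real.exp (ν / 2 * (x / h))) := by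
        ring
    _ = _ := by rw [← Real.exp_add, ← add_mul, add_halves]

lemma mul_left (hF : IsSymbol γ 0 F) (hG : IsSymbol γ k G) :
    IsSymbol γ k (fun h x => F h x * G h x) := by
  simpa using hF.mul hG

lemma mul_right (hF : IsSymbol γ m F) (hG : IsSymbol γ 0 G) :
    IsSymbol γ m (fun h x => F h x * G h x) :=
  hF.mul hG

lemma of_norm_le_pow {φ : ℝ → ℂ} {K : ℝ}
    (hφ : ∀ x ∈ Set.Icc (0 : ℝ) γ, ‖φ x‖ ≤ K * x ^ m) : IsSymbol γ m (fun _ x => φ x) := by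
  intro ν hν
  refine ⟨|K| * (m.factorial / ν ^ m), by positivity, fun h hh x hx => (hφ x hx).trans ?_⟩
  have hh0 := hh.1
  have hx0 := hx.1
  have key := pow_le_factorial_div_mul_exp (s := x / h) (by positivity) hν m
  calc K * x ^ m ≤ |K| * x ^ m := by gcongr; exact le_abs_self K
    _ = |K| * (h ^ m * (x / h) ^ m) := by rw [← mul_pow, mul_div_cancel₀ _ hh0.ne']
    _ ≤ |K| * (h ^ m * (m.factorial / ν ^ m * Real.exp (ν * (x / h)))) := by gcongr
    _ = _ := by ring

lemma of_continuousOn {φ : ℝ → ℂ} (hφ : ContinuousOn φ (Set.Icc 0 γ)) :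
    IsSymbol γ 0 (fun _ x => φ x) := by
  obtain ⟨K, hK⟩ := isCompact_Icc.exists_bound_of_continuousOn hφ
  exact of_norm_le_pow (K := K) (by simpa using hK)

lemma const (z : ℂ) : IsSymbol γ 0 (fun _ _ => z) :=
  of_continuousOn continuousOn_const

/-- A function vanishing near the endpoint `0` is negligible to every order. -/
lemma of_eq_zero_near {φ : ℝ → ℂ} (hφ : ContinuousOn φ (Set.Icc 0 γ)) {r : ℝ} (hr : 0 < r)
    (h0 : ∀ x ∈ Set.Ico 0 r, φ x = 0) (m : ℕ) : IsSymbol γ m (fun _ x => φ x) := by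
  obtain ⟨K, hK⟩ := isCompact_Icc.exists_bound_of_continuousOn hφ
  refine of_norm_le_pow (K := |K| / r ^ m) fun x hx => ?_
  have hx0 := hx.1
  rcases lt_or_ge x r with hxr | hxr
  · rw [h0 x ⟨hx.1, hxr⟩, norm_zero]; positivity
  · calc ‖φ x‖ ≤ |K| / r ^ m * r ^ m := by
          rw [div_mul_cancel₀ _ (by positivity)]; exact (hK x hx).trans (le_abs_self K)
      _ ≤ _ := by gcongr

lemma param_pow (m : ℕ) : IsSymbol γ m (fun h _ => (h : ℂ) ^ m) := by
  refine fun ν hν => ⟨1, zero_le_one, fun h hh x hx => ?_⟩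
  have hh0 := hh.1
  have hx0 := hx.1
  rw [norm_pow, Complex.norm_real, Real.norm_of_nonneg hh0.le, one_mul]
  exact le_mul_of_one_le_right (by positivity) (Real.one_le_exp (by positivity))

lemma param : IsSymbol γ 1 (fun h _ => (h : ℂ)) := by
  simpa using param_pow (γ := γ) 1

lemma of_le (hF : IsSymbol γ k F) (hmk : m ≤ k) : IsSymbol γ m F := by
  intro ν hν
  obtain ⟨K, hK, hF⟩ := hF ν hν
  refine ⟨K, hK, fun h hh x hx => (hF h hh x hx).trans ?_⟩
  have hh0 := hh.1
  have := pow_le_pow_of_le_one hh0.le hh.2 hmk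
  gcongr

open Polynomial in
lemma evalEval (r : ℂ[X][X]) :
    IsSymbol γ 0 (fun h x => r.evalEval (h : ℂ) ((x / h : ℝ) : ℂ)) := by
  induction r using Polynomial.induction_on' with
  | add p q hp hq => simpa using hp.add hq
  | monomial n c =>
    intro ν hν
    obtain ⟨L, hL⟩ := (isCompact_Icc (a := (0 : ℝ)) (b := 1)).exists_bound_of_continuousOn
      (f := fun h : ℝ => c.eval (h : ℂ)) (by fun_prop)
    refine ⟨|L| * (n.factorial / ν ^ n), by positivity, fun h hh x hx => ?_⟩
    have hh0 := hh.1
    have hx0 := hx.1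
    have key := pow_le_factorial_div_mul_exp (s := x / h) (by positivity) hν n
    have hev : (monomial n c).evalEval (h : ℂ) ((x / h : ℝ) : ℂ)
        = c.eval (h : ℂ) * ((x / h : ℝ) : ℂ) ^ n := by
      rw [← C_mul_X_pow_eq_monomial, evalEval_mul, evalEval_C, evalEval_pow, evalEval_X]
    beta_reduce
    rw [hev, norm_mul, norm_pow, Complex.norm_real, Real.norm_of_nonneg (by positivity)]
    calc _ ≤ |L| * (n.factorial / ν ^ n * Real.exp (ν * (x / h))) := by
          gcongr
          exact (hL h ⟨hh0.le, hh.2⟩).trans (le_abs_self L)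
      _ = _ := by ring

end IsSymbol

lemma eLpNorm_scaled_exp {γ κ h : ℝ} (hγ : 0 < γ) (hκ : 0 < κ) (hh : 0 < h) :
    eLpNorm (fun x : ℝ => (√h)⁻¹ * Real.exp (-κ * (x / h))) 2 (volume.restrict (Set.Icc 0 γ))
      = ENNReal.ofReal (√((1 - Real.exp (-(2 * κ * γ) / h)) / (2 * κ))) := by
  have hcont : Continuous (fun x : ℝ => (√h)⁻¹ * Real.exp (-κ * (x / h))) := by fun_prop
  have hmem : MemLp (fun x : ℝ => (√h)⁻¹ * Real.exp (-κ * (x / h))) 2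
      (volume.restrict (Set.Icc 0 γ)) := by
    rw [memLp_two_iff_integrable_sq hcont.aestronglyMeasurable]
    exact (hcont.pow 2).continuousOn.integrableOn_Icc
  rw [hmem.eLpNorm_eq_integral_rpow_norm two_ne_zero ENNReal.ofNat_ne_top]
  congr 1
  have hsq : ∀ x : ℝ, ‖(√h)⁻¹ * Real.exp (-κ * (x / h))‖ ^ (2 : ℝ≥0∞).toReal
      = h⁻¹ * Real.exp (-(2 * κ) / h * x) := by
    intro x
    rw [ENNReal.toReal_ofNat, Real.rpow_ofNat, Real.norm_eq_abs, sq_abs, mul_pow, inv_pow,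
      Real.sq_sqrt hh.le, ← Real.exp_nat_mul]
    congr 2
    push_cast
    ring
  simp_rw [hsq]
  have hc : -(2 * κ) / h ≠ 0 := by
    have : -(2 * κ) / h < 0 := div_neg_of_neg_of_pos (by linarith) hh
    exact this.ne
  rw [integral_Icc_eq_integral_Ioc, ← intervalIntegral.integral_of_le hγ.le,
    intervalIntegral.integral_const_mul, intervalIntegral.integral_comp_mul_left _ hc,
    integral_exp, Real.sqrt_eq_rpow, ENNReal.toReal_ofNat, one_div]
  congr 1
  simp only [mul_zero, Real.exp_zero, smul_eq_mul]
  rw [show -(2 * κ) / h * γ = -(2 * κ * γ) / h by ring]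
  field_simp
  ring

lemma norm_exp_I_mul (ξ : ℂ) (s : ℝ) :
    ‖Complex.exp (Complex.I * ξ * (s : ℂ))‖ = Real.exp (-ξ.im * s) := by
  rw [Complex.norm_exp]
  simp

/-- Multiplying the normalized boundary layer `h^{-1/2} e^{iξx/h}` by a symbol of order `m`
gives a function of `L²` norm `O(h ^ m)`. -/
lemma IsSymbol.exists_eLpNorm_le {γ : ℝ} (hγ : 0 < γ) {ξ : ℂ} (hξ : 0 < ξ.im) {m : ℕ}
    {G : ℝ → ℝ → ℂ} (hG : IsSymbol γ m G) :
    ∃ K ≥ (0 : ℝ), ∀ h ∈ Set.Ioc (0 : ℝ) 1,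
      eLpNorm (fun x : ℝ => ((√h)⁻¹ : ℝ) * Complex.exp (Complex.I * ξ * ((x / h : ℝ) : ℂ)) * G h x)
        2 (volume.restrict (Set.Icc 0 γ)) ≤ ENNReal.ofReal (K * h ^ m) := by
  obtain ⟨K, hK, hb⟩ := hG (ξ.im / 2) (by positivity)
  refine ⟨K * √(1 / ξ.im), by positivity, fun h hh => ?_⟩
  have hh0 := hh.1
  have hle := eLpNorm_le_mul_eLpNorm_of_ae_le_mul (μ := volume.restrict (Set.Icc 0 γ))
    (f := fun x : ℝ =>
      ((√h)⁻¹ : ℝ) * Complex.exp (Complex.I * ξ * ((x / h : ℝ) : ℂ)) * G h x)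
    (g := fun x : ℝ => (√h)⁻¹ * Real.exp (-(ξ.im / 2) * (x / h))) (c := K * h ^ m) ?_ 2
  · refine hle.trans ?_
    rw [eLpNorm_scaled_exp hγ (by positivity) hh0, ← ENNReal.ofReal_mul (by positivity)]
    refine ENNReal.ofReal_le_ofReal ?_
    rw [mul_right_comm]
    gcongr
    · linarith [Real.exp_pos (-(2 * (ξ.im / 2) * γ) / h)]
    · linarith
  · rw [ae_restrict_iff' measurableSet_Icc]
    refine ae_of_all _ fun x hx => ?_
    rw [norm_mul, norm_mul, norm_exp_I_mul, Complex.norm_real, norm_mul, Real.norm_of_nonneg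
      (Real.exp_pos (-(ξ.im / 2) * (x / h))).le]
    calc _ ≤ ‖(√h)⁻¹‖ * Real.exp (-ξ.im * (x / h)) *
          (K * h ^ m * Real.exp (ξ.im / 2 * (x / h))) := by gcongr; exact hb h hh x hx
      _ = K * h ^ m * (‖(√h)⁻¹‖ *
          (Real.exp (-ξ.im * (x / h)) * Real.exp (ξ.im / 2 * (x / h)))) := by ring
      _ = _ := by rw [← Real.exp_add]; ring_nf

/-- If the amplitude is `1 + O(h)`, the `L²` norm tends to that of `e^{iξs}` on the half line. -/
lemma IsSymbol.tendsto_eLpNorm {γ : ℝ} (hγ : 0 < γ) {ξ : ℂ} (hξ : 0 < ξ.im)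
    {G : ℝ → ℝ → ℂ} (hG : IsSymbol γ 1 (fun h x => G h x - 1))
    (hcont : ∀ h, 0 < h → Continuous (G h)) :
    Filter.Tendsto (fun h : ℝ => (eLpNorm (fun x : ℝ => ((√h)⁻¹ : ℝ) *
        Complex.exp (Complex.I * ξ * ((x / h : ℝ) : ℂ)) * G h x) 2
        (volume.restrict (Set.Icc 0 γ))).toReal) (𝓝[>] 0) (𝓝 (√(1 / (2 * ξ.im)))) := by
  obtain ⟨K, hK, hb⟩ := hG.exists_eLpNorm_le hγ hξ
  set e : ℝ → ℝ → ℂ := fun h x =>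
    ((√h)⁻¹ : ℝ) * Complex.exp (Complex.I * ξ * ((x / h : ℝ) : ℂ)) with he
  have hecont : ∀ h, Continuous (e h) := fun h => by fun_prop
  have hnorm : ∀ h, 0 < h → eLpNorm (e h) 2 (volume.restrict (Set.Icc 0 γ))
      = ENNReal.ofReal (√((1 - Real.exp (-(2 * ξ.im * γ) / h)) / (2 * ξ.im))) := by
    intro h hh
    rw [← eLpNorm_scaled_exp hγ hξ hh]
    refine eLpNorm_congr_norm_ae (ae_of_all _ fun x => ?_)
    rw [he]
    simp only [norm_mul, norm_exp_I_mul, Complex.norm_real, Real.norm_of_nonneg (Real.exp_nonneg _)]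
  have hlim : Filter.Tendsto
      (fun h : ℝ => √((1 - Real.exp (-(2 * ξ.im * γ) / h)) / (2 * ξ.im)))
      (𝓝[>] 0) (𝓝 (√(1 / (2 * ξ.im)))) := by
    have h1 : Filter.Tendsto (fun h : ℝ => Real.exp (-(2 * ξ.im * γ) / h)) (𝓝[>] 0) (𝓝 0) := by
      refine Real.tendsto_exp_atBot.comp ?_
      exact tendsto_inv_nhdsGT_zero.const_mul_atTop_of_neg
        (neg_lt_zero.mpr (by positivity))
    have h2 := ((h1.const_sub 1).div_const (2 * ξ.im)).sqrt
    simpa using h2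
  have hKlim : Filter.Tendsto (fun h : ℝ => K * h ^ 1) (𝓝[>] 0) (𝓝 0) := by
    have : Filter.Tendsto (fun h : ℝ => K * h ^ 1) (𝓝 0) (𝓝 (K * 0 ^ 1)) :=
      (by fun_prop : Continuous fun h : ℝ => K * h ^ 1).tendsto 0
    simpa using this.mono_left nhdsWithin_le_nhds
  refine tendsto_of_tendsto_of_dist hlim (squeeze_zero' (Filter.Eventually.of_forall fun _ =>
    dist_nonneg) ?_ hKlim)
  filter_upwards [Ioc_mem_nhdsGT (zero_lt_one (α := ℝ))] with h hh
  have hh0 := hh.1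
  have hd : eLpNorm (fun x => e h x * (G h x - 1)) 2 (volume.restrict (Set.Icc 0 γ))
      ≤ ENNReal.ofReal (K * h ^ 1) := hb h hh
  have hGc := hcont h hh0
  have hmeas1 : AEStronglyMeasurable (e h) (volume.restrict (Set.Icc 0 γ)) :=
    (hecont h).aestronglyMeasurable
  have hmeas2 : AEStronglyMeasurable (fun x => e h x * (G h x - 1))
      (volume.restrict (Set.Icc 0 γ)) :=
    ((hecont h).mul (hGc.sub continuous_const)).aestronglyMeasurable
  have hmeas3 : AEStronglyMeasurable (fun x => e h x * G h x)
      (volume.restrict (Set.Icc 0 γ)) := ((hecont h).mul hGc).aestronglyMeasurable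
  have hup : eLpNorm (fun x => e h x * G h x) 2 (volume.restrict (Set.Icc 0 γ))
      ≤ eLpNorm (e h) 2 (volume.restrict (Set.Icc 0 γ)) + ENNReal.ofReal (K * h ^ 1) := by
    refine le_trans (le_of_eq ?_)
      ((eLpNorm_add_le hmeas1 hmeas2 one_le_two).trans (add_le_add_right hd _))
    congr 1; ext x; simp only [Pi.add_apply]; ring
  have hlow : eLpNorm (e h) 2 (volume.restrict (Set.Icc 0 γ))
      ≤ eLpNorm (fun x => e h x * G h x) 2 (volume.restrict (Set.Icc 0 γ))
        + ENNReal.ofReal (K * h ^ 1) := by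
    refine le_trans (le_of_eq ?_)
      ((eLpNorm_sub_le hmeas3 hmeas2 one_le_two).trans (add_le_add_right hd _))
    congr 1; ext x; simp only [Pi.sub_apply]; ring
  rw [hnorm h hh0] at hup hlow
  have hne : eLpNorm (fun x => e h x * G h x) 2 (volume.restrict (Set.Icc 0 γ)) ≠ ⊤ :=
    (hup.trans_lt (by simp)).ne
  have hKh : 0 ≤ K * h ^ 1 := by positivity
  rw [← ENNReal.ofReal_toReal hne, ← ENNReal.ofReal_add (by positivity) hKh] at hup hlow
  rw [ENNReal.ofReal_le_ofReal_iff (by positivity)] at hup hlow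
  rw [Real.dist_eq, abs_le]
  constructor <;> linarith

open Polynomial in
/-- Taylor approximation at the left endpoint by a polynomial. -/
lemma exists_polynomial_taylor {γ : ℝ} (hγ : 0 < γ) {a : ℝ → ℂ}
    (ha : ContDiffOn ℝ (⊤ : ℕ∞) a (Set.Icc 0 γ)) (N : ℕ) :
    ∃ A : ℂ[X], A.coeff 0 = a 0 ∧
      IsSymbol γ (N + 1) (fun _ x => a x - A.eval (x : ℂ)) := by
  obtain ⟨K, hK⟩ := exists_taylor_mean_remainder_bound (n := N) hγ.le
    (ha.of_le (by exact_mod_cast le_top))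
  set A : ℂ[X] := ∑ k ∈ Finset.range (N + 1),
    monomial k (((k.factorial : ℝ)⁻¹ : ℝ) * iteratedDerivWithin k a (Set.Icc 0 γ) 0) with hA
  have heval : ∀ x : ℝ, A.eval (x : ℂ) = taylorWithinEval a N (Set.Icc 0 γ) 0 x := by
    intro x
    rw [taylor_within_apply, hA, eval_finsetSum]
    refine Finset.sum_congr rfl fun k _ => ?_
    rw [eval_monomial, Complex.real_smul]
    push_cast
    ring
  refine ⟨A, ?_, IsSymbol.of_norm_le_pow (K := K) fun x hx => ?_⟩
  · rw [coeff_zero_eq_eval_zero, ← Complex.ofReal_zero, heval, taylorWithinEval_self]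
  · rw [heval]
    simpa using hK x hx

lemma exists_smooth_cutoff {ρ : ℝ} (hρ : 0 < ρ) :
    ∃ χ : ℝ → ℂ, ContDiff ℝ (⊤ : ℕ∞) χ ∧ (∀ x, |x| < ρ → χ x = 1) ∧ ∀ x, 2 * ρ ≤ x → χ x = 0 := by
  let χ : ContDiffBump (0 : ℝ) := ⟨ρ, 2 * ρ, hρ, by linarith⟩
  refine ⟨fun x => (χ x : ℂ), Complex.ofRealCLM.contDiff.comp χ.contDiff, fun x hx => ?_,
    fun x hx => ?_⟩
  · beta_reduce
    rw [χ.one_of_mem_closedBall (by simpa [χ] using hx.le), Complex.ofReal_one]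
  · beta_reduce
    rw [χ.zero_of_le_dist, Complex.ofReal_zero]
    rw [Real.dist_eq, sub_zero]
    exact hx.trans (le_abs_self x)

lemma deriv_eq_zero_of_eq_const {φ : ℝ → ℂ} {ρ : ℝ} {z : ℂ} (hφ : ∀ x, |x| < ρ → φ x = z) :
    ∀ x, |x| < ρ → deriv φ x = 0 := by
  intro x hx
  have : φ =ᶠ[𝓝 x] fun _ => z := by
    filter_upwards [(isOpen_lt continuous_abs continuous_const).mem_nhds hx] with y hy
    exact hφ y hy
  rw [this.deriv_eq, deriv_const]

open Polynomial in
lemma contDiff_evalEval (u : ℂ[X][X]) (h : ℝ) :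
    ContDiff ℝ (⊤ : ℕ∞) (fun x : ℝ => u.evalEval (h : ℂ) ((x / h : ℝ) : ℂ)) := by
  simp only [← map_evalRingHom_eval]
  have h1 : ContDiff ℝ (⊤ : ℕ∞) fun x : ℝ => ((x / h : ℝ) : ℂ) :=
    Complex.ofRealCLM.contDiff.comp (contDiff_id.div_const h)
  have h2 : ContDiff ℂ (⊤ : ℕ∞) fun z : ℂ => (u.map (evalRingHom (h : ℂ))).eval z := by
    simpa [coe_aeval_eq_eval] using contDiff_aeval (𝕜 := ℂ) (u.map (evalRingHom (h : ℂ))) _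
  exact (h2.restrict_scalars ℝ).comp h1

open Polynomial in
lemma hasDerivAt_evalEval (u : ℂ[X][X]) (h x : ℝ) :
    HasDerivAt (fun x : ℝ => u.evalEval (h : ℂ) ((x / h : ℝ) : ℂ))
      ((derivative u).evalEval (h : ℂ) ((x / h : ℝ) : ℂ) / h) x := by
  simp only [← map_evalRingHom_eval, ← derivative_map]
  have h1 := ((u.map (evalRingHom (h : ℂ))).hasDerivAt ((x / h : ℝ) : ℂ)).comp_ofReal
  refine (h1.scomp x ((hasDerivAt_id x).div_const h)).congr_deriv ?_
  rw [Complex.real_smul]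
  push_cast
  ring

lemma hasDerivAt_layer_mul (k ξ : ℂ) {φ : ℝ → ℂ} {φ' : ℂ} {x : ℝ} (h : ℝ)
    (hφ : HasDerivAt φ φ' x) :
    HasDerivAt (fun x : ℝ => k * Complex.exp (Complex.I * ξ * ((x / h : ℝ) : ℂ)) * φ x)
      (k * Complex.exp (Complex.I * ξ * ((x / h : ℝ) : ℂ)) *
        (φ' + Complex.I * ξ / h * φ x)) x := by
  have h1 : HasDerivAt (fun x : ℝ => Complex.I * ξ * ((x / h : ℝ) : ℂ))
      (Complex.I * ξ * ((1 / h : ℝ) : ℂ)) x :=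
    ((hasDerivAt_id x).div_const h).ofReal_comp.const_mul _
  refine ((h1.cexp.const_mul k).mul hφ).congr_deriv ?_
  push_cast
  ring

/-- Theorem 12 (boundary pseudo-eigenfunctions): for an elliptic second order operator
`L_h` on `[0,γ₀]` with smooth coefficients and `Im ξ > 0`, there are smooth functions
`f_h`, supported near the endpoint `0`, with `‖f_h‖ → c > 0`, `‖Q f_h‖ = O(h)`,
`‖P f_h - ξ f_h‖ = O(h)` and `‖L_h f_h - σ(0,ξ) f_h‖ = O(h^{n+2})`. -/
theorem boundary_pseudoeigenfunctions
    (γ₀ : ℝ) (hγ₀ : 0 < γ₀)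
    (a b c : ℝ → ℂ)
    (ha : ContDiffOn ℝ (⊤ : ℕ∞) a (Set.Icc 0 γ₀)) (hb : ContDiffOn ℝ (⊤ : ℕ∞) b (Set.Icc 0 γ₀))
    (hc : ContDiffOn ℝ (⊤ : ℕ∞) c (Set.Icc 0 γ₀))
    (hell : ∀ x ∈ Set.Icc (0:ℝ) γ₀, a x ≠ 0)
    (ξ : ℂ) (hξ : 0 < ξ.im) :
    ∀ n : ℕ, 0 < n →
    ∃ δ ∈ Set.Ioo (0:ℝ) γ₀, ∃ c₀ > (0:ℝ), ∃ C > (0:ℝ), ∃ f : ℝ → ℝ → ℂ,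
      Filter.Tendsto
        (fun h => (eLpNorm (f h) 2 (volume.restrict (Set.Icc 0 γ₀))).toReal)
        (𝓝[>] 0) (𝓝 c₀) ∧
      ∀ h ∈ Set.Ioc (0:ℝ) 1,
        ContDiff ℝ (⊤ : ℕ∞) (f h) ∧
        (∀ x ∈ Set.Icc δ γ₀, f h x = 0) ∧
        eLpNorm (fun x : ℝ => (x:ℂ) * f h x) 2 (volume.restrict (Set.Icc 0 γ₀))
          ≤ ENNReal.ofReal (C * h) ∧
        eLpNorm (fun x : ℝ => -Complex.I * (h:ℂ) * deriv (f h) x - ξ * f h x) 2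
            (volume.restrict (Set.Icc 0 γ₀))
          ≤ ENNReal.ofReal (C * h) ∧
        eLpNorm (fun x : ℝ =>
            (-(h:ℂ)^2 * a x * deriv (deriv (f h)) x
              - Complex.I * (h:ℂ) * b x * deriv (f h) x + c x * f h x)
            - (a 0 * ξ^2 + b 0 * ξ + c 0) * f h x) 2
            (volume.restrict (Set.Icc 0 γ₀))
          ≤ ENNReal.ofReal (C * h ^ (n + 2 : ℕ)) := by
  intro n _
  obtain ⟨A, hA0, hA⟩ := exists_polynomial_taylor hγ₀ ha (n + 1)
  obtain ⟨B, hB0, hB⟩ := exists_polynomial_taylor hγ₀ hb (n + 1)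
  obtain ⟨D, hD0, hD⟩ := exists_polynomial_taylor hγ₀ hc (n + 1)
  set σ₀ : ℂ := a 0 * ξ ^ 2 + b 0 * ξ + c 0 with hσ₀
  obtain ⟨u, w, r, hu, hr⟩ := exists_formal_solution A
    (Polynomial.C Complex.I * (Polynomial.C (2 * ξ) * A + B))
    (Polynomial.C (ξ ^ 2) * A + Polynomial.C ξ * B + D - Polynomial.C σ₀)
    (by rw [hA0]; exact hell 0 ⟨le_rfl, hγ₀.le⟩)
    (by
      simp only [Polynomial.coeff_sub, Polynomial.coeff_add, Polynomial.coeff_C_mul,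
        Polynomial.coeff_C_zero, hA0, hB0, hD0, hσ₀]
      ring) (n + 1)
  obtain ⟨χ, hχ, hχ_one, hχ_zero⟩ := exists_smooth_cutoff (ρ := γ₀ / 4) (by positivity)
  have hχ' : ContDiff ℝ (⊤ : ℕ∞) (deriv χ) := (contDiff_infty_iff_deriv.mp hχ).2
  have hχ'' : ContDiff ℝ (⊤ : ℕ∞) (deriv (deriv χ)) := (contDiff_infty_iff_deriv.mp hχ').2
  have hχd : ∀ x, HasDerivAt χ (deriv χ x) x := fun x =>
    (hχ.differentiable (by simp) x).hasDerivAt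
  have hχd' : ∀ x, HasDerivAt (deriv χ) (deriv (deriv χ) x) x := fun x =>
    (hχ'.differentiable (by simp) x).hasDerivAt
  have hρ : 0 < γ₀ / 4 := by positivity
  have hχ'_zero := deriv_eq_zero_of_eq_const hχ_one
  have hχ''_zero := deriv_eq_zero_of_eq_const hχ'_zero
  have habs : ∀ x ∈ Set.Ico 0 (γ₀ / 4), |x| < γ₀ / 4 := fun x hx => by
    rw [abs_of_nonneg hx.1]; exact hx.2
  -- the amplitude and its derivatives in the fast variable `s = x / h`
  set U : ℝ → ℝ → ℂ := fun h x => u.evalEval (h : ℂ) ((x / h : ℝ) : ℂ) with hU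
  set U₁ : ℝ → ℝ → ℂ :=
    fun h x => (Polynomial.derivative u).evalEval (h : ℂ) ((x / h : ℝ) : ℂ) with hU₁
  set U₂ : ℝ → ℝ → ℂ := fun h x =>
    (Polynomial.derivative (Polynomial.derivative u)).evalEval (h : ℂ) ((x / h : ℝ) : ℂ) with hU₂
  set R : ℝ → ℝ → ℂ := fun h x => r.evalEval (h : ℂ) ((x / h : ℝ) : ℂ) with hR
  set W : ℝ → ℝ → ℂ := fun h x => w.evalEval (h : ℂ) ((x / h : ℝ) : ℂ) with hW
  set W₁ : ℝ → ℝ → ℂ :=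
    fun h x => (Polynomial.derivative w).evalEval (h : ℂ) ((x / h : ℝ) : ℂ) with hW₁
  have hUW : ∀ h x, U h x = 1 + h * W h x := fun h x => by
    simp [hU, hW, hu, Polynomial.evalEval_C]
  have hU₁W₁ : ∀ h x, U₁ h x = h * W₁ h x := fun h x => by
    simp [hU₁, hW₁, hu, Polynomial.evalEval_C]
  have htransport : ∀ h : ℝ, h ≠ 0 → ∀ x : ℝ,
      A.eval (x : ℂ) * U₂ h x
        + Complex.I * (2 * ξ * A.eval (x : ℂ) + B.eval (x : ℂ)) * U₁ h x
        - (ξ ^ 2 * A.eval (x : ℂ) + ξ * B.eval (x : ℂ) + D.eval (x : ℂ) - σ₀) * U h x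
        = (h : ℂ) ^ (n + 2) * R h x := by
    intro h hh x
    have hx : (h : ℂ) * ((x / h : ℝ) : ℂ) = x := by
      rw [← Complex.ofReal_mul, mul_div_cancel₀ _ hh]
    have := congrArg (Polynomial.evalEval (h : ℂ) ((x / h : ℝ) : ℂ)) hr
    simpa [Polynomial.evalEval_C, evalEval_dilation, hx, -Complex.ofReal_div] using this
  have sU : IsSymbol γ₀ 0 U := .evalEval u
  have sU₁ : IsSymbol γ₀ 0 U₁ := .evalEval _
  have sU₂ : IsSymbol γ₀ 0 U₂ := .evalEval _
  have sR : IsSymbol γ₀ 0 R := .evalEval r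
  have sW : IsSymbol γ₀ 0 W := .evalEval w
  have sW₁ : IsSymbol γ₀ 0 W₁ := .evalEval _
  have sχ : IsSymbol γ₀ 0 (fun _ x => χ x) := .of_continuousOn hχ.continuous.continuousOn
  have sχ' : ∀ m, IsSymbol γ₀ m (fun _ x => deriv χ x) :=
    .of_eq_zero_near hχ'.continuous.continuousOn hρ fun x hx => hχ'_zero x (habs x hx)
  have sχ'' : ∀ m, IsSymbol γ₀ m (fun _ x => deriv (deriv χ) x) :=
    .of_eq_zero_near hχ''.continuous.continuousOn hρ fun x hx => hχ''_zero x (habs x hx)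
  have sχ1 : IsSymbol γ₀ 1 (fun _ x => χ x - 1) :=
    .of_eq_zero_near (φ := fun x => χ x - 1) (hχ.continuous.sub continuous_const).continuousOn hρ
      (fun x hx => by rw [hχ_one x (habs x hx), sub_self]) 1
  have sa : IsSymbol γ₀ 0 (fun _ x => a x) := .of_continuousOn ha.continuousOn
  have sb : IsSymbol γ₀ 0 (fun _ x => b x) := .of_continuousOn hb.continuousOn
  have sh : IsSymbol γ₀ 0 (fun h _ => (h : ℂ)) := IsSymbol.param.of_le zero_le_one
  have sx : IsSymbol γ₀ 1 (fun _ x => (x : ℂ)) :=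
    .of_norm_le_pow (K := 1) fun x hx => by simp [abs_of_nonneg hx.1]
  -- symbols of the four quantities to be estimated
  have s_norm : IsSymbol γ₀ 1 (fun h x => χ x * U h x - 1) :=
    ((sχ1.mul_right sU).add (IsSymbol.param.mul_right sW)).congr fun h _ x _ => by
      linear_combination hUW h x
  have s_pos : IsSymbol γ₀ 1 (fun h x => (x : ℂ) * (χ x * U h x)) :=
    sx.mul_right (sχ.mul_left sU)
  have s_mom : IsSymbol γ₀ 1
      (fun h x => -Complex.I * (h * (deriv χ x * U h x) + χ x * U₁ h x)) :=
    ((IsSymbol.const (-Complex.I)).mul_left ((IsSymbol.param.mul_right ((sχ' 0).mul_left sU)).add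
      (IsSymbol.param.mul_right (sχ.mul_left sW₁)))).congr fun h _ x _ => by
        linear_combination (-Complex.I * χ x) * hU₁W₁ h x
  have s_op : IsSymbol γ₀ (n + 2) (fun h x =>
      χ x * (-(a x * U₂ h x) - Complex.I * (2 * ξ * a x + b x) * U₁ h x
        + (ξ ^ 2 * a x + ξ * b x + c x - σ₀) * U h x)
      - a x * h ^ 2 * (deriv (deriv χ) x * U h x)
      - h * deriv χ x * (2 * a x * U₁ h x + Complex.I * (2 * ξ * a x + b x) * U h x)) := by
    have t₁ := sχ.mul_left (((IsSymbol.const (-1)).mul_left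
      ((IsSymbol.param_pow (n + 2)).mul_right sR)))
    have t₂ := sχ.mul_left (hA.mul_right ((((IsSymbol.const (ξ ^ 2)).mul_left sU).add
      ((IsSymbol.const (-(2 * Complex.I * ξ))).mul_left sU₁)).add
      ((IsSymbol.const (-1)).mul_left sU₂)))
    have t₃ := sχ.mul_left (hB.mul_right (((IsSymbol.const ξ).mul_left sU).add
      ((IsSymbol.const (-Complex.I)).mul_left sU₁)))
    have t₄ := sχ.mul_left (hD.mul_right sU)
    have t₅ := (sχ'' (n + 2)).mul_right
      ((IsSymbol.const (-1)).mul_left (sh.mul_left (sh.mul_left (sa.mul_left sU))))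
    have t₆ := (sχ' (n + 2)).mul_right (sh.mul_left
      ((((IsSymbol.const (-2)).mul_left (sa.mul_left sU₁)).add
        ((IsSymbol.const (-(2 * Complex.I * ξ))).mul_left (sa.mul_left sU))).add
        ((IsSymbol.const (-Complex.I)).mul_left (sb.mul_left sU))))
    refine (((((t₁.add t₂).add t₃).add t₄).add t₅).add t₆).congr fun h hh x _ => ?_
    linear_combination (-χ x) * htransport h hh.1.ne' x
  set f : ℝ → ℝ → ℂ := fun h x =>
    ((√h)⁻¹ : ℝ) * Complex.exp (Complex.I * ξ * ((x / h : ℝ) : ℂ)) * (χ x * U h x) with hf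
  have hφ : ∀ h x : ℝ, HasDerivAt (fun x => χ x * U h x)
      (deriv χ x * U h x + χ x * (U₁ h x / h)) x := fun h x =>
    (hχd x).mul (hasDerivAt_evalEval u h x)
  have hdf : ∀ h : ℝ, deriv (f h) = fun x =>
      ((√h)⁻¹ : ℝ) * Complex.exp (Complex.I * ξ * ((x / h : ℝ) : ℂ)) *
        ((deriv χ x * U h x + χ x * (U₁ h x / h)) + Complex.I * ξ / h * (χ x * U h x)) :=
    fun h => funext fun x => (hasDerivAt_layer_mul _ ξ h (hφ h x)).deriv
  have hddf : ∀ h x : ℝ, deriv (deriv (f h)) x =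
      ((√h)⁻¹ : ℝ) * Complex.exp (Complex.I * ξ * ((x / h : ℝ) : ℂ)) *
        ((((deriv (deriv χ) x * U h x + deriv χ x * (U₁ h x / h))
            + (deriv χ x * (U₁ h x / h) + χ x * (U₂ h x / h / h)))
            + Complex.I * ξ / h * (deriv χ x * U h x + χ x * (U₁ h x / h)))
          + Complex.I * ξ / h * ((deriv χ x * U h x + χ x * (U₁ h x / h))
            + Complex.I * ξ / h * (χ x * U h x))) := by
    intro h x
    rw [hdf]
    refine (hasDerivAt_layer_mul _ ξ h ?_).deriv
    exact (((hχd' x).mul (hasDerivAt_evalEval u h x)).add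
      ((hχd x).mul ((hasDerivAt_evalEval _ h x).div_const _))).add ((hφ h x).const_mul _)
  obtain ⟨K₁, hK₁, hb₁⟩ := s_pos.exists_eLpNorm_le hγ₀ hξ
  obtain ⟨K₂, hK₂, hb₂⟩ := s_mom.exists_eLpNorm_le hγ₀ hξ
  obtain ⟨K₃, hK₃, hb₃⟩ := s_op.exists_eLpNorm_le hγ₀ hξ
  refine ⟨γ₀ / 2, ⟨by positivity, by linarith⟩, √(1 / (2 * ξ.im)), by positivity,
    K₁ + K₂ + K₃ + 1, by positivity, f, ?_, fun h hh => ⟨?_, fun x hx => ?_, ?_, ?_, ?_⟩⟩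
  · exact IsSymbol.tendsto_eLpNorm hγ₀ hξ s_norm fun h _ =>
      hχ.continuous.mul (contDiff_evalEval u h).continuous
  · have h1 : ContDiff ℝ (⊤ : ℕ∞) fun x : ℝ => ((x / h : ℝ) : ℂ) :=
      Complex.ofRealCLM.contDiff.comp (contDiff_id.div_const h)
    exact (contDiff_const.mul (contDiff_const.mul h1).cexp).mul
      (hχ.mul (contDiff_evalEval u h))
  · simp only [hf, hχ_zero x (by linarith [hx.1]), zero_mul, mul_zero]
  all_goals
    have hh0 := hh.1
    have hhne : (h : ℂ) ≠ 0 := by exact_mod_cast hh0.ne'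
  · refine le_trans (le_of_eq ?_) ((hb₁ h hh).trans (ENNReal.ofReal_le_ofReal ?_))
    · congr 1; ext x; simp only [hf]; ring
    · rw [pow_one]; gcongr; linarith
  · refine le_trans (le_of_eq ?_) ((hb₂ h hh).trans (ENNReal.ofReal_le_ofReal ?_))
    · congr 1; ext x
      simp only [hdf]
      simp only [hf]
      field_simp
      ring_nf
      simp only [Complex.I_sq]
      ring
    · rw [pow_one]; gcongr; linarith
  · refine le_trans (le_of_eq ?_) ((hb₃ h hh).trans (ENNReal.ofReal_le_ofReal ?_))
    · congr 1; ext x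
      simp only [hddf]
      simp only [hdf]
      simp only [hf]
      field_simp
      ring_nf
      simp only [Complex.I_sq]
      ring
    · gcongr; linarith
end

section
/- Let γ₀ > 0 and let a, b, c : [0, γ₀] → ℂ be C^∞ with a(x) ≠ 0 for all x, let (L_h f)(x) = −h² a(x) f″(x) − i h b(x) f′(x) + c(x) f(x), σ(u,ξ) = a(u)ξ² + b(u)ξ + c(u). Assume the exit condition Im(−b(0)/a(0)) > 0, and let Λ̃ = {ξ ∈ ℂ : 0 < Im(ξ) < Im(−b(0)/a(0))}. Let z ∈ ℂ be such that z ≠ c(0) − b(0)²/(4a(0)) and such that the two distinct solutions ξ₁, ξ₂ of σ(0,ξ) = z both lie in Λ̃. Let u, w ∈ ℂ, not both zero. Then for every positive integer n ≥ 1 there exist C > 0, h₀ > 0 and for each h ∈ (0, h₀] a nonzero function f_h ∈ C^∞([0, γ₀]) satisfying the boundary condition u h f_h′(0) + w f_h(0) = 0 and the estimate ‖L_h f_h − z f_h‖ ≤ C h^{n+2} ‖f_h‖. -/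
open MeasureTheory
open scoped ENNReal Topology

open Polynomial in
/-- The function `t ↦ p(t) exp(iξt)` on the real line, linear in the polynomial `p`. -/
noncomputable def expPolynomial (ξ : ℂ) : ℂ[X] →ₗ[ℂ] (ℝ → ℂ) where
  toFun p t := p.eval (t : ℂ) * Complex.exp (Complex.I * ξ * t)
  map_add' p q := by ext t; simp [add_mul]
  map_smul' r p := by ext t; simp [mul_assoc]

open Polynomial in
/-- The action of differentiation on the polynomial factor of `t ↦ p(t) exp(iξt)`. -/
noncomputable def expPolynomialDeriv (ξ : ℂ) : ℂ[X] →ₗ[ℂ] ℂ[X] :=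
  derivative + (Complex.I * ξ) • LinearMap.id

/-- A space `E` representing bounded functions on the half line, closed under differentiation
and under multiplication by the variable. -/
structure HalfLineModel (E : Type*) [AddCommGroup E] [Module ℂ E] where
  /-- The function represented by an element. -/
  ev : E →ₗ[ℂ] (ℝ → ℂ)
  /-- Differentiation. -/
  diff : E →ₗ[ℂ] E
  /-- Multiplication by the variable. -/
  mulVar : E →ₗ[ℂ] E
  hasDerivAt : ∀ F t, HasDerivAt (ev F) (ev (diff F) t) t
  ev_mulVar : ∀ F t, ev (mulVar F) t = t * ev F t
  bounded : ∀ F, ∃ K, ∀ t, 0 ≤ t → ‖ev F t‖ ≤ K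

section ExpPolynomial

open Polynomial

theorem expPolynomial_apply (ξ : ℂ) (p : ℂ[X]) (t : ℝ) :
    expPolynomial ξ p t = p.eval (t : ℂ) * Complex.exp (Complex.I * ξ * t) := rfl

theorem expPolynomialDeriv_apply (ξ : ℂ) (p : ℂ[X]) :
    expPolynomialDeriv ξ p = derivative p + (Complex.I * ξ) • p := rfl

theorem expPolynomial_hasDerivAt (ξ : ℂ) (p : ℂ[X]) (t : ℝ) :
    HasDerivAt (expPolynomial ξ p) (expPolynomial ξ (expPolynomialDeriv ξ p) t) t := by
  have h1 : HasDerivAt (fun s : ℂ => Complex.exp (Complex.I * ξ * s))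
      (Complex.exp (Complex.I * ξ * t) * (Complex.I * ξ)) (t : ℂ) := by
    simpa using ((hasDerivAt_id (t : ℂ)).const_mul (Complex.I * ξ)).cexp
  refine ((p.hasDerivAt (t : ℂ)).mul h1).comp_ofReal.congr_deriv ?_
  rw [expPolynomial_apply, expPolynomialDeriv_apply, eval_add, eval_smul, smul_eq_mul]
  ring

theorem expPolynomial_mulVar (ξ : ℂ) (p : ℂ[X]) (t : ℝ) :
    expPolynomial ξ (X * p) t = t * expPolynomial ξ p t := by
  simp [expPolynomial_apply, mul_assoc]

theorem expPolynomial_bounded {ξ : ℂ} (hξ : 0 < ξ.im) (p : ℂ[X]) :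
    ∃ K, ∀ t : ℝ, 0 ≤ t → ‖expPolynomial ξ p t‖ ≤ K := by
  induction p using Polynomial.induction_on' with
  | add p q hp hq =>
    obtain ⟨K, hK⟩ := hp
    obtain ⟨M, hM⟩ := hq
    refine ⟨K + M, fun t ht => ?_⟩
    rw [map_add]
    exact (norm_add_le _ _).trans (add_le_add (hK t ht) (hM t ht))
  | monomial n r =>
    refine ⟨‖r‖ * (n.factorial / ξ.im ^ n), fun t ht => ?_⟩
    have h1 := Real.pow_div_factorial_le_exp (ξ.im * t) (by positivity) n
    have h2 : ‖expPolynomial ξ (monomial n r) t‖ = ‖r‖ * (t ^ n * Real.exp (-(ξ.im * t))) := by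
      simp [expPolynomial_apply, Complex.norm_exp, abs_of_nonneg ht, mul_assoc]
    rw [h2, Real.exp_neg]
    refine mul_le_mul_of_nonneg_left ?_ (norm_nonneg r)
    rw [mul_pow, div_le_iff₀ (by positivity)] at h1
    rw [← div_eq_mul_inv, div_le_div_iff₀ (Real.exp_pos _) (by positivity)]
    linarith

/-- A constant-coefficient operator `κ ∂ + μ ∂²` with `κ ≠ 0` is surjective on polynomials. -/
theorem exists_polynomial_derivative_eq {κ : ℂ} (hκ : κ ≠ 0) (μ : ℂ) (q : ℂ[X]) :
    ∃ p : ℂ[X], κ • derivative p + μ • derivative (derivative p) = q := by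
  have key : ∀ n : ℕ, ∃ p : ℂ[X], κ • derivative p + μ • derivative (derivative p) = X ^ n := by
    intro n
    induction n with
    | zero => exact ⟨κ⁻¹ • X, by simp [hκ]⟩
    | succ n ih =>
      obtain ⟨p, hp⟩ := ih
      have hn : (n : ℂ) + 2 ≠ 0 := by exact_mod_cast (by omega : n + 2 ≠ 0)
      refine ⟨(κ * (n + 2))⁻¹ • X ^ (n + 2) - (κ⁻¹ * μ * (n + 1)) • p, ?_⟩
      have : κ • derivative ((κ * (n + 2))⁻¹ • X ^ (n + 2) - (κ⁻¹ * μ * (n + 1)) • p)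
          + μ • derivative (derivative ((κ * (n + 2))⁻¹ • X ^ (n + 2) - (κ⁻¹ * μ * (n + 1)) • p))
          = (κ • derivative ((κ * (n + 2))⁻¹ • X ^ (n + 2) : ℂ[X])
            + μ • derivative (derivative ((κ * (n + 2))⁻¹ • X ^ (n + 2) : ℂ[X])))
            - (κ⁻¹ * μ * (n + 1)) • (κ • derivative p + μ • derivative (derivative p)) := by
        simp only [map_sub, derivative_smul]
        module
      rw [this, hp]
      simp only [derivative_X_pow, smul_eq_C_mul, derivative_mul, derivative_C,
        zero_mul, zero_add, ← mul_assoc, ← C_mul]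
      have e1 : κ * (κ * (↑n + 2))⁻¹ * ((n + 2 : ℕ) : ℂ) = 1 := by
        push_cast; field_simp
      have e2 : μ * (κ * (↑n + 2))⁻¹ * ((n + 2 : ℕ) : ℂ) * ((n + 2 - 1 : ℕ) : ℂ)
          = κ⁻¹ * μ * (n + 1) := by
        rw [show n + 2 - 1 = n + 1 by omega]; push_cast; field_simp
      rw [e1, e2]
      simp
  induction q using Polynomial.induction_on' with
  | add p q hp hq =>
    obtain ⟨P, hP⟩ := hp
    obtain ⟨Q, hQ⟩ := hq
    refine ⟨P + Q, ?_⟩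
    rw [← hP, ← hQ]
    simp only [map_add, smul_add]
    abel
  | monomial n r =>
    obtain ⟨P, hP⟩ := key n
    refine ⟨r • P, ?_⟩
    rw [← C_mul_X_pow_eq_monomial, ← smul_eq_C_mul, ← hP]
    simp only [derivative_smul, smul_add]
    rw [smul_comm κ r, smul_comm μ r]

/-- Pairs `(p, q)` of polynomials representing `p(t) exp(iξ₁t) + q(t) exp(iξ₂t)`. -/
noncomputable def expPolynomialModel {ξ₁ ξ₂ : ℂ} (h₁ : 0 < ξ₁.im) (h₂ : 0 < ξ₂.im) :
    HalfLineModel (ℂ[X] × ℂ[X]) where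
  ev := (expPolynomial ξ₁).coprod (expPolynomial ξ₂)
  diff := (expPolynomialDeriv ξ₁).prodMap (expPolynomialDeriv ξ₂)
  mulVar := (LinearMap.mulLeft ℂ X).prodMap (LinearMap.mulLeft ℂ X)
  hasDerivAt F t :=
    (expPolynomial_hasDerivAt ξ₁ F.1 t).add (expPolynomial_hasDerivAt ξ₂ F.2 t)
  ev_mulVar F t := by
    simp [expPolynomial_mulVar, mul_add]
  bounded F := by
    obtain ⟨K, hK⟩ := expPolynomial_bounded h₁ F.1
    obtain ⟨M, hM⟩ := expPolynomial_bounded h₂ F.2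
    exact ⟨K + M, fun t ht => (norm_add_le _ _).trans (add_le_add (hK t ht) (hM t ht))⟩

/-- The constant-coefficient operator with symbol `a ξ² + b ξ + d` is surjective on the
polynomial factors of `exp(iξt)` when `ξ` is a simple root of the symbol. -/
theorem exists_expPolynomialDeriv_eq {a b d ξ : ℂ} (hroot : a * ξ ^ 2 + b * ξ + d = 0)
    (hsimple : 2 * a * ξ + b ≠ 0) (q : ℂ[X]) :
    ∃ p : ℂ[X], -a • expPolynomialDeriv ξ (expPolynomialDeriv ξ p)
      - (Complex.I * b) • expPolynomialDeriv ξ p + d • p = q := by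
  obtain ⟨p, hp⟩ := exists_polynomial_derivative_eq
    (κ := -(Complex.I * (2 * a * ξ + b))) (by simpa using hsimple) (-a) q
  refine ⟨p, ?_⟩
  rw [← hp]
  have hd : d = -(a * ξ ^ 2 + b * ξ) := by linear_combination hroot
  have hI : (C Complex.I : ℂ[X]) * C Complex.I = -1 := by
    rw [← C_mul, Complex.I_mul_I]; simp
  have h2 : (C 2 : ℂ[X]) = 2 := C_ofNat 2
  simp only [expPolynomialDeriv_apply, hd, map_add, derivative_smul]
  simp only [smul_eq_C_mul, C_mul, C_neg, map_add, C_pow, h2]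
  linear_combination (-(C a * C ξ ^ 2) - C b * C ξ) * p * hI

theorem expPolynomialDeriv_operator_C {a b d ξ : ℂ} (hroot : a * ξ ^ 2 + b * ξ + d = 0) (r : ℂ) :
    -a • expPolynomialDeriv ξ (expPolynomialDeriv ξ (C r))
      - (Complex.I * b) • expPolynomialDeriv ξ (C r) + d • C r = 0 := by
  simp only [expPolynomialDeriv_apply, derivative_smul, derivative_C, smul_zero, zero_add]
  simp only [smul_C, smul_eq_mul, ← C_add, ← C_sub]
  rw [C_eq_zero]
  linear_combination r * hroot - (a * ξ ^ 2 + b * ξ) * r * Complex.I_mul_I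

end ExpPolynomial

section FormalSolution

variable {E : Type*} [AddCommGroup E] [Module ℂ E]

/-- The sequence determined by a right inverse `S` of `P 0` and the vanishing of the Cauchy product
of `P` and the sequence. -/
noncomputable def formalSolution (P : ℕ → E →ₗ[ℂ] E) (S : E → E) (e : E) : ℕ → E
  | 0 => e
  | k + 1 => S (-∑ j : Fin (k + 1), P (j + 1) (formalSolution P S e (k - j)))
decreasing_by omega

theorem exists_formalSolution (P : ℕ → E →ₗ[ℂ] E) (K : E → Prop)
    (hsurj : ∀ g, ∃ F, K F ∧ P 0 F = g) {e : E} (he : K e) (hPe : P 0 e = 0) :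
    ∃ F : ℕ → E, F 0 = e ∧ (∀ k, K (F k)) ∧
      ∀ m, ∑ p ∈ Finset.HasAntidiagonal.antidiagonal m, P p.1 (F p.2) = 0 := by
  choose S hSK hS using hsurj
  refine ⟨formalSolution P S e, by rw [formalSolution], fun k => ?_, fun m => ?_⟩
  · cases k with
    | zero => rwa [formalSolution]
    | succ k => rw [formalSolution]; exact hSK _
  · cases m with
    | zero => simpa [formalSolution] using hPe
    | succ m =>
      rw [Finset.Nat.sum_antidiagonal_succ, Finset.Nat.sum_antidiagonal_eq_sum_range_succ_mk,
        formalSolution, hS,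
        Fin.sum_univ_eq_sum_range (fun j => P (j + 1) (formalSolution P S e (m - j)))]
      simp

end FormalSolution

namespace HalfLineModel

variable {E : Type*} [AddCommGroup E] [Module ℂ E] (M : HalfLineModel E)

theorem ev_mulVar_pow (j : ℕ) (F : E) (t : ℝ) :
    M.ev ((M.mulVar ^ j) F) t = (t : ℂ) ^ j * M.ev F t := by
  induction j with
  | zero => simp
  | succ j ih => rw [pow_succ', Module.End.mul_apply, M.ev_mulVar, ih]; ring

theorem deriv_ev (F : E) : deriv (M.ev F) = M.ev (M.diff F) :=
  funext fun t => (M.hasDerivAt F t).deriv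

theorem contDiff_ev (F : E) : ContDiff ℝ (⊤ : ℕ∞) (M.ev F) := by
  rw [contDiff_infty]
  intro n
  induction n generalizing F with
  | zero =>
    exact contDiff_zero.2 (Differentiable.continuous fun t => (M.hasDerivAt F t).differentiableAt)
  | succ n ih =>
    push_cast
    rw [contDiff_succ_iff_deriv]
    refine ⟨fun t => (M.hasDerivAt F t).differentiableAt, by simp, ?_⟩
    rw [M.deriv_ev]
    exact ih _

/-- A Taylor polynomial in `h` of functions of the rescaled variable `x / h`. -/
noncomputable def rescaledSum (N : ℕ) (F : ℕ → E) (h x : ℝ) : ℂ :=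
  ∑ k ∈ Finset.range N, (h : ℂ) ^ k * M.ev (F k) (x / h)

theorem contDiff_rescaledSum (N : ℕ) (F : ℕ → E) (h : ℝ) :
    ContDiff ℝ (⊤ : ℕ∞) (M.rescaledSum N F h) :=
  ContDiff.sum fun k _ => contDiff_const.mul ((M.contDiff_ev (F k)).comp (contDiff_id.div_const h))

theorem deriv_rescaledSum (N : ℕ) (F : ℕ → E) (h : ℝ) :
    deriv (M.rescaledSum N F h)
      = fun x => (h : ℂ)⁻¹ * M.rescaledSum N (fun k => M.diff (F k)) h x := by
  funext x
  have hk : ∀ k ∈ Finset.range N, HasDerivAt (fun x : ℝ => (h : ℂ) ^ k * M.ev (F k) (x / h))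
      ((h : ℂ) ^ k * ((h : ℂ)⁻¹ * M.ev (M.diff (F k)) (x / h))) x := by
    intro k _
    have := ((M.hasDerivAt (F k) (x / h)).scomp x ((hasDerivAt_id x).div_const h)).const_mul
      ((h : ℂ) ^ k)
    simpa [Function.comp_def] using this
  refine (HasDerivAt.fun_sum hk).deriv.trans ?_
  rw [rescaledSum, Finset.mul_sum]
  exact Finset.sum_congr rfl fun k _ => by ring

theorem rescaledSum_zero (N : ℕ) (F : ℕ → E) (h : ℝ) :
    M.rescaledSum N F h 0 = ∑ k ∈ Finset.range N, (h : ℂ) ^ k * M.ev (F k) 0 := by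
  simp [rescaledSum]

/-- If all antidiagonal sums of order less than `N` vanish, the double sum is `O(h ^ N)`. -/
theorem exists_norm_doubleSum_le (N : ℕ) (Q : ℕ → ℕ → E)
    (hQ : ∀ m < N, ∑ p ∈ Finset.HasAntidiagonal.antidiagonal m, Q p.1 p.2 = 0) :
    ∃ K, ∀ h ∈ Set.Ioc (0 : ℝ) 1, ∀ t, 0 ≤ t →
      ‖∑ p ∈ Finset.range N ×ˢ Finset.range N, (h : ℂ) ^ (p.1 + p.2) * M.ev (Q p.1 p.2) t‖
        ≤ K * h ^ N := by
  choose B hB using M.bounded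
  set s := Finset.range N ×ˢ Finset.range N
  refine ⟨∑ p ∈ s with ¬ p.1 + p.2 < N, B (Q p.1 p.2), fun h hh t ht => ?_⟩
  rw [← Finset.sum_filter_add_sum_filter_not s (fun p => p.1 + p.2 < N)]
  have hzero : ∑ p ∈ s with p.1 + p.2 < N, (h : ℂ) ^ (p.1 + p.2) * M.ev (Q p.1 p.2) t = 0 := by
    rw [← Finset.sum_fiberwise_of_maps_to (t := Finset.range N) (g := fun p => p.1 + p.2)
      (by simp)]
    refine Finset.sum_eq_zero fun m hm => ?_
    have hm' : m < N := Finset.mem_range.1 hm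
    have hset : (s.filter (fun p => p.1 + p.2 < N)).filter (fun p => p.1 + p.2 = m)
        = Finset.HasAntidiagonal.antidiagonal m := by
      ext p
      simp only [s, Finset.mem_filter, Finset.mem_product, Finset.mem_range,
        Finset.HasAntidiagonal.mem_antidiagonal]
      omega
    rw [hset]
    calc ∑ p ∈ Finset.HasAntidiagonal.antidiagonal m, (h : ℂ) ^ (p.1 + p.2) * M.ev (Q p.1 p.2) t
        = ∑ p ∈ Finset.HasAntidiagonal.antidiagonal m, (h : ℂ) ^ m * M.ev (Q p.1 p.2) t :=
          Finset.sum_congr rfl fun p hp => by rw [Finset.HasAntidiagonal.mem_antidiagonal.1 hp]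
      _ = (h : ℂ) ^ m * M.ev (∑ p ∈ Finset.HasAntidiagonal.antidiagonal m, Q p.1 p.2) t := by
          rw [← Finset.mul_sum, map_sum, Finset.sum_apply]
      _ = 0 := by rw [hQ m hm']; simp
  rw [hzero, zero_add, Finset.sum_mul]
  refine norm_sum_le_of_le _ fun p hp => ?_
  have hp' : N ≤ p.1 + p.2 := by simpa using (Finset.mem_filter.1 hp).2
  rw [norm_mul, norm_pow, Complex.norm_real, Real.norm_of_nonneg hh.1.le, mul_comm]
  exact mul_le_mul (hB _ t ht) (pow_le_pow_of_le_one hh.1.le hh.2 hp') (by have := hh.1; positivity)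
    ((norm_nonneg _).trans (hB _ t ht))

/-- Replacing a coefficient by its Taylor polynomial of order `N` costs `O(h ^ N)`. -/
theorem exists_norm_coeff_mul_sub_le {γ : ℝ} {α : ℝ → ℂ} {A : ℕ → ℂ} {N : ℕ} {C : ℝ}
    (hα : ∀ x ∈ Set.Icc 0 γ, ‖α x - ∑ j ∈ Finset.range N, A j * (x : ℂ) ^ j‖ ≤ C * x ^ N)
    (G : ℕ → E) :
    ∃ K, ∀ h ∈ Set.Ioc (0 : ℝ) 1, ∀ x ∈ Set.Icc 0 γ,
      ‖α x * M.rescaledSum N G h x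
        - ∑ p ∈ Finset.range N ×ˢ Finset.range N,
          (h : ℂ) ^ (p.1 + p.2) * M.ev ((M.mulVar ^ p.1) (A p.1 • G p.2)) (x / h)‖ ≤ K * h ^ N := by
  choose B hB using M.bounded
  refine ⟨∑ k ∈ Finset.range N, |C| * B ((M.mulVar ^ N) (G k)), fun h hh x hx => ?_⟩
  have hh0 : (h : ℂ) ≠ 0 := by exact_mod_cast hh.1.ne'
  have hsum : ∑ p ∈ Finset.range N ×ˢ Finset.range N,
      (h : ℂ) ^ (p.1 + p.2) * M.ev ((M.mulVar ^ p.1) (A p.1 • G p.2)) (x / h)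
      = (∑ j ∈ Finset.range N, A j * (x : ℂ) ^ j) * M.rescaledSum N G h x := by
    rw [rescaledSum, Finset.sum_mul_sum, ← Finset.sum_product']
    refine Finset.sum_congr rfl fun p _ => ?_
    rw [M.ev_mulVar_pow, map_smul, Pi.smul_apply, smul_eq_mul, pow_add]
    push_cast
    rw [div_pow]
    field_simp
  rw [hsum, ← sub_mul, rescaledSum, Finset.mul_sum, Finset.sum_mul]
  refine norm_sum_le_of_le _ fun k _ => ?_
  have hxh : 0 ≤ x / h := div_nonneg hx.1 hh.1.le
  have hb := hB ((M.mulVar ^ N) (G k)) (x / h) hxh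
  rw [M.ev_mulVar_pow, norm_mul, norm_pow, Complex.norm_real, Real.norm_of_nonneg hxh] at hb
  have hxN : x ^ N = h ^ N * (x / h) ^ N := by
    rw [← mul_pow, mul_div_cancel₀ _ hh.1.ne']
  have hhk : h ^ k ≤ 1 := pow_le_one₀ hh.1.le hh.2
  have hh1 := hh.1.le
  rw [norm_mul, norm_mul, norm_pow, Complex.norm_real, Real.norm_of_nonneg hh.1.le]
  calc ‖α x - ∑ j ∈ Finset.range N, A j * (x : ℂ) ^ j‖ * (h ^ k * ‖M.ev (G k) (x / h)‖)
      ≤ (|C| * x ^ N) * (1 * ‖M.ev (G k) (x / h)‖) := by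
        refine mul_le_mul ((hα x hx).trans ?_) ?_ (by positivity) ?_
        · exact mul_le_mul_of_nonneg_right (le_abs_self C) (pow_nonneg hx.1 N)
        · exact mul_le_mul_of_nonneg_right hhk (norm_nonneg _)
        · exact mul_nonneg (abs_nonneg C) (pow_nonneg hx.1 N)
    _ = |C| * ((x / h) ^ N * ‖M.ev (G k) (x / h)‖) * h ^ N := by rw [hxN]; ring
    _ ≤ |C| * B ((M.mulVar ^ N) (G k)) * h ^ N := by gcongr

/-- The operator on the model given by the `j`-th Taylor coefficients of a second order
operator. -/
noncomputable def taylorOperator (A B D : ℕ → ℂ) (j : ℕ) : E →ₗ[ℂ] E :=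
  (M.mulVar ^ j) ∘ₗ (-A j • M.diff ∘ₗ M.diff - (Complex.I * B j) • M.diff + D j • LinearMap.id)

theorem exists_norm_operator_le {γ : ℝ} {α β δ : ℝ → ℂ} {A B D : ℕ → ℂ} {N : ℕ} {Cα Cβ Cδ : ℝ}
    (hα : ∀ x ∈ Set.Icc 0 γ, ‖α x - ∑ j ∈ Finset.range N, A j * (x : ℂ) ^ j‖ ≤ Cα * x ^ N)
    (hβ : ∀ x ∈ Set.Icc 0 γ, ‖β x - ∑ j ∈ Finset.range N, B j * (x : ℂ) ^ j‖ ≤ Cβ * x ^ N)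
    (hδ : ∀ x ∈ Set.Icc 0 γ, ‖δ x - ∑ j ∈ Finset.range N, D j * (x : ℂ) ^ j‖ ≤ Cδ * x ^ N)
    (F : ℕ → E)
    (hF : ∀ m, ∑ p ∈ Finset.HasAntidiagonal.antidiagonal m, M.taylorOperator A B D p.1 (F p.2) = 0) :
    ∃ K, ∀ h ∈ Set.Ioc (0 : ℝ) 1, ∀ x ∈ Set.Icc 0 γ,
      ‖-(h : ℂ) ^ 2 * α x * deriv (deriv (M.rescaledSum N F h)) x
        - Complex.I * (h : ℂ) * β x * deriv (M.rescaledSum N F h) x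
        + δ x * M.rescaledSum N F h x‖ ≤ K * h ^ N := by
  obtain ⟨K₂, h₂⟩ := M.exists_norm_coeff_mul_sub_le hα (fun k => M.diff (M.diff (F k)))
  obtain ⟨K₁, h₁⟩ := M.exists_norm_coeff_mul_sub_le hβ (fun k => M.diff (F k))
  obtain ⟨K₀, h₀⟩ := M.exists_norm_coeff_mul_sub_le hδ F
  obtain ⟨K, hK⟩ := M.exists_norm_doubleSum_le N
    (fun j k => M.taylorOperator A B D j (F k)) fun m _ => hF m
  refine ⟨K₂ + K₁ + K₀ + K, fun h hh x hx => ?_⟩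
  have hh0 : (h : ℂ) ≠ 0 := by exact_mod_cast hh.1.ne'
  specialize h₂ h hh x hx
  specialize h₁ h hh x hx
  specialize h₀ h hh x hx
  specialize hK h hh (x / h) (div_nonneg hx.1 hh.1.le)
  have hd2 : deriv (deriv (M.rescaledSum N F h)) x
      = (h : ℂ)⁻¹ * ((h : ℂ)⁻¹ * M.rescaledSum N (fun k => M.diff (M.diff (F k))) h x) := by
    rw [M.deriv_rescaledSum, deriv_const_mul_field, M.deriv_rescaledSum]
  rw [hd2, M.deriv_rescaledSum]
  set T₂ := ∑ p ∈ Finset.range N ×ˢ Finset.range N, (h : ℂ) ^ (p.1 + p.2) *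
    M.ev ((M.mulVar ^ p.1) (A p.1 • M.diff (M.diff (F p.2)))) (x / h) with hT₂
  set T₁ := ∑ p ∈ Finset.range N ×ˢ Finset.range N, (h : ℂ) ^ (p.1 + p.2) *
    M.ev ((M.mulVar ^ p.1) (B p.1 • M.diff (F p.2))) (x / h) with hT₁
  set T₀ := ∑ p ∈ Finset.range N ×ˢ Finset.range N, (h : ℂ) ^ (p.1 + p.2) *
    M.ev ((M.mulVar ^ p.1) (D p.1 • F p.2)) (x / h) with hT₀
  have hT : ∑ p ∈ Finset.range N ×ˢ Finset.range N, (h : ℂ) ^ (p.1 + p.2) *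
      M.ev (M.taylorOperator A B D p.1 (F p.2)) (x / h) = -T₂ - Complex.I * T₁ + T₀ := by
    rw [hT₂, hT₁, hT₀, Finset.mul_sum, ← Finset.sum_neg_distrib, ← Finset.sum_sub_distrib,
      ← Finset.sum_add_distrib]
    refine Finset.sum_congr rfl fun p _ => ?_
    simp only [taylorOperator, LinearMap.comp_apply, LinearMap.add_apply, LinearMap.sub_apply,
      LinearMap.smul_apply, LinearMap.id_apply, map_add, map_sub, map_smul, Pi.add_apply,
      Pi.sub_apply, Pi.smul_apply, smul_eq_mul]
    ring
  rw [hT] at hK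
  set S₂ := M.rescaledSum N (fun k => M.diff (M.diff (F k))) h x
  set S₁ := M.rescaledSum N (fun k => M.diff (F k)) h x
  set S₀ := M.rescaledSum N F h x
  have hsplit : -(h : ℂ) ^ 2 * α x * ((h : ℂ)⁻¹ * ((h : ℂ)⁻¹ * S₂))
      - Complex.I * (h : ℂ) * β x * ((h : ℂ)⁻¹ * S₁) + δ x * S₀
      = -(α x * S₂ - T₂) + -(Complex.I * (β x * S₁ - T₁)) + (δ x * S₀ - T₀)
        + (-T₂ - Complex.I * T₁ + T₀) := by
    field_simp
    ring
  rw [hsplit]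
  have e₂ : ‖-(α x * S₂ - T₂)‖ ≤ K₂ * h ^ N := by rwa [norm_neg]
  have e₁ : ‖-(Complex.I * (β x * S₁ - T₁))‖ ≤ K₁ * h ^ N := by
    rwa [norm_neg, norm_mul, Complex.norm_I, one_mul]
  linarith [norm_add₄_le (a := -(α x * S₂ - T₂)) (b := -(Complex.I * (β x * S₁ - T₁)))
    (c := δ x * S₀ - T₀) (d := -T₂ - Complex.I * T₁ + T₀)]

/-- A rescaled sum with nonzero leading term stays away from zero on an interval of length
proportional to `h`. -/
theorem exists_le_norm_rescaledSum (N : ℕ) (F : ℕ → E) {t₀ : ℝ} (ht₀ : 0 < t₀)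
    (hF : M.ev (F 0) t₀ ≠ 0) :
    ∃ δ > 0, ∃ t₁ > t₀, ∃ h₀ > 0, ∀ h ∈ Set.Ioc (0 : ℝ) h₀,
      ∀ x ∈ Set.Icc (h * t₀) (h * t₁), δ ≤ ‖M.rescaledSum (N + 1) F h x‖ := by
  choose B hB using M.bounded
  set δ := ‖M.ev (F 0) t₀‖ / 4 with hδ
  have hδ0 : 0 < δ := by have := norm_pos_iff.2 hF; positivity
  have hcont : ContinuousAt (fun t => ‖M.ev (F 0) t‖) t₀ :=
    (M.hasDerivAt (F 0) t₀).continuousAt.norm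
  have hev : ∀ᶠ t in 𝓝 t₀, 2 * δ < ‖M.ev (F 0) t‖ :=
    hcont.eventually (lt_mem_nhds (by simp only [hδ] at hδ0 ⊢; linarith))
  obtain ⟨ε, hε, hball⟩ := Metric.eventually_nhds_iff.1 hev
  set K := ∑ k ∈ Finset.range N, |B (F (k + 1))| with hKdef
  have hK : 0 ≤ K := Finset.sum_nonneg fun _ _ => abs_nonneg _
  refine ⟨δ, hδ0, t₀ + ε / 2, by linarith, min 1 (δ / (K + 1)), by positivity,
    fun h hh x hx => ?_⟩
  have hh0 := hh.1
  have hh1 : h ≤ 1 := hh.2.trans (min_le_left _ _)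
  have hhK : h * (K + 1) ≤ δ :=
    (le_div_iff₀ (by positivity)).1 (hh.2.trans (min_le_right _ _))
  have ht1 : t₀ ≤ x / h := (le_div_iff₀ hh0).2 (by linarith [hx.1])
  have ht2 : x / h ≤ t₀ + ε / 2 := (div_le_iff₀ hh0).2 (by linarith [hx.2])
  have hmain : 2 * δ < ‖M.ev (F 0) (x / h)‖ := by
    apply hball
    rw [Real.dist_eq, abs_lt]
    constructor <;> linarith
  have htail : ‖∑ k ∈ Finset.range N, (h : ℂ) ^ (k + 1) * M.ev (F (k + 1)) (x / h)‖ ≤ h * K := by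
    rw [hKdef, Finset.mul_sum]
    refine norm_sum_le_of_le _ fun k _ => ?_
    rw [norm_mul, norm_pow, Complex.norm_real, Real.norm_of_nonneg hh0.le]
    refine mul_le_mul ?_ ((hB _ _ (ht₀.le.trans ht1)).trans (le_abs_self _)) (norm_nonneg _) hh0.le
    exact pow_le_of_le_one hh0.le hh1 (by omega)
  rw [rescaledSum, Finset.sum_range_succ']
  simp only [pow_zero, one_mul]
  have := norm_sub_le
    (∑ k ∈ Finset.range N, (h : ℂ) ^ (k + 1) * M.ev (F (k + 1)) (x / h) + M.ev (F 0) (x / h))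
    (∑ k ∈ Finset.range N, (h : ℂ) ^ (k + 1) * M.ev (F (k + 1)) (x / h))
  rw [add_sub_cancel_left] at this
  linarith

end HalfLineModel

theorem ofReal_mul_sqrt_le_eLpNorm {γ p q δ : ℝ} (hp : 0 ≤ p) (hq : q ≤ γ) (hpq : p ≤ q)
    (hδ : 0 ≤ δ) {f : ℝ → ℂ} (hf : ∀ x ∈ Set.Icc p q, δ ≤ ‖f x‖) :
    ENNReal.ofReal (δ * √(q - p)) ≤ eLpNorm f 2 (volume.restrict (Set.Icc 0 γ)) := by
  have hle : volume.restrict (Set.Icc p q) ≤ volume.restrict (Set.Icc 0 γ) :=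
    Measure.restrict_mono (Set.Icc_subset_Icc hp hq) le_rfl
  refine le_trans ?_ (eLpNorm_mono_measure f hle)
  have hae : ∀ᵐ x ∂volume.restrict (Set.Icc p q), ‖δ‖ ≤ ‖f x‖ := by
    filter_upwards [ae_restrict_mem measurableSet_Icc] with x hx
    rw [Real.norm_of_nonneg hδ]
    exact hf x hx
  refine le_trans (le_of_eq ?_) (eLpNorm_mono_ae hae)
  rw [eLpNorm_const' δ two_ne_zero ENNReal.ofNat_ne_top, Measure.restrict_apply_univ,
    Real.volume_Icc, ENNReal.ofReal_rpow_of_nonneg (sub_nonneg.2 hpq) (by positivity),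
    Real.enorm_eq_ofReal hδ, ← ENNReal.ofReal_mul hδ, Real.sqrt_eq_rpow]
  simp

theorem eLpNorm_le_ofReal_mul_sqrt {γ K : ℝ} (hγ : 0 ≤ γ) {f : ℝ → ℂ}
    (hf : ∀ x ∈ Set.Icc 0 γ, ‖f x‖ ≤ K) :
    eLpNorm f 2 (volume.restrict (Set.Icc 0 γ)) ≤ ENNReal.ofReal (K * √γ) := by
  have hae : ∀ᵐ x ∂volume.restrict (Set.Icc 0 γ), ‖f x‖ ≤ K := by
    filter_upwards [ae_restrict_mem measurableSet_Icc] with x hx using hf x hx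
  refine (eLpNorm_le_of_ae_bound hae).trans (le_of_eq ?_)
  rw [Measure.restrict_apply_univ, Real.volume_Icc, sub_zero,
    ENNReal.ofReal_rpow_of_nonneg hγ (by positivity), ← ENNReal.ofReal_mul (by positivity),
    Real.sqrt_eq_rpow, mul_comm]
  simp

theorem exists_taylor_coefficients {γ : ℝ} (hγ : 0 ≤ γ) {f : ℝ → ℂ}
    (hf : ContDiffOn ℝ (⊤ : ℕ∞) f (Set.Icc 0 γ)) (N : ℕ) :
    ∃ A : ℕ → ℂ, A 0 = f 0 ∧ ∃ C : ℝ, ∀ x ∈ Set.Icc 0 γ,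
      ‖f x - ∑ j ∈ Finset.range (N + 1), A j * (x : ℂ) ^ j‖ ≤ C * x ^ (N + 1) := by
  obtain ⟨C, hC⟩ := exists_taylor_mean_remainder_bound (n := N) hγ
    (hf.of_le (by exact_mod_cast le_top))
  refine ⟨fun j => ((j.factorial : ℂ))⁻¹ * iteratedDerivWithin j f (Set.Icc 0 γ) 0, by simp, C,
    fun x hx => ?_⟩
  have := hC x hx
  rw [taylor_within_apply, sub_zero] at this
  refine (congrArg (fun y => ‖f x - y‖) (Finset.sum_congr rfl fun j _ => ?_)).trans_le this
  rw [Complex.real_smul]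
  push_cast
  ring

theorem exists_pos_expPolynomial_add_ne_zero {ξ₁ ξ₂ α₁ α₂ : ℂ} (hne : ξ₁ ≠ ξ₂)
    (hα : ¬(α₁ = 0 ∧ α₂ = 0)) :
    ∃ t > 0, expPolynomial ξ₁ (Polynomial.C α₁) t + expPolynomial ξ₂ (Polynomial.C α₂) t ≠ 0 := by
  by_contra! hzero
  have hd := (expPolynomial_hasDerivAt ξ₁ (Polynomial.C α₁) 1).add
    (expPolynomial_hasDerivAt ξ₂ (Polynomial.C α₂) 1)
  have hev : (expPolynomial ξ₁ (Polynomial.C α₁) + expPolynomial ξ₂ (Polynomial.C α₂))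
      =ᶠ[𝓝 1] fun _ => (0 : ℂ) := by
    filter_upwards [lt_mem_nhds (one_pos : (0 : ℝ) < 1)] with t ht using hzero t ht
  have h1 := (hd.congr_of_eventuallyEq hev.symm).unique (hasDerivAt_const 1 (0 : ℂ))
  have h0 := hzero 1 one_pos
  simp only [expPolynomial_apply, expPolynomialDeriv_apply, Polynomial.derivative_C,
    Polynomial.eval_smul, Polynomial.eval_C, zero_add, smul_eq_mul] at h0 h1
  have hsub : ξ₁ - ξ₂ ≠ 0 := sub_ne_zero.2 hne
  set e₁ := Complex.exp (Complex.I * ξ₁ * (1 : ℝ)) with he₁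
  set e₂ := Complex.exp (Complex.I * ξ₂ * (1 : ℝ)) with he₂
  have h₁ : Complex.I * (ξ₁ - ξ₂) * (α₁ * e₁) = 0 := by
    linear_combination h1 - Complex.I * ξ₂ * h0
  have h₂ : Complex.I * (ξ₁ - ξ₂) * (α₂ * e₂) = 0 := by
    linear_combination Complex.I * ξ₁ * h0 - h1
  simp [hsub, he₁, he₂] at h₁ h₂
  exact hα ⟨h₁, h₂⟩

/-- Theorem 13 (boundary pseudospectra with boundary conditions): under the exit
condition `Im(-b(0)/a(0)) > 0`, for `z` inside the parabola with the two roots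
`ξ₁ ≠ ξ₂` of `σ(0,ξ) = z` in the strip `Λ̃`, and any non-degenerate boundary condition
`u h f'(0) + w f(0) = 0`, there are nonzero smooth functions `f_h` satisfying the
boundary condition with `‖L_h f_h - z f_h‖ / ‖f_h‖ = O(h^{n+2})`. -/
theorem boundary_pseudoeigenfunctions_with_boundary_condition
    (γ₀ : ℝ) (hγ₀ : 0 < γ₀)
    (a b c : ℝ → ℂ)
    (ha : ContDiffOn ℝ (⊤ : ℕ∞) a (Set.Icc 0 γ₀)) (hb : ContDiffOn ℝ (⊤ : ℕ∞) b (Set.Icc 0 γ₀))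
    (hc : ContDiffOn ℝ (⊤ : ℕ∞) c (Set.Icc 0 γ₀))
    (hell : ∀ x ∈ Set.Icc (0:ℝ) γ₀, a x ≠ 0)
    (hexit : 0 < (-(b 0) / a 0).im)
    (z : ℂ) (hz : z ≠ c 0 - (b 0)^2 / (4 * a 0))
    (ξ₁ ξ₂ : ℂ) (hne : ξ₁ ≠ ξ₂)
    (hroot₁ : a 0 * ξ₁^2 + b 0 * ξ₁ + c 0 = z)
    (hroot₂ : a 0 * ξ₂^2 + b 0 * ξ₂ + c 0 = z)
    (hΛ₁ : 0 < ξ₁.im ∧ ξ₁.im < (-(b 0) / a 0).im)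
    (hΛ₂ : 0 < ξ₂.im ∧ ξ₂.im < (-(b 0) / a 0).im)
    (u w : ℂ) (huw : ¬(u = 0 ∧ w = 0)) :
    ∀ n : ℕ, 1 ≤ n →
    ∃ C > (0:ℝ), ∃ h₀ > (0:ℝ), ∃ f : ℝ → ℝ → ℂ,
      ∀ h ∈ Set.Ioc (0:ℝ) h₀,
        ContDiff ℝ (⊤ : ℕ∞) (f h) ∧
        eLpNorm (f h) 2 (volume.restrict (Set.Icc 0 γ₀)) ≠ 0 ∧
        u * (h:ℂ) * deriv (f h) 0 + w * f h 0 = 0 ∧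
        eLpNorm (fun x : ℝ =>
            (-(h:ℂ)^2 * a x * deriv (deriv (f h)) x
              - Complex.I * (h:ℂ) * b x * deriv (f h) x + c x * f h x)
            - z * f h x) 2 (volume.restrict (Set.Icc 0 γ₀))
          ≤ ENNReal.ofReal (C * h ^ (n + 2 : ℕ)) *
            eLpNorm (f h) 2 (volume.restrict (Set.Icc 0 γ₀)) := by
  intro n _
  obtain ⟨A, hA0, Cα, hα⟩ := exists_taylor_coefficients hγ₀.le ha (n + 2)
  obtain ⟨B, hB0, Cβ, hβ⟩ := exists_taylor_coefficients hγ₀.le hb (n + 2)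
  obtain ⟨D, hD0, Cδ, hδ⟩ := exists_taylor_coefficients hγ₀.le (hc.sub contDiffOn_const) (n + 2)
    (f := fun x => c x - z)
  have ha0 : a 0 ≠ 0 := hell 0 ⟨le_rfl, hγ₀.le⟩
  have hsub : ξ₁ - ξ₂ ≠ 0 := sub_ne_zero.2 hne
  have hsum : a 0 * (ξ₁ + ξ₂) + b 0 = 0 :=
    mul_left_cancel₀ hsub (by linear_combination hroot₁ - hroot₂)
  have hr₁ : a 0 * ξ₁ ^ 2 + b 0 * ξ₁ + (c 0 - z) = 0 := by linear_combination hroot₁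
  have hr₂ : a 0 * ξ₂ ^ 2 + b 0 * ξ₂ + (c 0 - z) = 0 := by linear_combination hroot₂
  have hs₁ : 2 * a 0 * ξ₁ + b 0 ≠ 0 := by
    rw [show 2 * a 0 * ξ₁ + b 0 = a 0 * (ξ₁ - ξ₂) by linear_combination hsum]
    exact mul_ne_zero ha0 hsub
  have hs₂ : 2 * a 0 * ξ₂ + b 0 ≠ 0 := by
    rw [show 2 * a 0 * ξ₂ + b 0 = -(a 0 * (ξ₁ - ξ₂)) by linear_combination hsum]
    exact neg_ne_zero.2 (mul_ne_zero ha0 hsub)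
  let M := expPolynomialModel hΛ₁.1 hΛ₂.1
  let bc : (Polynomial ℂ × Polynomial ℂ) → ℂ := fun F => u * M.ev (M.diff F) 0 + w * M.ev F 0
  have hbc_add : ∀ F G, bc (F + G) = bc F + bc G := fun F G => by
    simp only [bc, map_add, Pi.add_apply]; ring
  set β₁ := Complex.I * u * ξ₁ + w with hβ₁
  set β₂ := Complex.I * u * ξ₂ + w with hβ₂
  have hββ : ¬(β₁ = 0 ∧ β₂ = 0) := by
    rintro ⟨h₁, h₂⟩
    have hu : Complex.I * u * (ξ₁ - ξ₂) = 0 := by linear_combination h₁ - h₂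
    have hu0 : u = 0 := by simpa [hsub] using hu
    exact huw ⟨hu0, by simpa [hβ₁, hu0] using h₁⟩
  have hbc_const : ∀ α₁ α₂ : ℂ, bc (Polynomial.C α₁, Polynomial.C α₂) = α₁ * β₁ + α₂ * β₂ := by
    intro α₁ α₂
    simp [bc, M, expPolynomialModel, expPolynomial_apply, expPolynomialDeriv_apply, hβ₁, hβ₂]
    ring
  have hP : ∀ p q : Polynomial ℂ, M.taylorOperator A B D 0 (p, q)
      = (-a 0 • expPolynomialDeriv ξ₁ (expPolynomialDeriv ξ₁ p)
          - (Complex.I * b 0) • expPolynomialDeriv ξ₁ p + (c 0 - z) • p,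
        -a 0 • expPolynomialDeriv ξ₂ (expPolynomialDeriv ξ₂ q)
          - (Complex.I * b 0) • expPolynomialDeriv ξ₂ q + (c 0 - z) • q) := by
    intro p q
    rw [HalfLineModel.taylorOperator, hA0, hB0, hD0]
    simp [M, expPolynomialModel]
  have hP_const : ∀ α₁ α₂ : ℂ,
      M.taylorOperator A B D 0 (Polynomial.C α₁, Polynomial.C α₂) = 0 := by
    intro α₁ α₂
    rw [hP, Prod.mk_eq_zero]
    constructor
    · exact expPolynomialDeriv_operator_C hr₁ α₁
    · exact expPolynomialDeriv_operator_C hr₂ α₂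
  have hsurj : ∀ g, ∃ F, bc F = 0 ∧ M.taylorOperator A B D 0 F = g := by
    rintro ⟨g₁, g₂⟩
    obtain ⟨p, hp⟩ := exists_expPolynomialDeriv_eq hr₁ hs₁ g₁
    obtain ⟨q, hq⟩ := exists_expPolynomialDeriv_eq hr₂ hs₂ g₂
    obtain ⟨α₁, α₂, hα₁₂⟩ : ∃ α₁ α₂ : ℂ, α₁ * β₁ + α₂ * β₂ = -bc (p, q) := by
      by_cases h₁ : β₁ = 0
      · have h₂ : β₂ ≠ 0 := fun h₂ => hββ ⟨h₁, h₂⟩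
        exact ⟨0, -bc (p, q) / β₂, by field_simp; ring⟩
      · exact ⟨-bc (p, q) / β₁, 0, by field_simp; ring⟩
    refine ⟨(p, q) + (Polynomial.C α₁, Polynomial.C α₂), ?_, ?_⟩
    · rw [hbc_add, hbc_const, hα₁₂, add_neg_cancel]
    · rw [map_add, hP_const, add_zero, hP, hp, hq]
  obtain ⟨F, hF0, hFbc, hF⟩ := exists_formalSolution (M.taylorOperator A B D) (fun F => bc F = 0)
    hsurj (e := (Polynomial.C β₂, Polynomial.C (-β₁))) (by rw [hbc_const]; ring) (hP_const _ _)
  obtain ⟨t₀, ht₀, hFt⟩ := exists_pos_expPolynomial_add_ne_zero hne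
    (α₁ := β₂) (α₂ := -β₁) (by rw [neg_eq_zero, and_comm]; exact hββ)
  obtain ⟨K, hK⟩ := M.exists_norm_operator_le hα hβ hδ F hF
  obtain ⟨δ, hδ0, t₁, ht₁, h₁, hh₁, hlow⟩ := M.exists_le_norm_rescaledSum (n + 2) F ht₀
    (by rw [hF0]; exact hFt)
  have ht : 0 < t₁ - t₀ := sub_pos.2 ht₁
  have ht₁0 : 0 < t₁ := ht₀.trans ht₁
  have hsqrt : 0 < √(t₁ - t₀) := Real.sqrt_pos.2 ht
  refine ⟨|K| * √γ₀ / (δ * √(t₁ - t₀)) + 1, by positivity, min (min 1 h₁) (γ₀ / t₁),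
    by positivity, M.rescaledSum (n + 2 + 1) F, fun h hh => ?_⟩
  have hh0 : 0 < h := hh.1
  have hh1 : h ≤ 1 := hh.2.trans ((min_le_left _ _).trans (min_le_left _ _))
  have hhh₁ : h ≤ h₁ := hh.2.trans ((min_le_left _ _).trans (min_le_right _ _))
  have hhγ : h * t₁ ≤ γ₀ := (le_div_iff₀ ht₁0).1 (hh.2.trans (min_le_right _ _))
  have hlower := ofReal_mul_sqrt_le_eLpNorm (γ := γ₀) (p := h * t₀) (q := h * t₁) (by positivity)
    hhγ (by gcongr) hδ0.le (hlow h ⟨hh0, hhh₁⟩)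
  rw [← mul_sub, Real.sqrt_mul hh0.le] at hlower
  have hsqrth : 0 < √h := Real.sqrt_pos.2 hh0
  refine ⟨M.contDiff_rescaledSum _ _ _, fun hzero => ?_, ?_, ?_⟩
  · rw [hzero, nonpos_iff_eq_zero, ENNReal.ofReal_eq_zero] at hlower
    exact absurd hlower (not_le.2 (by positivity))
  · have hhC : (h : ℂ) ≠ 0 := by exact_mod_cast hh0.ne'
    rw [congrFun (M.deriv_rescaledSum _ _ _) 0, M.rescaledSum_zero, M.rescaledSum_zero, ← mul_assoc,
      mul_inv_cancel_right₀ hhC, Finset.mul_sum, Finset.mul_sum, ← Finset.sum_add_distrib]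
    refine Finset.sum_eq_zero fun k _ => ?_
    linear_combination (h : ℂ) ^ k * hFbc k
  · refine (eLpNorm_le_ofReal_mul_sqrt hγ₀.le (K := |K| * h ^ (n + 3)) fun x hx => ?_).trans
      (le_trans ?_ (mul_le_mul_right hlower _))
    · rw [add_sub_assoc, ← sub_mul]
      exact (hK h ⟨hh0, hh1⟩ x hx).trans
        (mul_le_mul_of_nonneg_right (le_abs_self K) (by positivity))
    · rw [← ENNReal.ofReal_mul (by positivity)]
      refine ENNReal.ofReal_le_ofReal ?_
      have hle : h ≤ √h := Real.le_sqrt_of_sq_le (by nlinarith)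
      calc |K| * h ^ (n + 3) * √γ₀ = |K| * √γ₀ * h ^ (n + 2) * h := by ring
        _ ≤ |K| * √γ₀ * h ^ (n + 2) * √h := by gcongr
        _ = |K| * √γ₀ / (δ * √(t₁ - t₀)) * h ^ (n + 2) * (δ * (√h * √(t₁ - t₀))) := by
            field_simp
        _ ≤ (|K| * √γ₀ / (δ * √(t₁ - t₀)) + 1) * h ^ (n + 2) * (δ * (√h * √(t₁ - t₀))) := by
            gcongr
            linarith
end

section
/- Let ℝ^N_+ = {x ∈ ℝ^N : x^N ≥ 0} and let U = {x ∈ ℝ^N_+ : |x| < ρ} for some ρ > 0. Let a^{jk}, b^j, b₁^j, c, c₁, c₂ be C^∞ complex-valued functions on U, let v be a C^∞ positive density on U, and for h ∈ (0,1] let (L_h f)(x) = −h² a^{jk}(x) ∂_j∂_k f(x) − i h (b^j(x) + h b₁^j(x)) ∂_j f(x) + (c(x) + h c₁(x) + h² c₂(x)) f(x) (summation over repeated indices). Let σ(x,ξ) = a^{jk}(x) ξ_j ξ_k + b^j(x) ξ_j + c(x). Let ξ = (ξ′, ξ_N) ∈ ℂ^N with ξ′ ∈ ℝ^{N−1} and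 Im(ξ_N) > 0. Then there exist constants c > 0, c′ > 0, C > 0 and, for every sufficiently small h > 0, a smooth function f_h on ℝ^N_+ supported in {x ∈ ℝ^N_+ : |x| ≤ c′ h^{1/2}}, such that lim_{h→0+} ‖f_h‖_{L²(v dx)} = c and ‖L_h f_h − σ(0,ξ) f_h‖_{L²(v dx)} ≤ C h^{1/2}. -/
open MeasureTheory
open scoped ENNReal Topology

/-- Coordinate basis vectors of the half-space model `ℝ^N × ℝ` of `ℝ^{N+1}_+`,
the last coordinate being normal to the boundary. -/
noncomputable def coordVec (N : ℕ) (i : Fin (N + 1)) : EuclideanSpace ℝ (Fin N) × ℝ :=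
  if h : (i : ℕ) < N then (EuclideanSpace.single ⟨i, h⟩ 1, 0) else (0, 1)

/-- Partial derivative in the `i`-th coordinate direction. -/
noncomputable def pderivC (N : ℕ) (i : Fin (N + 1))
    (f : EuclideanSpace ℝ (Fin N) × ℝ → ℂ) (x : EuclideanSpace ℝ (Fin N) × ℝ) : ℂ :=
  fderiv ℝ f x (coordVec N i)

/-- The half-ball `U = {x ∈ ℝ^{N+1}_+ : |x| < ρ}` in the half-space model. -/
def halfBall (N : ℕ) (ρ : ℝ) : Set (EuclideanSpace ℝ (Fin N) × ℝ) :=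
  {x | 0 ≤ x.2 ∧ Real.sqrt (‖x.1‖^2 + x.2^2) < ρ}

/-- The complex linear phase `x ↦ ∑ ξ_i x_i` on the half-space model. -/
noncomputable def phaseForm {N : ℕ} (ξ : Fin (N + 1) → ℂ) :
    EuclideanSpace ℝ (Fin N) × ℝ →L[ℝ] ℂ :=
  (∑ i : Fin N, ((EuclideanSpace.proj i).comp
      (ContinuousLinearMap.fst ℝ (EuclideanSpace ℝ (Fin N)) ℝ)).smulRight (ξ i.castSucc)) +
    (ContinuousLinearMap.snd ℝ (EuclideanSpace ℝ (Fin N)) ℝ).smulRight (ξ (Fin.last N))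

lemma phaseForm_apply {N : ℕ} (ξ : Fin (N + 1) → ℂ) (x : EuclideanSpace ℝ (Fin N) × ℝ) :
    phaseForm ξ x = (∑ i : Fin N, (x.1 i : ℂ) * ξ i.castSucc) + (x.2 : ℂ) * ξ (Fin.last N) := by
  simp [phaseForm]

lemma phaseForm_coordVec {N : ℕ} (ξ : Fin (N + 1) → ℂ) (i : Fin (N + 1)) :
    phaseForm ξ (coordVec N i) = ξ i := by
  rw [phaseForm_apply]
  refine Fin.lastCases ?_ (fun j => ?_) i
  · simp [coordVec]
  · simp only [coordVec, Fin.val_castSucc, Fin.is_lt, dite_true, Fin.eta]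
    rw [Finset.sum_eq_single j] <;> simp +contextual

lemma phaseForm_im {N : ℕ} (ξ : Fin (N + 1) → ℂ)
    (hξ : ∀ i : Fin (N + 1), (i : ℕ) < N → (ξ i).im = 0)
    (x : EuclideanSpace ℝ (Fin N) × ℝ) :
    (phaseForm ξ x).im = (ξ (Fin.last N)).im * x.2 := by
  rw [phaseForm_apply]
  have h : ∀ i : Fin N, (ξ i.castSucc).im = 0 := fun i => hξ _ (by simp)
  simp [h, mul_comm]

/-- The wave packet `A e^{α ξ·x} ψ(β x)`. -/
noncomputable def wavePacket {N : ℕ} (ξ : Fin (N + 1) → ℂ) (A α : ℂ) (β : ℝ)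
    (ψ : EuclideanSpace ℝ (Fin N) × ℝ → ℂ) (x : EuclideanSpace ℝ (Fin N) × ℝ) : ℂ :=
  A * Complex.exp (α * phaseForm ξ x) * ψ (β • x)

lemma contDiff_wavePacket {N : ℕ} (ξ : Fin (N + 1) → ℂ) (A α : ℂ) (β : ℝ)
    {ψ : EuclideanSpace ℝ (Fin N) × ℝ → ℂ} (hψ : ContDiff ℝ (⊤ : ℕ∞) ψ) :
    ContDiff ℝ (⊤ : ℕ∞) (wavePacket ξ A α β ψ) := by
  unfold wavePacket
  have h1 : ContDiff ℝ (⊤ : ℕ∞) (fun x => phaseForm ξ x) := (phaseForm ξ).contDiff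
  have h2 : ContDiff ℝ (⊤ : ℕ∞) (fun x : EuclideanSpace ℝ (Fin N) × ℝ => ψ (β • x)) :=
    hψ.comp (contDiff_const_smul β)
  exact (contDiff_const.mul (contDiff_const.mul h1).cexp).mul h2

lemma contDiff_pderivC {N : ℕ} (k : Fin (N + 1)) {ψ : EuclideanSpace ℝ (Fin N) × ℝ → ℂ}
    (hψ : ContDiff ℝ (⊤ : ℕ∞) ψ) : ContDiff ℝ (⊤ : ℕ∞) (pderivC N k ψ) := by
  unfold pderivC
  exact (hψ.fderiv_right (m := (⊤ : ℕ∞)) (by simp)).clm_apply contDiff_const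

lemma tsupport_pderivC_subset {N : ℕ} (k : Fin (N + 1))
    (ψ : EuclideanSpace ℝ (Fin N) × ℝ → ℂ) : tsupport (pderivC N k ψ) ⊆ tsupport ψ :=
  tsupport_fderiv_apply_subset ℝ _

lemma pderivC_wavePacket {N : ℕ} (ξ : Fin (N + 1) → ℂ) (A α : ℂ) (β : ℝ)
    {ψ : EuclideanSpace ℝ (Fin N) × ℝ → ℂ} (hψ : ContDiff ℝ (⊤ : ℕ∞) ψ) (k : Fin (N + 1)) :
    pderivC N k (wavePacket ξ A α β ψ) =
      wavePacket ξ A α β (fun y => α * ξ k * ψ y + β * pderivC N k ψ y) := by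
  funext x
  have hψ' : HasFDerivAt ψ (fderiv ℝ ψ (β • x)) (β • x) :=
    (hψ.differentiable (by simp) _).hasFDerivAt
  have hs : HasFDerivAt (fun x : EuclideanSpace ℝ (Fin N) × ℝ => β • x)
      (β • ContinuousLinearMap.id ℝ _) x := (hasFDerivAt_id x).const_smul β
  have h1 := (((phaseForm ξ).hasFDerivAt (x := x)).const_mul α).cexp.const_mul A
  have h2 := h1.mul (hψ'.comp x hs)
  have : fderiv ℝ (wavePacket ξ A α β ψ) x = _ := h2.fderiv
  simp only [pderivC, this, wavePacket]
  simp [phaseForm_coordVec]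
  ring

lemma pderivC_linearComb {N : ℕ} (k : Fin (N + 1)) (p q : ℂ)
    {ψ χ : EuclideanSpace ℝ (Fin N) × ℝ → ℂ} (hψ : ContDiff ℝ (⊤ : ℕ∞) ψ)
    (hχ : ContDiff ℝ (⊤ : ℕ∞) χ) (x : EuclideanSpace ℝ (Fin N) × ℝ) :
    pderivC N k (fun y => p * ψ y + q * χ y) x = p * pderivC N k ψ x + q * pderivC N k χ x := by
  have h1 := ((hψ.differentiable (by simp) x).hasFDerivAt).const_mul p
  have h2 := ((hχ.differentiable (by simp) x).hasFDerivAt).const_mul q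
  have : fderiv ℝ (fun y => p * ψ y + q * χ y) x = _ := (h1.add h2).fderiv
  simp [pderivC, this]

lemma pderivC_pderivC_wavePacket {N : ℕ} (ξ : Fin (N + 1) → ℂ) (A α : ℂ) (β : ℝ)
    {ψ : EuclideanSpace ℝ (Fin N) × ℝ → ℂ} (hψ : ContDiff ℝ (⊤ : ℕ∞) ψ) (j k : Fin (N + 1)) :
    pderivC N j (pderivC N k (wavePacket ξ A α β ψ)) =
      wavePacket ξ A α β (fun y => α ^ 2 * ξ j * ξ k * ψ y
        + α * β * (ξ j * pderivC N k ψ y + ξ k * pderivC N j ψ y)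
        + β ^ 2 * pderivC N j (pderivC N k ψ) y) := by
  have hk := contDiff_pderivC k hψ
  rw [pderivC_wavePacket ξ A α β hψ,
    pderivC_wavePacket ξ A α β ((contDiff_const.mul hψ).add (contDiff_const.mul hk))]
  congr 1
  funext y
  rw [pderivC_linearComb j _ _ hψ hk]
  ring

lemma enorm_wavePacket_sq {N : ℕ} (ξ : Fin (N + 1) → ℂ)
    (hξ : ∀ i : Fin (N + 1), (i : ℕ) < N → (ξ i).im = 0) {s : ℝ} (A : ℝ)
    (ψ : EuclideanSpace ℝ (Fin N) × ℝ → ℂ) (x : EuclideanSpace ℝ (Fin N) × ℝ) :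
    ‖wavePacket ξ A (Complex.I / (s : ℂ) ^ 2) s⁻¹ ψ x‖ₑ ^ (2 : ℝ) =
      ENNReal.ofReal (A ^ 2) *
        (ENNReal.ofReal (Real.exp (-(2 * (ξ (Fin.last N)).im * (x.2 / s ^ 2)))) *
          ‖ψ (s⁻¹ • x)‖ₑ ^ (2 : ℝ)) := by
  have hre : (Complex.I / (s : ℂ) ^ 2 * phaseForm ξ x).re
      = -((ξ (Fin.last N)).im * (x.2 / s ^ 2)) := by
    have : Complex.I / (s : ℂ) ^ 2 * phaseForm ξ x
        = ((1 / s ^ 2 : ℝ) : ℂ) * (Complex.I * phaseForm ξ x) := by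
      push_cast; ring
    rw [this, Complex.re_ofReal_mul, Complex.I_mul_re, phaseForm_im ξ hξ]
    ring
  have hexp : ‖Complex.exp (Complex.I / (s : ℂ) ^ 2 * phaseForm ξ x)‖ ^ 2 =
      Real.exp (-(2 * (ξ (Fin.last N)).im * (x.2 / s ^ 2))) := by
    rw [Complex.norm_exp, hre, ← Real.exp_nat_mul]
    congr 1
    push_cast
    ring
  rw [wavePacket, enorm_mul, enorm_mul, ENNReal.mul_rpow_of_nonneg _ _ (by norm_num),
    ENNReal.mul_rpow_of_nonneg _ _ (by norm_num), mul_assoc]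
  congr 1
  · rw [← ofReal_norm, ENNReal.rpow_two, ← ENNReal.ofReal_pow (norm_nonneg _)]
    simp
  · congr 1
    rw [← ofReal_norm, ENNReal.rpow_two, ← ENNReal.ofReal_pow (norm_nonneg _), hexp]

lemma lintegral_comp_parabolic_scaling {N : ℕ} {s : ℝ} (hs : 0 < s)
    {g : EuclideanSpace ℝ (Fin N) × ℝ → ℝ≥0∞} (hg : Measurable g) :
    ∫⁻ z : EuclideanSpace ℝ (Fin N) × ℝ, g (s • z.1, s ^ 2 * z.2) =
      ENNReal.ofReal ((s ^ (N + 2))⁻¹) * ∫⁻ x, g x := by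
  have h1 : Measurable (fun y : EuclideanSpace ℝ (Fin N) => s • y) := measurable_const_smul s
  have h2 : Measurable (fun t : ℝ => s ^ 2 • t) := measurable_const_smul (s ^ 2)
  have hmap := Measure.map_prod_map (volume : Measure (EuclideanSpace ℝ (Fin N)))
    (volume : Measure ℝ) h1 h2
  rw [Measure.map_addHaar_smul volume hs.ne', Measure.map_addHaar_smul volume (by positivity),
    Measure.prod_smul_left, Measure.prod_smul_right] at hmap
  have := lintegral_map (μ := (volume : Measure (EuclideanSpace ℝ (Fin N))).prod volume) hg
    (h1.prodMap h2)
  rw [← hmap, lintegral_smul_measure, lintegral_smul_measure] at this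
  simp only [Prod.map_apply', smul_eq_mul] at this
  rw [Measure.volume_eq_prod, ← this, ← mul_assoc, ← ENNReal.ofReal_mul (abs_nonneg _)]
  congr 2
  rw [abs_of_pos (by positivity), abs_of_pos (by positivity)]
  simp [pow_add, mul_comm]

/-- Squared `L²` mass of a wave packet, written in parabolically rescaled coordinates. -/
lemma eLpNorm_wavePacket {N : ℕ} (ξ : Fin (N + 1) → ℂ)
    (hξ : ∀ i : Fin (N + 1), (i : ℕ) < N → (ξ i).im = 0) {s : ℝ} (hs : 0 < s)
    {ψ : EuclideanSpace ℝ (Fin N) × ℝ → ℂ} (hψ : Measurable ψ)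
    {w : EuclideanSpace ℝ (Fin N) × ℝ → ℝ≥0∞} (hw : Measurable w) :
    eLpNorm (wavePacket ξ (√(s ^ (N + 2))⁻¹ : ℝ) (Complex.I / (s : ℂ) ^ 2) s⁻¹ ψ) 2
        (volume.withDensity w) =
      (∫⁻ z : EuclideanSpace ℝ (Fin N) × ℝ, w (s • z.1, s ^ 2 * z.2) *
        (ENNReal.ofReal (Real.exp (-(2 * (ξ (Fin.last N)).im * z.2))) *
          ‖ψ (z.1, s * z.2)‖ₑ ^ (2 : ℝ))) ^ (1 / 2 : ℝ) := by
  rw [eLpNorm_eq_lintegral_rpow_enorm_toReal (by norm_num) (by norm_num)]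
  simp only [ENNReal.toReal_ofNat, enorm_wavePacket_sq ξ hξ]
  have hA : √(s ^ (N + 2))⁻¹ ^ 2 = (s ^ (N + 2))⁻¹ := Real.sq_sqrt (by positivity)
  have hmeas : Measurable fun x : EuclideanSpace ℝ (Fin N) × ℝ =>
      ENNReal.ofReal (Real.exp (-(2 * (ξ (Fin.last N)).im * (x.2 / s ^ 2)))) *
          ‖ψ (s⁻¹ • x)‖ₑ ^ (2 : ℝ) := by
    have : Measurable fun x : EuclideanSpace ℝ (Fin N) × ℝ => ψ (s⁻¹ • x) :=
      hψ.comp (measurable_const_smul _)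
    fun_prop
  congr 1
  rw [lintegral_const_mul _ hmeas, lintegral_withDensity_eq_lintegral_mul _ hw hmeas, hA,
    ← lintegral_comp_parabolic_scaling hs (hw.mul hmeas)]
  refine lintegral_congr fun z => ?_
  have e1 : s ^ 2 * z.2 / s ^ 2 = z.2 := by field_simp
  have e2 : s⁻¹ • ((s • z.1, s ^ 2 * z.2) : EuclideanSpace ℝ (Fin N) × ℝ) = (z.1, s * z.2) := by
    ext1
    · simp [smul_smul, hs.ne']
    · simp; field_simp
  simp only [Pi.mul_apply, e1, e2]

/-- A dominating profile for rescaled wave packet densities. -/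
noncomputable def packetBound (N : ℕ) (M : ℝ≥0∞) (η : ℝ) (z : EuclideanSpace ℝ (Fin N) × ℝ) :
    ℝ≥0∞ :=
  M * ((Metric.closedBall (0 : EuclideanSpace ℝ (Fin N)) 2).indicator 1 z.1 *
    (Set.Ici (0 : ℝ)).indicator (fun t => ENNReal.ofReal (Real.exp (-(2 * η * t)))) z.2)

lemma lintegral_packetBound_ne_top (N : ℕ) {M : ℝ≥0∞} (hM : M ≠ ∞) {η : ℝ} (hη : 0 < η) :
    ∫⁻ z, packetBound N M η z ≠ ∞ := by
  have h1 : Measurable ((Metric.closedBall (0 : EuclideanSpace ℝ (Fin N)) 2).indicator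
      (1 : EuclideanSpace ℝ (Fin N) → ℝ≥0∞)) :=
    measurable_one.indicator Metric.isClosed_closedBall.measurableSet
  have h2 : Measurable ((Set.Ici (0 : ℝ)).indicator
      (fun t => ENNReal.ofReal (Real.exp (-(2 * η * t))))) :=
    Measurable.indicator (by fun_prop) measurableSet_Ici
  unfold packetBound
  rw [lintegral_const_mul _ (by fun_prop), Measure.volume_eq_prod,
    lintegral_prod_mul h1.aemeasurable h2.aemeasurable]
  refine ENNReal.mul_ne_top hM (ENNReal.mul_ne_top ?_ ?_)
  · rw [lintegral_indicator_one Metric.isClosed_closedBall.measurableSet]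
    exact (isCompact_closedBall _ _).measure_lt_top.ne
  · rw [lintegral_indicator measurableSet_Ici, setLIntegral_congr Ioi_ae_eq_Ici.symm]
    have := integrableOn_exp_mul_Ioi (a := -(2 * η)) (by linarith) 0
    simpa only [neg_mul] using this.lintegral_lt_top.ne

lemma rescaled_density_le_packetBound {N : ℕ} {w : EuclideanSpace ℝ (Fin N) × ℝ → ℝ≥0∞}
    {M : ℝ≥0∞} {s : ℝ} (hs : 0 < s) (hneg : ∀ x, x.2 < 0 → w x = 0)
    (hM : ∀ x, 0 ≤ x.2 → ‖x‖ ≤ 2 * s → w x ≤ M) (η : ℝ)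
    {ψ : EuclideanSpace ℝ (Fin N) × ℝ → ℂ} (hψ1 : ∀ y, ‖ψ y‖ ≤ 1)
    (hψ2 : ∀ y, 2 < ‖y‖ → ψ y = 0) (z : EuclideanSpace ℝ (Fin N) × ℝ) :
    w (s • z.1, s ^ 2 * z.2) * (ENNReal.ofReal (Real.exp (-(2 * η * z.2))) *
      ‖ψ (z.1, s * z.2)‖ₑ ^ (2 : ℝ)) ≤ packetBound N M η z := by
  rcases lt_or_ge z.2 0 with hz | hz
  · rw [hneg _ (mul_neg_of_pos_of_neg (by positivity) hz)]
    simp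
  rcases lt_or_ge 2 ‖((z.1, s * z.2) : EuclideanSpace ℝ (Fin N) × ℝ)‖ with hy | hy
  · rw [hψ2 _ hy]
    simp
  rw [Prod.norm_def, max_le_iff] at hy
  simp only [Real.norm_eq_abs] at hy
  have hx : ‖((s • z.1, s ^ 2 * z.2) : EuclideanSpace ℝ (Fin N) × ℝ)‖ ≤ 2 * s := by
    have e : s ^ 2 * z.2 = s * (s * z.2) := by ring
    rw [Prod.norm_def, max_le_iff, norm_smul, e, norm_mul, Real.norm_eq_abs, Real.norm_eq_abs,
      abs_of_pos hs]
    constructor <;> nlinarith [hy.1, hy.2]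
  have hψz : ‖ψ (z.1, s * z.2)‖ₑ ^ (2 : ℝ) ≤ 1 := by
    refine ENNReal.rpow_le_one ?_ (by norm_num)
    rw [← ofReal_norm]
    exact ENNReal.ofReal_le_one.2 (hψ1 _)
  rw [packetBound, Set.indicator_of_mem (by simpa using hy.1), Set.indicator_of_mem (Set.mem_Ici.2 hz),
    Pi.one_apply, one_mul]
  exact mul_le_mul' (hM _ (by positivity) hx) (mul_le_of_le_one_right' hψz)

lemma tendsto_parabolic_scaling {N : ℕ} {z : EuclideanSpace ℝ (Fin N) × ℝ} (hz : 0 ≤ z.2) :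
    Filter.Tendsto (fun s : ℝ => ((s • z.1, s ^ 2 * z.2) : EuclideanSpace ℝ (Fin N) × ℝ))
      (𝓝[>] 0) (𝓝[{x | 0 ≤ x.2}] 0) := by
  refine tendsto_nhdsWithin_iff.2 ⟨?_, ?_⟩
  · have : Continuous fun s : ℝ => ((s • z.1, s ^ 2 * z.2) : EuclideanSpace ℝ (Fin N) × ℝ) := by
      fun_prop
    exact (this.tendsto' 0 0 (by simp)).mono_left nhdsWithin_le_nhds
  · filter_upwards with s
    exact mul_nonneg (sq_nonneg s) hz

/-- The limiting mass of wave packets concentrating at the boundary point `0`. -/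
noncomputable def limitMass {N : ℕ} (w₀ : ℝ≥0∞) (η : ℝ)
    (ψ : EuclideanSpace ℝ (Fin N) × ℝ → ℂ) : ℝ≥0∞ :=
  ∫⁻ z : EuclideanSpace ℝ (Fin N) × ℝ, (Set.Ici (0 : ℝ)).indicator (fun _ => w₀) z.2 *
    (ENNReal.ofReal (Real.exp (-(2 * η * z.2))) * ‖ψ (z.1, 0)‖ₑ ^ (2 : ℝ))

lemma limitMass_ne_zero {N : ℕ} {w₀ : ℝ≥0∞} (hw₀ : w₀ ≠ 0) (η : ℝ)
    {ψ : EuclideanSpace ℝ (Fin N) × ℝ → ℂ} (hψ : Continuous ψ)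
    (hψ1 : ∀ y, ‖y‖ < 1 → ψ y = 1) : limitMass w₀ η ψ ≠ 0 := by
  have h2 : Measurable ((Set.Ici (0 : ℝ)).indicator (fun _ => w₀)) :=
    Measurable.indicator (by fun_prop) measurableSet_Ici
  have hψm : Measurable fun z : EuclideanSpace ℝ (Fin N) × ℝ => ψ (z.1, 0) :=
    (hψ.comp (by fun_prop)).measurable
  refine (((lintegral_pos_iff_support ?_).2 ?_)).ne'
  · exact (h2.comp measurable_snd).mul (Measurable.mul (by fun_prop) (hψm.enorm.pow_const _))
  · have ho : IsOpen (Metric.ball (0 : EuclideanSpace ℝ (Fin N)) 1 ×ˢ Set.Ioi (0 : ℝ)) :=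
      Metric.isOpen_ball.prod isOpen_Ioi
    refine (ho.measure_pos volume ⟨(0, 1), by simp⟩).trans_le (measure_mono ?_)
    rintro ⟨y, t⟩ ⟨hy, ht⟩
    have hy1 : ψ (y, 0) = 1 := hψ1 _ (by simpa [Prod.norm_def] using hy)
    have ht' : t ∈ Set.Ici (0 : ℝ) := le_of_lt (Set.mem_Ioi.1 ht)
    simp [Function.mem_support, hy1, ht', hw₀, Real.exp_pos]

lemma tendsto_rescaled_mass {N : ℕ} {w : EuclideanSpace ℝ (Fin N) × ℝ → ℝ≥0∞}
    (hw : Measurable w) {M : ℝ≥0∞} (hMtop : M ≠ ∞) {δ : ℝ} (hδ : 0 < δ)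
    (hneg : ∀ x, x.2 < 0 → w x = 0) (hM : ∀ x, 0 ≤ x.2 → ‖x‖ ≤ δ → w x ≤ M)
    (hlim : Filter.Tendsto w (𝓝[{x | 0 ≤ x.2}] 0) (𝓝 (w 0))) (hw₀ : w 0 ≠ ∞)
    {η : ℝ} (hη : 0 < η)
    {ψ : EuclideanSpace ℝ (Fin N) × ℝ → ℂ} (hψ : Continuous ψ) (hψ1 : ∀ y, ‖ψ y‖ ≤ 1)
    (hψ2 : ∀ y, 2 < ‖y‖ → ψ y = 0) :
    limitMass (w 0) η ψ ≠ ∞ ∧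
    Filter.Tendsto (fun s : ℝ => ∫⁻ z : EuclideanSpace ℝ (Fin N) × ℝ,
      w (s • z.1, s ^ 2 * z.2) * (ENNReal.ofReal (Real.exp (-(2 * η * z.2))) *
      ‖ψ (z.1, s * z.2)‖ₑ ^ (2 : ℝ))) (𝓝[>] 0) (𝓝 (limitMass (w 0) η ψ)) := by
  have hbd : ∀ᶠ s in 𝓝[>] (0 : ℝ), ∀ z : EuclideanSpace ℝ (Fin N) × ℝ,
      w (s • z.1, s ^ 2 * z.2) * (ENNReal.ofReal (Real.exp (-(2 * η * z.2))) *
      ‖ψ (z.1, s * z.2)‖ₑ ^ (2 : ℝ)) ≤ packetBound N M η z := by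
    filter_upwards [Ioc_mem_nhdsGT (show (0 : ℝ) < δ / 2 by positivity)] with s hs z
    exact rescaled_density_le_packetBound hs.1 hneg
      (fun x hx hxs => hM x hx (hxs.trans (by linarith [hs.2]))) η hψ1 hψ2 z
  have hpt : ∀ z : EuclideanSpace ℝ (Fin N) × ℝ, Filter.Tendsto (fun s : ℝ =>
      w (s • z.1, s ^ 2 * z.2) * (ENNReal.ofReal (Real.exp (-(2 * η * z.2))) *
      ‖ψ (z.1, s * z.2)‖ₑ ^ (2 : ℝ))) (𝓝[>] 0)
      (𝓝 ((Set.Ici (0 : ℝ)).indicator (fun _ => w 0) z.2 *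
        (ENNReal.ofReal (Real.exp (-(2 * η * z.2))) * ‖ψ (z.1, 0)‖ₑ ^ (2 : ℝ)))) := by
    intro z
    rcases lt_or_ge z.2 0 with hz | hz
    · rw [Set.indicator_of_notMem (by simpa using hz), zero_mul]
      refine tendsto_const_nhds.congr' ?_
      filter_upwards [self_mem_nhdsWithin] with s hs
      rw [hneg _ (mul_neg_of_pos_of_neg (pow_pos hs 2) hz), zero_mul]
    · rw [Set.indicator_of_mem (show z.2 ∈ Set.Ici (0 : ℝ) from hz)]
      have hc : Continuous fun s : ℝ => ‖ψ (z.1, s * z.2)‖ₑ ^ (2 : ℝ) :=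
        ENNReal.continuous_rpow_const.comp (hψ.comp (by fun_prop)).enorm
      have h2 := (hc.tendsto' 0 (‖ψ (z.1, 0)‖ₑ ^ (2 : ℝ)) (by simp)).mono_left
        (nhdsWithin_le_nhds (s := Set.Ioi 0))
      have hfin : ‖ψ (z.1, 0)‖ₑ ^ (2 : ℝ) ≠ ∞ := ENNReal.rpow_ne_top_of_nonneg (by norm_num) (by simp)
      exact ENNReal.Tendsto.mul (hlim.comp (tendsto_parabolic_scaling hz))
        (Or.inr (ENNReal.mul_ne_top ENNReal.ofReal_ne_top hfin))
        (ENNReal.Tendsto.const_mul h2 (Or.inr ENNReal.ofReal_ne_top)) (Or.inr hw₀)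
  have hfin := lintegral_packetBound_ne_top N hMtop hη
  constructor
  · refine ne_top_of_le_ne_top hfin (lintegral_mono fun z => ?_)
    exact le_of_tendsto (hpt z) (hbd.mono fun s h => h z)
  · refine tendsto_lintegral_filter_of_dominated_convergence (packetBound N M η) ?_
      (hbd.mono fun s h => Filter.Eventually.of_forall h) hfin (Filter.Eventually.of_forall hpt)
    refine Filter.Eventually.of_forall fun s => ?_
    have h1 : Measurable fun z : EuclideanSpace ℝ (Fin N) × ℝ => w (s • z.1, s ^ 2 * z.2) :=
      hw.comp (Continuous.measurable (by fun_prop))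
    have h2 : Measurable fun z : EuclideanSpace ℝ (Fin N) × ℝ => ψ (z.1, s * z.2) :=
      (hψ.comp (by fun_prop)).measurable
    exact h1.mul (Measurable.mul (by fun_prop) (h2.enorm.pow_const _))

open Asymptotics in
lemma ContDiffOn.isBigO_sub_zero {N : ℕ} {ρ : ℝ} (hρ : 0 < ρ)
    {g : EuclideanSpace ℝ (Fin N) × ℝ → ℂ} (hg : ContDiffOn ℝ (⊤ : ℕ∞) g (halfBall N ρ)) :
    (fun x => g x - g 0) =O[𝓝[halfBall N ρ] 0] fun x => x := by
  have h0 : (0 : EuclideanSpace ℝ (Fin N) × ℝ) ∈ halfBall N ρ := by simp [halfBall, hρ]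
  simpa using (hg.differentiableOn (by simp) 0 h0).isBigO_sub

lemma ContDiffOn.isBigO_one_zero {N : ℕ} {ρ : ℝ} (hρ : 0 < ρ)
    {g : EuclideanSpace ℝ (Fin N) × ℝ → ℂ} (hg : ContDiffOn ℝ (⊤ : ℕ∞) g (halfBall N ρ)) :
    g =O[𝓝[halfBall N ρ] 0] fun _ => (1 : ℝ) := by
  have h0 : (0 : EuclideanSpace ℝ (Fin N) × ℝ) ∈ halfBall N ρ := by simp [halfBall, hρ]
  exact (hg.continuousOn 0 h0).tendsto.isBigO_one ℝ

/-- Pairs `(s, x)` with `s → 0+` and `x` a point of the half-ball with `|x| ≤ 2 s`. -/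
def concentrationFilter (N : ℕ) (ρ : ℝ) : Filter (ℝ × (EuclideanSpace ℝ (Fin N) × ℝ)) :=
  Filter.comap Prod.fst (𝓝[>] 0) ⊓
    Filter.principal {p | p.2 ∈ halfBall N ρ ∧ ‖p.2‖ ≤ 2 * p.1}

lemma tendsto_fst_concentrationFilter (N : ℕ) (ρ : ℝ) :
    Filter.Tendsto Prod.fst (concentrationFilter N ρ) (𝓝[>] 0) :=
  Filter.tendsto_comap.mono_left inf_le_left

lemma eventually_mem_concentrationFilter (N : ℕ) (ρ : ℝ) :
    ∀ᶠ p in concentrationFilter N ρ, p.2 ∈ halfBall N ρ ∧ ‖p.2‖ ≤ 2 * p.1 :=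
  Filter.mem_inf_of_right (Filter.mem_principal_self _)

lemma tendsto_snd_concentrationFilter (N : ℕ) (ρ : ℝ) :
    Filter.Tendsto Prod.snd (concentrationFilter N ρ) (𝓝[halfBall N ρ] 0) := by
  refine tendsto_nhdsWithin_iff.2 ⟨?_, (eventually_mem_concentrationFilter N ρ).mono
    fun p hp => hp.1⟩
  refine squeeze_zero_norm' ((eventually_mem_concentrationFilter N ρ).mono fun p hp => hp.2) ?_
  simpa using ((tendsto_nhds_of_tendsto_nhdsWithin
    (tendsto_fst_concentrationFilter N ρ)).const_mul 2)

open Asymptotics in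
lemma isBigO_snd_concentrationFilter (N : ℕ) (ρ : ℝ) :
    (Prod.snd : ℝ × (EuclideanSpace ℝ (Fin N) × ℝ) → _) =O[concentrationFilter N ρ] Prod.fst := by
  refine IsBigO.of_bound 2 ((eventually_mem_concentrationFilter N ρ).mono fun p hp => ?_)
  exact hp.2.trans (by gcongr; exact le_abs_self _)

/-- The amplitude of `(L_h - σ(0, ξ))` applied to a wave packet, at scale `h = s²`. -/
noncomputable def packetError {N : ℕ}
    (a : Fin (N+1) → Fin (N+1) → EuclideanSpace ℝ (Fin N) × ℝ → ℂ)
    (b b₁ : Fin (N+1) → EuclideanSpace ℝ (Fin N) × ℝ → ℂ)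
    (c c₁ c₂ : EuclideanSpace ℝ (Fin N) × ℝ → ℂ) (ξ : Fin (N+1) → ℂ)
    (φ : EuclideanSpace ℝ (Fin N) × ℝ → ℂ) (p : ℝ × (EuclideanSpace ℝ (Fin N) × ℝ)) : ℂ :=
  (∑ j, ∑ k, ((a j k p.2 - a j k 0) * (ξ j * ξ k) * φ (p.1⁻¹ • p.2)
    - a j k p.2 * ((p.1 : ℂ) * (Complex.I * (ξ j * pderivC N k φ (p.1⁻¹ • p.2)
          + ξ k * pderivC N j φ (p.1⁻¹ • p.2)))
        + (p.1 : ℂ) ^ 2 * pderivC N j (pderivC N k φ) (p.1⁻¹ • p.2))))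
  + (∑ j, ((b j p.2 - b j 0 + (p.1 : ℂ) ^ 2 * b₁ j p.2) * ξ j * φ (p.1⁻¹ • p.2)
    - (p.1 : ℂ) * (b j p.2 + (p.1 : ℂ) ^ 2 * b₁ j p.2)
        * (Complex.I * pderivC N j φ (p.1⁻¹ • p.2))))
  + (c p.2 - c 0 + (p.1 : ℂ) ^ 2 * c₁ p.2 + (p.1 : ℂ) ^ 4 * c₂ p.2) * φ (p.1⁻¹ • p.2)

lemma operator_wavePacket {N : ℕ}
    (a : Fin (N+1) → Fin (N+1) → EuclideanSpace ℝ (Fin N) × ℝ → ℂ)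
    (b b₁ : Fin (N+1) → EuclideanSpace ℝ (Fin N) × ℝ → ℂ)
    (c c₁ c₂ : EuclideanSpace ℝ (Fin N) × ℝ → ℂ) (ξ : Fin (N+1) → ℂ)
    {φ f : EuclideanSpace ℝ (Fin N) × ℝ → ℂ} (hφ : ContDiff ℝ (⊤ : ℕ∞) φ) (A : ℂ) {s : ℝ}
    (hs : s ≠ 0) (hf : f = wavePacket ξ A (Complex.I / (s : ℂ) ^ 2) s⁻¹ φ)
    {h : ℂ} (hh : h = (s : ℂ) ^ 2) (x : EuclideanSpace ℝ (Fin N) × ℝ) :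
    (-h^2 * ∑ j, ∑ k, a j k x * pderivC N j (pderivC N k f) x
        - Complex.I * h * ∑ j, (b j x + h * b₁ j x) * pderivC N j f x
        + (c x + h * c₁ x + h^2 * c₂ x) * f x)
      - ((∑ j, ∑ k, a j k 0 * ξ j * ξ k) + (∑ j, b j 0 * ξ j) + c 0) * f x
    = A * Complex.exp (Complex.I / (s : ℂ) ^ 2 * phaseForm ξ x)
        * packetError a b b₁ c c₁ c₂ ξ φ (s, x) := by
  have hs' : (s : ℂ) ≠ 0 := by exact_mod_cast hs
  have hI : Complex.I ^ 2 = -1 := Complex.I_sq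
  subst hf hh
  simp only [pderivC_pderivC_wavePacket ξ _ _ _ hφ]
  simp only [pderivC_wavePacket ξ _ _ _ hφ]
  simp only [wavePacket, packetError]
  set e := A * Complex.exp (Complex.I / (s : ℂ) ^ 2 * phaseForm ξ x)
  set y := s⁻¹ • x
  push_cast
  rw [mul_add e, mul_add e]
  have second_order : -((s : ℂ) ^ 2) ^ 2 * ∑ j, ∑ k, a j k x *
        (e * ((Complex.I / (s : ℂ) ^ 2) ^ 2 * ξ j * ξ k * φ y
        + Complex.I / (s : ℂ) ^ 2 * (s : ℂ)⁻¹ * (ξ j * pderivC N k φ y + ξ k * pderivC N j φ y)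
        + (s : ℂ)⁻¹ ^ 2 * pderivC N j (pderivC N k φ) y))
      - (∑ j, ∑ k, a j k 0 * ξ j * ξ k) * (e * φ y)
      = e * ∑ j, ∑ k, ((a j k x - a j k 0) * (ξ j * ξ k) * φ y
        - a j k x * ((s : ℂ) * (Complex.I * (ξ j * pderivC N k φ y + ξ k * pderivC N j φ y))
        + (s : ℂ) ^ 2 * pderivC N j (pderivC N k φ) y)) := by
    simp only [Finset.mul_sum, Finset.sum_mul, ← Finset.sum_sub_distrib]
    refine Finset.sum_congr rfl fun j _ => Finset.sum_congr rfl fun k _ => ?_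
    field_simp
    linear_combination (-(e * a j k x * ξ j * ξ k * φ y)) * hI
  have first_order : -(Complex.I * (s : ℂ) ^ 2 * ∑ j, (b j x + (s : ℂ) ^ 2 * b₁ j x) *
        (e * (Complex.I / (s : ℂ) ^ 2 * ξ j * φ y + (s : ℂ)⁻¹ * pderivC N j φ y)))
      - (∑ j, b j 0 * ξ j) * (e * φ y)
      = e * ∑ j, ((b j x - b j 0 + (s : ℂ) ^ 2 * b₁ j x) * ξ j * φ y
        - (s : ℂ) * (b j x + (s : ℂ) ^ 2 * b₁ j x) * (Complex.I * pderivC N j φ y)) := by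
    simp only [Finset.mul_sum, Finset.sum_mul, ← Finset.sum_neg_distrib,
      ← Finset.sum_sub_distrib]
    refine Finset.sum_congr rfl fun j _ => ?_
    field_simp
    ring_nf
    rw [hI]
    ring
  rw [← second_order, ← first_order]
  ring

lemma packetError_eq_zero {N : ℕ}
    (a : Fin (N+1) → Fin (N+1) → EuclideanSpace ℝ (Fin N) × ℝ → ℂ)
    (b b₁ : Fin (N+1) → EuclideanSpace ℝ (Fin N) × ℝ → ℂ)
    (c c₁ c₂ : EuclideanSpace ℝ (Fin N) × ℝ → ℂ) (ξ : Fin (N+1) → ℂ)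
    {φ : EuclideanSpace ℝ (Fin N) × ℝ → ℂ} {s : ℝ} {x : EuclideanSpace ℝ (Fin N) × ℝ}
    (hx : s⁻¹ • x ∉ tsupport φ) : packetError a b b₁ c c₁ c₂ ξ φ (s, x) = 0 := by
  have h0 : φ (s⁻¹ • x) = 0 := image_eq_zero_of_notMem_tsupport hx
  have h1 : ∀ j, pderivC N j φ (s⁻¹ • x) = 0 := fun j =>
    image_eq_zero_of_notMem_tsupport fun h => hx (tsupport_pderivC_subset j φ h)
  have h2 : ∀ j k, pderivC N j (pderivC N k φ) (s⁻¹ • x) = 0 := fun j k =>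
    image_eq_zero_of_notMem_tsupport fun h =>
      hx (tsupport_pderivC_subset k φ (tsupport_pderivC_subset j _ h))
  simp [packetError, h0, h1, h2]

open Asymptotics in
lemma isBigO_packetError {N : ℕ} {ρ : ℝ} (hρ : 0 < ρ)
    {a : Fin (N+1) → Fin (N+1) → EuclideanSpace ℝ (Fin N) × ℝ → ℂ}
    {b b₁ : Fin (N+1) → EuclideanSpace ℝ (Fin N) × ℝ → ℂ}
    {c c₁ c₂ : EuclideanSpace ℝ (Fin N) × ℝ → ℂ}
    (ha : ∀ j k, ContDiffOn ℝ (⊤ : ℕ∞) (a j k) (halfBall N ρ))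
    (hb : ∀ j, ContDiffOn ℝ (⊤ : ℕ∞) (b j) (halfBall N ρ))
    (hb₁ : ∀ j, ContDiffOn ℝ (⊤ : ℕ∞) (b₁ j) (halfBall N ρ))
    (hc : ContDiffOn ℝ (⊤ : ℕ∞) c (halfBall N ρ)) (hc₁ : ContDiffOn ℝ (⊤ : ℕ∞) c₁ (halfBall N ρ))
    (hc₂ : ContDiffOn ℝ (⊤ : ℕ∞) c₂ (halfBall N ρ)) (ξ : Fin (N+1) → ℂ)
    {φ : EuclideanSpace ℝ (Fin N) × ℝ → ℂ} (hφ : ContDiff ℝ (⊤ : ℕ∞) φ)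
    (hφc : HasCompactSupport φ) :
    packetError a b b₁ c c₁ c₂ ξ φ =O[concentrationFilter N ρ] Prod.fst := by
  set l := concentrationFilter N ρ
  have hsnd := tendsto_snd_concentrationFilter N ρ
  have hfst := tendsto_nhds_of_tendsto_nhdsWithin (tendsto_fst_concentrationFilter N ρ)
  have hsub : ∀ {g : EuclideanSpace ℝ (Fin N) × ℝ → ℂ},
      ContDiffOn ℝ (⊤ : ℕ∞) g (halfBall N ρ) →
      (fun p : ℝ × (EuclideanSpace ℝ (Fin N) × ℝ) => g p.2 - g 0) =O[l] Prod.fst := fun hg =>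
    ((hg.isBigO_sub_zero hρ).comp_tendsto hsnd).trans (isBigO_snd_concentrationFilter N ρ)
  have hone : ∀ {g : EuclideanSpace ℝ (Fin N) × ℝ → ℂ},
      ContDiffOn ℝ (⊤ : ℕ∞) g (halfBall N ρ) →
      (fun p : ℝ × (EuclideanSpace ℝ (Fin N) × ℝ) => g p.2) =O[l] fun _ => (1 : ℝ) := fun hg =>
    (hg.isBigO_one_zero hρ).comp_tendsto hsnd
  have hprof : ∀ {ψ : EuclideanSpace ℝ (Fin N) × ℝ → ℂ}, Continuous ψ → HasCompactSupport ψ →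
      (fun p : ℝ × (EuclideanSpace ℝ (Fin N) × ℝ) => ψ (p.1⁻¹ • p.2)) =O[l]
        fun _ => (1 : ℝ) := by
    intro ψ h1 h2
    obtain ⟨K, hK⟩ := h1.bounded_above_of_compact_support h2
    exact IsBigO.of_bound K (Filter.Eventually.of_forall fun p => by simpa using hK _)
  have hs : (fun p : ℝ × (EuclideanSpace ℝ (Fin N) × ℝ) => (p.1 : ℂ)) =O[l] Prod.fst :=
    IsBigO.of_bound 1 (Filter.Eventually.of_forall fun p => by simp)
  have hs1 : (fun p : ℝ × (EuclideanSpace ℝ (Fin N) × ℝ) => (p.1 : ℂ)) =O[l]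
      fun _ => (1 : ℝ) := hs.trans (hfst.isBigO_one ℝ)
  have hspow : ∀ n : ℕ, (fun p : ℝ × (EuclideanSpace ℝ (Fin N) × ℝ) => (p.1 : ℂ) ^ (n + 1))
      =O[l] Prod.fst := fun n => by
    simpa [pow_succ] using (hs1.pow n).mul hs
  have hconst : ∀ z : ℂ, (fun _ : ℝ × (EuclideanSpace ℝ (Fin N) × ℝ) => z) =O[l]
      fun _ => (1 : ℝ) := fun z => isBigO_const_const z one_ne_zero l
  have hmul : ∀ {F G : ℝ × (EuclideanSpace ℝ (Fin N) × ℝ) → ℂ}, F =O[l] Prod.fst →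
      G =O[l] (fun _ => (1 : ℝ)) → (fun p => F p * G p) =O[l] Prod.fst := fun hF hG => by
    simpa using hF.mul hG
  have hmul' : ∀ {F G : ℝ × (EuclideanSpace ℝ (Fin N) × ℝ) → ℂ}, F =O[l] (fun _ => (1 : ℝ)) →
      G =O[l] Prod.fst → (fun p => F p * G p) =O[l] Prod.fst := fun hF hG => by
    simpa using hF.mul hG
  have hmul1 : ∀ {F G : ℝ × (EuclideanSpace ℝ (Fin N) × ℝ) → ℂ}, F =O[l] (fun _ => (1 : ℝ)) →
      G =O[l] (fun _ => (1 : ℝ)) → (fun p => F p * G p) =O[l] fun _ => (1 : ℝ) :=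
    fun hF hG => by simpa using hF.mul hG
  have p0 := hprof hφ.continuous hφc
  have c1 : ∀ j, HasCompactSupport (pderivC N j φ) := fun j =>
    hφc.of_isClosed_subset (isClosed_tsupport _) (tsupport_pderivC_subset j φ)
  have p1 := fun j => hprof (contDiff_pderivC j hφ).continuous (c1 j)
  have p2 := fun j k => hprof (contDiff_pderivC j (contDiff_pderivC k hφ)).continuous
    ((c1 k).of_isClosed_subset (isClosed_tsupport _) (tsupport_pderivC_subset j _))
  unfold packetError
  refine IsBigO.add (IsBigO.add ?_ ?_) ?_
  · refine IsBigO.fun_sum fun j _ => IsBigO.fun_sum fun k _ => ?_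
    refine (hmul (hmul (hsub (ha j k)) (hconst _)) p0).sub (hmul' (hone (ha j k)) ?_)
    exact (hmul hs (hmul1 (hconst _) ((hmul1 (hconst _) (p1 k)).add
      (hmul1 (hconst _) (p1 j))))).add (hmul (hspow 1) (p2 j k))
  · refine IsBigO.fun_sum fun j _ => ?_
    have hbb := hmul (hspow 1) (hone (hb₁ j))
    exact (hmul (hmul ((hsub (hb j)).add hbb) (hconst _)) p0).sub
      (hmul (hmul hs ((hone (hb j)).add (hbb.trans (hfst.isBigO_one ℝ))))
        (hmul1 (hconst _) (p1 j)))
  · exact hmul (((hsub hc).add (hmul (hspow 1) (hone hc₁))).add (hmul (hspow 3) (hone hc₂))) p0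

lemma exists_norm_packetError_le {N : ℕ} {ρ : ℝ} (hρ : 0 < ρ)
    {a : Fin (N+1) → Fin (N+1) → EuclideanSpace ℝ (Fin N) × ℝ → ℂ}
    {b b₁ : Fin (N+1) → EuclideanSpace ℝ (Fin N) × ℝ → ℂ}
    {c c₁ c₂ : EuclideanSpace ℝ (Fin N) × ℝ → ℂ}
    (ha : ∀ j k, ContDiffOn ℝ (⊤ : ℕ∞) (a j k) (halfBall N ρ))
    (hb : ∀ j, ContDiffOn ℝ (⊤ : ℕ∞) (b j) (halfBall N ρ))
    (hb₁ : ∀ j, ContDiffOn ℝ (⊤ : ℕ∞) (b₁ j) (halfBall N ρ))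
    (hc : ContDiffOn ℝ (⊤ : ℕ∞) c (halfBall N ρ)) (hc₁ : ContDiffOn ℝ (⊤ : ℕ∞) c₁ (halfBall N ρ))
    (hc₂ : ContDiffOn ℝ (⊤ : ℕ∞) c₂ (halfBall N ρ)) (ξ : Fin (N+1) → ℂ)
    {φ : EuclideanSpace ℝ (Fin N) × ℝ → ℂ} (hφ : ContDiff ℝ (⊤ : ℕ∞) φ)
    (hφc : tsupport φ ⊆ Metric.closedBall 0 2) :
    ∃ K > (0 : ℝ), ∀ᶠ s in 𝓝[>] (0 : ℝ), ∀ x ∈ halfBall N ρ,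
      ‖packetError a b b₁ c c₁ c₂ ξ φ (s, x)‖ ≤
        K * s * ‖(Metric.closedBall (0 : EuclideanSpace ℝ (Fin N) × ℝ) 2).indicator
          (fun _ => (1 : ℂ)) (s⁻¹ • x)‖ := by
  have hcomp : HasCompactSupport φ :=
    (isCompact_closedBall _ _).of_isClosed_subset (isClosed_tsupport _) hφc
  obtain ⟨K, hKpos, hK⟩ :=
    (isBigO_packetError hρ ha hb hb₁ hc hc₁ hc₂ ξ hφ hcomp).exists_pos
  refine ⟨K, hKpos, ?_⟩
  have hK' := hK.bound
  rw [concentrationFilter, Filter.eventually_inf_principal, Filter.eventually_comap] at hK'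
  filter_upwards [hK', self_mem_nhdsWithin] with s hs hspos x hx
  have hspos : 0 < s := hspos
  by_cases hmem : s⁻¹ • x ∈ Metric.closedBall (0 : EuclideanSpace ℝ (Fin N) × ℝ) 2
  · rw [Set.indicator_of_mem hmem, norm_one, mul_one]
    have hxs : ‖x‖ ≤ 2 * s := by
      rw [mem_closedBall_zero_iff, norm_smul, norm_inv, Real.norm_eq_abs, abs_of_pos hspos,
        inv_mul_le_iff₀ hspos] at hmem
      linarith
    simpa [abs_of_pos hspos] using hs (s, x) rfl ⟨hx, hxs⟩
  · rw [packetError_eq_zero _ _ _ _ _ _ _ fun h => hmem (hφc h), norm_zero]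
    positivity

lemma measurableSet_halfBall (N : ℕ) (ρ : ℝ) : MeasurableSet (halfBall N ρ) := by
  refine MeasurableSet.inter (s₁ := {x : EuclideanSpace ℝ (Fin N) × ℝ | 0 ≤ x.2}) ?_ ?_
  · exact measurableSet_le measurable_const measurable_snd
  · exact measurableSet_lt
      (f := fun x : EuclideanSpace ℝ (Fin N) × ℝ => √(‖x.1‖ ^ 2 + x.2 ^ 2)) (by fun_prop)
      measurable_const

lemma halfBall_mem_nhdsWithin (N : ℕ) {ρ : ℝ} (hρ : 0 < ρ) :
    halfBall N ρ ∈ 𝓝[{x : EuclideanSpace ℝ (Fin N) × ℝ | 0 ≤ x.2}] 0 := by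
  have hc : Continuous fun x : EuclideanSpace ℝ (Fin N) × ℝ => √(‖x.1‖ ^ 2 + x.2 ^ 2) := by
    fun_prop
  have hlt := hc.continuousAt.eventually_lt (x₀ := 0) (g := fun _ => ρ) continuousAt_const
    (by simpa using hρ)
  filter_upwards [self_mem_nhdsWithin, nhdsWithin_le_nhds hlt] with x h1 h2 using ⟨h1, h2⟩

/-- The density of `v dx` on the half-ball, extended by zero. -/
noncomputable def halfBallDensity (N : ℕ) (ρ : ℝ) (v : EuclideanSpace ℝ (Fin N) × ℝ → ℝ) :
    EuclideanSpace ℝ (Fin N) × ℝ → ℝ≥0∞ :=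
  (halfBall N ρ).indicator fun x => ENNReal.ofReal (v x)

lemma measurable_halfBallDensity {N : ℕ} {ρ : ℝ} {v : EuclideanSpace ℝ (Fin N) × ℝ → ℝ}
    (hv : ContinuousOn v (halfBall N ρ)) : Measurable (halfBallDensity N ρ v) := by
  classical
  have h : ContinuousOn (fun x => ENNReal.ofReal (v x)) (halfBall N ρ) :=
    ENNReal.continuous_ofReal.comp_continuousOn hv
  rw [halfBallDensity, ← Set.piecewise_eq_indicator]
  exact h.measurable_piecewise continuousOn_const (measurableSet_halfBall N ρ)

lemma tendsto_halfBallDensity {N : ℕ} {ρ : ℝ} (hρ : 0 < ρ)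
    {v : EuclideanSpace ℝ (Fin N) × ℝ → ℝ} (hv : ContinuousOn v (halfBall N ρ)) :
    Filter.Tendsto (halfBallDensity N ρ v) (𝓝[{x | 0 ≤ x.2}] 0)
      (𝓝 (halfBallDensity N ρ v 0)) := by
  have h0 : (0 : EuclideanSpace ℝ (Fin N) × ℝ) ∈ halfBall N ρ := by simp [halfBall, hρ]
  have h1 := (ENNReal.continuous_ofReal.comp_continuousOn hv 0 h0).tendsto
  have h2 : Filter.Tendsto (fun x => ENNReal.ofReal (v x))
      (𝓝[{x : EuclideanSpace ℝ (Fin N) × ℝ | 0 ≤ x.2}] 0)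
      (𝓝 (halfBallDensity N ρ v 0)) := by
    rw [halfBallDensity, Set.indicator_of_mem h0]
    exact h1.mono_left (nhdsWithin_le_of_mem (halfBall_mem_nhdsWithin N hρ))
  refine h2.congr' ?_
  filter_upwards [halfBall_mem_nhdsWithin N hρ] with x hx
  rw [halfBallDensity, Set.indicator_of_mem hx]

lemma sqrt_le_two_mul_norm {N : ℕ} (x : EuclideanSpace ℝ (Fin N) × ℝ) :
    √(‖x.1‖ ^ 2 + x.2 ^ 2) ≤ 2 * ‖x‖ := by
  have h1 : ‖x.1‖ ≤ ‖x‖ := norm_fst_le x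
  have h2 : |x.2| ≤ ‖x‖ := norm_snd_le x
  have h3 : x.2 ^ 2 ≤ ‖x‖ ^ 2 := by
    rw [← sq_abs]
    gcongr
  have h4 : ‖x.1‖ ^ 2 ≤ ‖x‖ ^ 2 := by gcongr
  refine Real.sqrt_le_iff.2 ⟨by positivity, ?_⟩
  nlinarith [sq_nonneg ‖x‖]

lemma exists_smooth_cutoff_s18 (N : ℕ) : ∃ φ : EuclideanSpace ℝ (Fin N) × ℝ → ℂ,
    ContDiff ℝ (⊤ : ℕ∞) φ ∧ tsupport φ ⊆ Metric.closedBall 0 2 ∧ (∀ y, ‖φ y‖ ≤ 1) ∧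
      ∀ y, ‖y‖ < 1 → φ y = 1 := by
  let χ : ContDiffBump (0 : EuclideanSpace ℝ (Fin N) × ℝ) := ⟨1, 2, one_pos, one_lt_two⟩
  refine ⟨fun y => (χ y : ℂ), Complex.ofRealCLM.contDiff.comp χ.contDiff, ?_, fun y => ?_,
    fun y hy => ?_⟩
  · exact (tsupport_comp_subset (g := fun r : ℝ => (r : ℂ)) rfl _).trans χ.tsupport_eq.subset
  · rw [Complex.norm_real, Real.norm_eq_abs, abs_of_nonneg χ.nonneg]
    exact χ.le_one
  · simp only
    rw [χ.one_of_mem_closedBall (by simpa [χ] using hy.le), Complex.ofReal_one]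

/-- Theorem 14 (higher-dimensional boundary pseudo-eigenfunctions): for the operator
`L_h = -h² a^{jk}∂_j∂_k - ih(b^j + h b₁^j)∂_j + (c + h c₁ + h² c₂)` with smooth
coefficients on the half-ball `U`, smooth positive density `v`, and complex covector
`ξ = (ξ', ξ_N)` with `ξ'` real and `Im ξ_N > 0`, there are smooth functions `f_h`
supported in balls of radius `O(h^{1/2})` about the boundary point `0` with
`‖f_h‖ → c > 0` and `‖L_h f_h - σ(0,ξ) f_h‖ = O(h^{1/2})` in `L²(v dx)`. -/
theorem boundary_pseudoeigenfunctions_higher_dim (N : ℕ) (ρ : ℝ) (hρ : 0 < ρ)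
    (a : Fin (N+1) → Fin (N+1) → EuclideanSpace ℝ (Fin N) × ℝ → ℂ)
    (b b₁ : Fin (N+1) → EuclideanSpace ℝ (Fin N) × ℝ → ℂ)
    (c c₁ c₂ : EuclideanSpace ℝ (Fin N) × ℝ → ℂ)
    (v : EuclideanSpace ℝ (Fin N) × ℝ → ℝ)
    (ha : ∀ j k, ContDiffOn ℝ (⊤ : ℕ∞) (a j k) (halfBall N ρ))
    (hb : ∀ j, ContDiffOn ℝ (⊤ : ℕ∞) (b j) (halfBall N ρ))
    (hb₁ : ∀ j, ContDiffOn ℝ (⊤ : ℕ∞) (b₁ j) (halfBall N ρ))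
    (hc : ContDiffOn ℝ (⊤ : ℕ∞) c (halfBall N ρ)) (hc₁ : ContDiffOn ℝ (⊤ : ℕ∞) c₁ (halfBall N ρ))
    (hc₂ : ContDiffOn ℝ (⊤ : ℕ∞) c₂ (halfBall N ρ))
    (hv : ContDiffOn ℝ (⊤ : ℕ∞) v (halfBall N ρ)) (hvpos : ∀ x ∈ halfBall N ρ, 0 < v x)
    (ξ : Fin (N+1) → ℂ)
    (hξreal : ∀ i : Fin (N+1), (i : ℕ) < N → (ξ i).im = 0)
    (hξN : 0 < (ξ (Fin.last N)).im) :
    ∃ c₀ > (0:ℝ), ∃ c' > (0:ℝ), ∃ C > (0:ℝ), ∃ h₀ > (0:ℝ),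
    ∃ f : ℝ → (EuclideanSpace ℝ (Fin N) × ℝ → ℂ),
      Filter.Tendsto
        (fun h => (eLpNorm (f h) 2
          ((volume.restrict (halfBall N ρ)).withDensity
            (fun x => ENNReal.ofReal (v x)))).toReal)
        (𝓝[>] 0) (𝓝 c₀) ∧
      ∀ h ∈ Set.Ioc (0:ℝ) h₀,
        ContDiff ℝ (⊤ : ℕ∞) (f h) ∧
        (∀ x : EuclideanSpace ℝ (Fin N) × ℝ,
          c' * h ^ ((1:ℝ)/2) < Real.sqrt (‖x.1‖^2 + x.2^2) → f h x = 0) ∧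
        eLpNorm (fun x =>
            (-(h:ℂ)^2 * ∑ j, ∑ k, a j k x * pderivC N j (pderivC N k (f h)) x
              - Complex.I * (h:ℂ) * ∑ j, (b j x + (h:ℂ) * b₁ j x) * pderivC N j (f h) x
              + (c x + (h:ℂ) * c₁ x + (h:ℂ)^2 * c₂ x) * f h x)
            - ((∑ j, ∑ k, a j k 0 * ξ j * ξ k) + (∑ j, b j 0 * ξ j) + c 0) * f h x) 2
          ((volume.restrict (halfBall N ρ)).withDensity (fun x => ENNReal.ofReal (v x)))
          ≤ ENNReal.ofReal (C * h ^ ((1:ℝ)/2)) := by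
  obtain ⟨φ, hφ, hφs, hφ1, hφe⟩ := exists_smooth_cutoff_s18 N
  have hφ2 : ∀ y, 2 < ‖y‖ → φ y = 0 := fun y hy =>
    image_eq_zero_of_notMem_tsupport fun h => by
      have := mem_closedBall_zero_iff.1 (hφs h)
      linarith
  set η := (ξ (Fin.last N)).im
  set w := halfBallDensity N ρ v
  have h0 : (0 : EuclideanSpace ℝ (Fin N) × ℝ) ∈ halfBall N ρ := by simp [halfBall, hρ]
  have hw : Measurable w := measurable_halfBallDensity hv.continuousOn
  have hw0 : w 0 = ENNReal.ofReal (v 0) := Set.indicator_of_mem h0 _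
  have hw0top : w 0 ≠ ∞ := hw0 ▸ ENNReal.ofReal_ne_top
  have hw0ne : w 0 ≠ 0 := by
    rw [hw0]
    exact (ENNReal.ofReal_pos.2 (hvpos 0 h0)).ne'
  have hneg : ∀ x, x.2 < 0 → w x = 0 := fun x hx =>
    Set.indicator_of_notMem (fun h => absurd h.1 (not_le.2 hx)) _
  have hlim := tendsto_halfBallDensity hρ hv.continuousOn
  have hMtop : w 0 + 1 ≠ ∞ := ENNReal.add_ne_top.2 ⟨hw0top, ENNReal.one_ne_top⟩
  obtain ⟨δ, hδ, hM⟩ : ∃ δ > 0, ∀ x : EuclideanSpace ℝ (Fin N) × ℝ,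
      0 ≤ x.2 → ‖x‖ ≤ δ → w x ≤ w 0 + 1 := by
    have hev := hlim.eventually_lt_const (ENNReal.lt_add_right hw0top one_ne_zero)
    obtain ⟨δ, hδ, hb⟩ := Metric.mem_nhdsWithin_iff.1 hev
    refine ⟨δ / 2, by positivity, fun x hx hxδ => (hb ⟨?_, hx⟩).le⟩
    rw [mem_ball_zero_iff]
    linarith
  have hμ : (volume.restrict (halfBall N ρ)).withDensity (fun x => ENNReal.ofReal (v x)) =
      volume.withDensity w := (withDensity_indicator (measurableSet_halfBall N ρ) _).symm
  have hae : ∀ᵐ x ∂(volume.withDensity w), x ∈ halfBall N ρ := by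
    rw [← hμ]
    exact (withDensity_absolutelyContinuous _ _).ae_le
      (ae_restrict_mem (measurableSet_halfBall N ρ))
  obtain ⟨hLtop, hL⟩ := tendsto_rescaled_mass hw hMtop hδ hneg hM hlim hw0top hξN
    hφ.continuous hφ1 hφ2
  have hLne : limitMass (w 0) η φ ≠ 0 := limitMass_ne_zero hw0ne η hφ.continuous hφe
  have hDtop := lintegral_packetBound_ne_top N hMtop hξN
  set D := ((∫⁻ z, packetBound N (w 0 + 1) η z) ^ (1 / 2 : ℝ))
  have hDtop' : D ≠ ∞ := ENNReal.rpow_ne_top_of_nonneg (by norm_num) hDtop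
  obtain ⟨K, hK, hKev⟩ := exists_norm_packetError_le hρ ha hb hb₁ hc hc₁ hc₂ ξ hφ hφs
  obtain ⟨s₀, hs₀, hs₀K⟩ := mem_nhdsGT_iff_exists_Ioc_subset.1 hKev
  have hs₀ : 0 < s₀ := hs₀
  let f : ℝ → EuclideanSpace ℝ (Fin N) × ℝ → ℂ := fun h =>
    wavePacket ξ (√(√h ^ (N + 2))⁻¹ : ℝ) (Complex.I / (√h : ℂ) ^ 2) (√h)⁻¹ φ
  refine ⟨((limitMass (w 0) η φ) ^ (1 / 2 : ℝ)).toReal, ?_, 4, by norm_num,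
    K * (D.toReal + 1), by positivity, (min s₀ (δ / 2)) ^ 2, by positivity, f, ?_, ?_⟩
  · refine ENNReal.toReal_pos ?_ (ENNReal.rpow_ne_top_of_nonneg (by norm_num) hLtop)
    simp [ENNReal.rpow_eq_zero_iff, hLne]
  · rw [hμ]
    have hsq : Filter.Tendsto Real.sqrt (𝓝[>] 0) (𝓝[>] 0) := by
      refine tendsto_nhdsWithin_iff.2 ⟨?_, ?_⟩
      · exact (Real.continuous_sqrt.tendsto' 0 0 Real.sqrt_zero).mono_left nhdsWithin_le_nhds
      · filter_upwards [self_mem_nhdsWithin] with h hh using Real.sqrt_pos.2 hh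
    have hcont := (ENNReal.continuous_rpow_const (y := (1 / 2 : ℝ))).tendsto (limitMass (w 0) η φ)
    refine (ENNReal.tendsto_toReal
      (ENNReal.rpow_ne_top_of_nonneg (by norm_num) hLtop)).comp ?_
    refine ((hcont.comp (hL.comp hsq))).congr' ?_
    filter_upwards [self_mem_nhdsWithin] with h hh
    exact (eLpNorm_wavePacket ξ hξreal (Real.sqrt_pos.2 hh) hφ.continuous.measurable hw).symm
  · rintro h ⟨hh, hh₀⟩
    have hs : 0 < √h := Real.sqrt_pos.2 hh
    have hsle : √h ≤ min s₀ (δ / 2) := Real.sqrt_le_iff.2 ⟨by positivity, hh₀⟩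
    rw [← Real.sqrt_eq_rpow]
    refine ⟨contDiff_wavePacket _ _ _ _ hφ, fun x hx => ?_, ?_⟩
    · have hx' : 2 < ‖(√h)⁻¹ • x‖ := by
        rw [norm_smul, norm_inv, Real.norm_eq_abs, abs_of_pos hs, lt_inv_mul_iff₀ hs]
        linarith [sqrt_le_two_mul_norm x]
      simp only [f, wavePacket, hφ2 _ hx', mul_zero]
    · rw [hμ]
      have hhs : (h : ℂ) = (√h : ℂ) ^ 2 := by
        rw [← Complex.ofReal_pow, Real.sq_sqrt hh.le]
      have hop := operator_wavePacket a b b₁ c c₁ c₂ ξ hφ ((√(√h ^ (N + 2))⁻¹ : ℝ) : ℂ)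
        hs.ne' (f := f h) rfl hhs
      simp only [hop]
      set ψ := (Metric.closedBall (0 : EuclideanSpace ℝ (Fin N) × ℝ) 2).indicator
        (fun _ => (1 : ℂ))
      have hψm : Measurable ψ :=
        measurable_const.indicator Metric.isClosed_closedBall.measurableSet
      have hψ1 : ∀ y, ‖ψ y‖ ≤ 1 := fun y => by
        simpa using norm_indicator_le_norm_self (fun _ => (1 : ℂ)) y
      have hψ2 : ∀ y, 2 < ‖y‖ → ψ y = 0 := fun y hy =>
        Set.indicator_of_notMem (by simpa using hy) _
      have hmass : eLpNorm (wavePacket ξ (√(√h ^ (N + 2))⁻¹ : ℝ) (Complex.I / (√h : ℂ) ^ 2)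
          (√h)⁻¹ ψ) 2 (volume.withDensity w) ≤ D := by
        rw [eLpNorm_wavePacket ξ hξreal hs hψm hw]
        refine ENNReal.rpow_le_rpow (lintegral_mono fun z => ?_) (by norm_num)
        refine rescaled_density_le_packetBound hs hneg (fun x hx hxs => hM x hx ?_) η hψ1 hψ2 z
        linarith [hsle.trans (min_le_right _ _)]
      have hle : ∀ᵐ x ∂(volume.withDensity w),
          ‖((√(√h ^ (N + 2))⁻¹ : ℝ) : ℂ) * Complex.exp (Complex.I / (√h : ℂ) ^ 2 * phaseForm ξ x) *
            packetError a b b₁ c c₁ c₂ ξ φ (√h, x)‖ ≤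
          K * √h * ‖wavePacket ξ (√(√h ^ (N + 2))⁻¹ : ℝ) (Complex.I / (√h : ℂ) ^ 2)
            (√h)⁻¹ ψ x‖ := by
        filter_upwards [hae] with x hx
        have := hs₀K ⟨hs, hsle.trans (min_le_left _ _)⟩ x hx
        rw [wavePacket, norm_mul, norm_mul (_ * _) (ψ _), mul_left_comm]
        exact mul_le_mul_of_nonneg_left this (norm_nonneg _)
      refine (eLpNorm_le_mul_eLpNorm_of_ae_le_mul hle 2).trans ?_
      refine (mul_le_mul_right hmass _).trans ?_
      rw [← ENNReal.ofReal_toReal hDtop', ← ENNReal.ofReal_mul (by positivity)]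
      refine ENNReal.ofReal_le_ofReal ?_
      rw [ENNReal.toReal_ofReal ENNReal.toReal_nonneg]
      nlinarith [mul_pos hK hs]
end
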